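/- Assume GRH, let q ≥ 3, and let μ_q be a Borel probability measure on ℝ such that for every bounded Lipschitz continuous f : ℝ → ℝ, lim_{Y→∞} (1/Y)·∫₂^Y f(E_q(e^y)) dy = ∫_ℝ f dμ_q. Then the variance of μ_q satisfies ∫_ℝ t² dμ_q(t) − (∫_ℝ t dμ_q(t))² = Σ*_{γ ≠ 0} m_γ²/(1/4 + γ²), where the sum runs over the distinct nonzero real numbers γ such that 1/2 + iγ is a zero of Z_q(s) := ∏_{χ² = χ₀, χ ≠ χ₀} L(s,χ) (product over the nontrivial real Dirichlet characters mod q), and m_γ denotes the multiplicity (analytic order) of the zero 1/2 + iγ of Z_q. -/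

import Mathlib

open Filter Topology MeasureTheory

noncomputable section

/-- The L-function of a Dirichlet character mod `q`, as a total function (junk value `0`
when `q = 0`). -/
def LFun (q : ℕ) (χ : DirichletCharacter ℂ q) (s : ℂ) : ℂ :=
  if h : q ≠ 0 then
    haveI : NeZero q := ⟨h⟩
    DirichletCharacter.LFunction χ s
  else 0

/-- GRH for all Dirichlet L-functions. -/
def GRH : Prop :=
  ∀ (N : ℕ) (χ : DirichletCharacter ℂ N), N ≠ 0 → χ.IsPrimitive →
    ∀ s : ℂ, 0 < s.re → s.re < 1 → LFun N χ s = 0 → s.re = 1 / 2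

/-- The set of nonnegative imaginary parts of nontrivial zeros of L-functions of primitive
Dirichlet characters mod `q`. -/
def LISet (q : ℕ) : Set ℝ :=
  {γ : ℝ | 0 ≤ γ ∧ ∃ χ : DirichletCharacter ℂ q, χ.IsPrimitive ∧
    ∃ s : ℂ, 0 < s.re ∧ s.re < 1 ∧ s.im = γ ∧ LFun q χ s = 0}

/-- The Linear Independence hypothesis for modulus `q`. -/
def LI (q : ℕ) : Prop :=
  LinearIndependent ℚ ((↑) : LISet q → ℝ)

/-- Number of primes `p ≤ x` with `p ≡ a (mod q)`. -/
def primePi (q : ℕ) (a : ZMod q) (x : ℝ) : ℕ :=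
  Nat.card {p : ℕ | p.Prime ∧ (p : ℝ) ≤ x ∧ (p : ZMod q) = a}

/-- Number of primes `p ≤ x` whose residue class mod `q` is a square in `(ZMod q)ˣ`. -/
def primePiR (q : ℕ) (x : ℝ) : ℕ :=
  Nat.card {p : ℕ | p.Prime ∧ (p : ℝ) ≤ x ∧
    ∃ u : (ZMod q)ˣ, ((u : ZMod q)) ^ 2 = (p : ZMod q)}

/-- Number of primes `p ≤ x` coprime to `q` whose residue class mod `q` is not a square
in `(ZMod q)ˣ`. -/
def primePiNR (q : ℕ) (x : ℝ) : ℕ :=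
  Nat.card {p : ℕ | p.Prime ∧ (p : ℝ) ≤ x ∧ IsUnit (p : ZMod q) ∧
    ¬ ∃ u : (ZMod q)ˣ, ((u : ZMod q)) ^ 2 = (p : ZMod q)}

/-- `ρ(q)`: the index of the subgroup of squares in `(ZMod q)ˣ`. -/
def rho (q : ℕ) : ℕ :=
  (MonoidHom.range (powMonoidHom 2 : (ZMod q)ˣ →* (ZMod q)ˣ)).index

/-- Partial logarithmic averages of a set of naturals. -/
def logSum (P : Set ℕ) (N : ℕ) : ℝ :=
  (Real.log N)⁻¹ * ∑ n ∈ Finset.range (N + 1), Set.indicator P (fun n => (n : ℝ)⁻¹) n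

/-- `P` has logarithmic density `d`. -/
def HasLogDensity (P : Set ℕ) (d : ℝ) : Prop :=
  Filter.Tendsto (logSum P) Filter.atTop (nhds d)

/-- The set of `n` for which non-residues beat residues:
`π(n;q,NR) > (ρ(q)-1)·π(n;q,R)`. -/
def raceNR (q : ℕ) : Set ℕ :=
  {n : ℕ | ((rho q : ℝ) - 1) * primePiR q n < primePiNR q n}

open Classical in
/-- The multiplicity (analytic order) of `s` as a zero of `f`. -/
def zeroMult (f : ℂ → ℂ) (s : ℂ) : ℕ :=
  if h : ∃ n : ℕ, ∃ g : ℂ → ℂ, AnalyticAt ℂ g s ∧ g s ≠ 0 ∧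
      (∀ᶠ z in nhds s, f z = (z - s) ^ n * g z)
  then h.choose else 0

/-- The product of the L-functions of the nontrivial real (quadratic) characters mod `q`. -/
def Zfun (q : ℕ) (s : ℂ) : ℂ :=
  ∏ᶠ χ ∈ {χ : DirichletCharacter ℂ q | χ ^ 2 = 1 ∧ χ ≠ 1}, LFun q χ s

/-- `∑_γ m(γ)/(1/4+γ²)`, the sum over the zeros `1/2+iγ` of `L(s,χ)`, with multiplicity. -/
def zeroSumInv (q : ℕ) (χ : DirichletCharacter ℂ q) : ℝ :=
  ∑' γ : ℝ, (zeroMult (LFun q χ) (1 / 2 + γ * Complex.I) : ℝ) / (1 / 4 + γ ^ 2)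

/-- `ω(q)`: number of distinct prime factors. -/
def omega (q : ℕ) : ℕ := q.primeFactors.card

/-- The radical `q' = ∏_{p ∣ q} p`. -/
def radical (q : ℕ) : ℕ := ∏ p ∈ q.primeFactors, p

/-- The race set for a general linear combination of prime counting functions. -/
def raceSet (q : ℕ) {k : ℕ} (a : Fin k → (ZMod q)ˣ) (α : Fin k → ℝ) : Set ℕ :=
  {n : ℕ | 0 < ∑ i, α i * primePi q ((a i : ZMod q)) n}

/-- `E_q(x) = (π(x;q,NR) − (ρ(q)−1)π(x;q,R))·log x/√x`. -/
def Efun (q : ℕ) (x : ℝ) : ℝ :=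
  ((primePiNR q x : ℝ) - ((rho q : ℝ) - 1) * primePiR q x) * Real.log x / Real.sqrt x

/-- `μ` is the limiting logarithmic distribution of `E_q(e^y)`. -/
def IsLimitingDistribution (q : ℕ) (μ : Measure ℝ) : Prop :=
  IsProbabilityMeasure μ ∧
    ∀ f : ℝ → ℝ, (∃ C : ℝ, ∀ x, |f x| ≤ C) → (∃ K : NNReal, LipschitzWith K f) →
      Tendsto (fun Y : ℝ => (1 / Y) * ∫ y in (2:ℝ)..Y, f (Efun q (Real.exp y)))
        atTop (nhds (∫ t, f t ∂μ))

/-- `S(q)`: sum over the nontrivial real characters mod `q` of `∑_γ m(γ)/(1/4+γ²)`. -/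
def Sq (q : ℕ) : ℝ :=
  ∑ᶠ χ ∈ {χ : DirichletCharacter ℂ q | χ ^ 2 = 1 ∧ χ ≠ 1}, zeroSumInv q χ

/-- The standard normal distribution function `Φ`. -/
def normalCDF (x : ℝ) : ℝ :=
  (Real.sqrt (2 * Real.pi))⁻¹ * ∫ t in Set.Iic x, Real.exp (-t ^ 2 / 2)

end

open scoped Classical
open Asymptotics

/-- Dividing a bounded holomorphic function on a disc by Blaschke factors: all the zeros in a
smaller disc can be removed, and their number is controlled by the size of the function. -/
lemma exists_blaschke_quotient {M : ℝ} (n : ℕ) : ∀ F : ℂ → ℂ,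
    DifferentiableOn ℂ F (Metric.ball 0 2) →
    (∀ z ∈ Metric.closedBall (0 : ℂ) 1.9, ‖F z‖ ≤ M) → F 0 ≠ 0 →
    M < (1.9 / 1.6) ^ n * ‖F 0‖ →
    ∃ (Z : Multiset ℂ) (h : ℂ → ℂ), Z.card ≤ n ∧ (∀ ρ ∈ Z, ‖ρ‖ ≤ 1.6 ∧ F ρ = 0) ∧
      DifferentiableOn ℂ h (Metric.ball 0 2) ∧
      (∀ z ∈ Metric.closedBall (0 : ℂ) 1.6, h z ≠ 0) ∧
      (∀ z ∈ Metric.closedBall (0 : ℂ) 1.9, ‖h z‖ ≤ M) ∧ ‖F 0‖ ≤ ‖h 0‖ ∧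
      ∀ z ∈ Metric.ball (0 : ℂ) 1.6, F z ≠ 0 →
        ‖logDeriv F z - logDeriv h z - (Z.map fun ρ => 1 / (z - ρ)).sum‖ ≤ 2 * Z.card := by
  induction n with
  | zero =>
    intro F _ hM _ h
    have := hM 0 (by simp; norm_num)
    simp at h
    linarith
  | succ n ih =>
    intro F hF hM hF0 hlt
    by_cases hz : ∀ z ∈ Metric.closedBall (0 : ℂ) 1.6, F z ≠ 0
    · exact ⟨0, F, by simp, by simp, hF, hz, hM, le_rfl, by simp⟩
    push Not at hz
    obtain ⟨ρ, hρ, hFρ⟩ := hz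
    have hρn : ‖ρ‖ ≤ 1.6 := by simpa using hρ
    have hρ0 : ρ ≠ 0 := fun h => hF0 (h ▸ hFρ)
    have hρpos : 0 < ‖ρ‖ := norm_pos_iff.2 hρ0
    have hball : Metric.ball (0 : ℂ) 2 ∈ 𝓝 ρ :=
      Metric.isOpen_ball.mem_nhds (by simp; norm_num at hρn ⊢; linarith)
    set B : ℂ → ℂ := fun z => (1.9 ^ 2 - (starRingEnd ℂ) ρ * z) / 1.9 with hB
    set h1 : ℂ → ℂ := fun z => dslope F ρ z * B z with hh1
    have hBd : Differentiable ℂ B := by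
      intro z; simp only [hB]; fun_prop
    have hdsl : DifferentiableOn ℂ (dslope F ρ) (Metric.ball 0 2) :=
      (Complex.differentiableOn_dslope hball).2 hF
    have hh1d : DifferentiableOn ℂ h1 (Metric.ball 0 2) := hdsl.mul hBd.differentiableOn
    have hmul : ∀ z, (z - ρ) * dslope F ρ z = F z := by
      intro z
      have := sub_smul_dslope F ρ z
      simpa [hFρ] using this
    have hBne : ∀ z ∈ Metric.closedBall (0 : ℂ) 1.9, B z ≠ 0 := by
      intro z hz h
      simp only [hB, div_eq_zero_iff, sub_eq_zero] at h
      rcases h with h | h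
      · have h2 := congrArg norm h
        simp at h2 hz
        norm_num at h2 hz hρn
        nlinarith [norm_nonneg z, norm_nonneg ρ]
      · norm_num at h
    have hsph : ∀ z : ℂ, ‖z‖ = 1.9 → ‖B z‖ = ‖z - ρ‖ := by
      intro z hz
      have h2 : (1.9 : ℂ) ^ 2 = (starRingEnd ℂ) z * z := by
        rw [mul_comm, Complex.mul_conj, Complex.normSq_eq_norm_sq, hz]
        push_cast; norm_num
      have : B z = (starRingEnd ℂ) (z - ρ) * z / 1.9 := by
        simp only [hB, h2, map_sub]; ring
      rw [this, norm_div, norm_mul, RCLike.norm_conj, hz]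
      norm_num
    have hclos : ∀ z ∈ Metric.closedBall (0 : ℂ) 1.9, ‖h1 z‖ ≤ M := by
      intro z hz
      have hcl : closure (Metric.ball (0 : ℂ) 1.9) = Metric.closedBall 0 1.9 :=
        closure_ball _ (by norm_num)
      refine Complex.norm_le_of_forall_mem_frontier_norm_le (U := Metric.ball (0 : ℂ) 1.9)
        Metric.isBounded_ball ?_ ?_ (hcl ▸ hz)
      · refine (hh1d.mono ?_).diffContOnCl
        rw [hcl]
        exact Metric.closedBall_subset_ball (by norm_num)
      · intro w hw
        rw [frontier_ball _ (by norm_num)] at hw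
        have hw' : ‖w‖ = 1.9 := by simpa using hw
        have : ‖h1 w‖ = ‖F w‖ := by
          rw [← hmul w, hh1]
          simp only [norm_mul, hsph w hw']
          ring
        rw [this]
        exact hM w (by simp [hw'])
    have hB0 : B 0 = 1.9 := by simp [hB]; norm_num
    have h10 : h1 0 = -(F 0) / ρ * 1.9 := by
      have := hmul 0
      simp only [hh1, hB0]
      rw [← this]; field_simp; ring
    have h10n : (1.9 / 1.6) * ‖F 0‖ ≤ ‖h1 0‖ := by
      rw [h10, norm_mul, norm_div, norm_neg]
      have : ‖(1.9 : ℂ)‖ = 1.9 := by norm_num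
      rw [this, div_mul_eq_mul_div, div_mul_eq_mul_div, mul_comm (1.9 : ℝ)]
      gcongr
    have hF0pos : 0 < ‖F 0‖ := norm_pos_iff.2 hF0
    obtain ⟨Z, h, hcard, hZ, hd, hne, hbd, h0, hlog⟩ := ih h1 hh1d hclos
      (norm_pos_iff.1 (by linarith [mul_pos (by norm_num : (0:ℝ) < 1.9 / 1.6) hF0pos]))
      (by
        refine hlt.trans_le ?_
        rw [pow_succ, mul_assoc]
        gcongr)
    have hzero : ∀ z ∈ Metric.closedBall (0 : ℂ) 1.9, F z ≠ 0 → h1 z ≠ 0 := by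
      intro z hz hFz
      have := hmul z
      refine mul_ne_zero (fun h => hFz ?_) (hBne z hz)
      rw [← this, h, mul_zero]
    refine ⟨ρ ::ₘ Z, h, by simpa using hcard, ?_, hd, hne, hbd, ?_, ?_⟩
    · intro τ hτ
      rcases Multiset.mem_cons.1 hτ with rfl | hτ
      · exact ⟨hρn, hFρ⟩
      · refine ⟨(hZ τ hτ).1, ?_⟩
        by_contra hcon
        exact hzero τ (by simp; exact (hZ τ hτ).1.trans (by norm_num)) hcon (hZ τ hτ).2
    · refine le_trans ?_ h0
      refine le_trans ?_ h10n
      norm_num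
      linarith
    · intro z hz hFz
      have hzn : ‖z‖ < 1.6 := by simpa using hz
      have hz9 : z ∈ Metric.closedBall (0 : ℂ) 1.9 := by
        simp; exact hzn.le.trans (by norm_num)
      have hz2 : Metric.ball (0 : ℂ) 2 ∈ 𝓝 z :=
        Metric.isOpen_ball.mem_nhds (by simp; exact hzn.trans (by norm_num))
      have hne1 := hzero z hz9 hFz
      have hIH := hlog z hz hne1
      have hzρ : z - ρ ≠ 0 := fun h => hFz (by rw [← hmul z, h, zero_mul])
      have hds : dslope F ρ z ≠ 0 := fun h => hFz (by rw [← hmul z, h, mul_zero])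
      have hFl : logDeriv F z = 1 / (z - ρ) + logDeriv (dslope F ρ) z := by
        have : F = fun z => (z - ρ) * dslope F ρ z := by ext w; exact (hmul w).symm
        conv_lhs => rw [this]
        rw [logDeriv_mul (f := fun z => z - ρ) _ hzρ hds (by fun_prop)
          (hdsl.differentiableAt hz2)]
        simp [logDeriv_apply]
      have hl1 : logDeriv h1 z = logDeriv (dslope F ρ) z + logDeriv B z :=
        logDeriv_mul _ hds (hBne z hz9) (hdsl.differentiableAt hz2) (hBd z)
      have hBl : ‖logDeriv B z‖ ≤ 2 := by
        have hderiv : deriv B z = -(starRingEnd ℂ) ρ / 1.9 := by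
          simp only [hB]
          simp
        have hlow : 1.05 ≤ ‖1.9 ^ 2 - (starRingEnd ℂ) ρ * z‖ := by
          have := norm_sub_norm_le ((1.9 : ℂ) ^ 2) ((starRingEnd ℂ) ρ * z)
          rw [norm_mul, RCLike.norm_conj, norm_pow] at this
          have h19 : ‖(1.9 : ℂ)‖ = 1.9 := by norm_num
          rw [h19] at this
          nlinarith [norm_nonneg z, norm_nonneg ρ]
        rw [logDeriv_apply, hderiv, hB]
        simp only
        rw [div_div_div_cancel_right₀ (by norm_num), norm_div, norm_neg, RCLike.norm_conj,
          div_le_iff₀ (by linarith)]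
        linarith
      have : logDeriv F z - logDeriv h z - ((ρ ::ₘ Z).map fun ρ => 1 / (z - ρ)).sum =
          (logDeriv h1 z - logDeriv h z - (Z.map fun ρ => 1 / (z - ρ)).sum) - logDeriv B z := by
        rw [hFl, hl1]; simp; ring
      rw [this]
      refine (norm_sub_le _ _).trans ?_
      push_cast [Multiset.card_cons]
      linarith

/-- Borel–Carathéodory bound for the logarithmic derivative of a zero-free function. -/
lemma exists_norm_logDeriv_le : ∃ K : ℝ, 0 < K ∧ ∀ (h : ℂ → ℂ) (L : ℝ), 0 < L →
    DifferentiableOn ℂ h (Metric.ball 0 2) →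
    (∀ z ∈ Metric.closedBall (0 : ℂ) 1.6, h z ≠ 0) →
    (∀ z ∈ Metric.closedBall (0 : ℂ) 1.6, ‖h z‖ ≤ Real.exp L * ‖h 0‖) →
    ∀ z ∈ Metric.ball (0 : ℂ) 1.59, ‖logDeriv h z‖ ≤ K * L := by
  refine ⟨2 * 1.595 / (1.6 - 1.595) / 0.0049, by norm_num, ?_⟩
  intro h L hL hd hne hb z hz
  have hsub : Metric.ball (0 : ℂ) 1.6 ⊆ Metric.ball 0 2 := Metric.ball_subset_ball (by norm_num)
  have hsubc : Metric.ball (0 : ℂ) 1.6 ⊆ Metric.closedBall 0 1.6 := Metric.ball_subset_closedBall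
  have hld : DifferentiableOn ℂ (logDeriv h) (Metric.ball 0 1.6) := by
    refine ((hd.deriv Metric.isOpen_ball).mono hsub).div (hd.mono hsub) fun w hw => hne w (hsubc hw)
  obtain ⟨φ₀, hφ₀⟩ := hld.isExactOn_ball
  set φ : ℂ → ℂ := fun w => φ₀ w - φ₀ 0 with hφ
  have hφd : ∀ w ∈ Metric.ball (0 : ℂ) 1.6, HasDerivAt φ (logDeriv h w) w := fun w hw =>
    (hφ₀ w hw).sub_const _
  have h0mem : (0 : ℂ) ∈ Metric.ball (0 : ℂ) 1.6 := by simp; norm_num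
  have hconst : ∀ w ∈ Metric.ball (0 : ℂ) 1.6, h w * Complex.exp (-φ w) = h 0 := by
    intro w hw
    have hder : ∀ w ∈ Metric.ball (0 : ℂ) 1.6,
        HasDerivAt (fun w => h w * Complex.exp (-φ w)) 0 w := by
      intro w hw
      have h1 : HasDerivAt h (deriv h w) w :=
        (hd.differentiableAt (Metric.isOpen_ball.mem_nhds (hsub hw))).hasDerivAt
      have h2 : HasDerivAt (fun w => h w * Complex.exp (-φ w)) _ w :=
        h1.mul ((hφd w hw).neg.cexp)
      refine h2.congr_deriv ?_
      rw [logDeriv_apply]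
      have := hne w (hsubc hw)
      simp only [Pi.neg_apply]
      field_simp
      ring
    have := Metric.isOpen_ball.is_const_of_deriv_eq_zero (convex_ball (0 : ℂ) 1.6).isPreconnected
      (fun w hw => (hder w hw).differentiableAt.differentiableWithinAt)
      (fun w hw => (hder w hw).deriv) hw h0mem
    simpa [hφ] using this
  have hre : ∀ w ∈ Metric.ball (0 : ℂ) 1.6, (φ w).re ≤ L := by
    intro w hw
    have h0 : 0 < ‖h 0‖ := norm_pos_iff.2 (hne 0 (hsubc h0mem))
    have h1 := congrArg norm (hconst w hw)
    rw [norm_mul, Complex.norm_exp, Complex.neg_re, Real.exp_neg] at h1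
    have h2 := hb w (hsubc hw)
    rw [← Real.exp_le_exp]
    have h3 : ‖h w‖ = ‖h 0‖ * Real.exp (φ w).re := by
      rw [← h1]; field_simp
    rw [h3, mul_comm] at h2
    exact le_of_mul_le_mul_right h2 h0
  have hzn : ‖z‖ < 1.59 := by simpa using hz
  have hbc : ∀ w ∈ Metric.ball (0 : ℂ) 1.595, ‖φ w‖ ≤ 2 * L * 1.595 / (1.6 - 1.595) := by
    intro w hw
    have hw' : ‖w‖ < 1.595 := by simpa using hw
    have := Complex.borelCaratheodory_zero (R := 1.6) hL
      (fun w hw => (hφd w hw).differentiableAt.differentiableWithinAt) hre (by norm_num)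
      (by simp; linarith : w ∈ Metric.ball (0 : ℂ) 1.6) (by simp [hφ])
    refine this.trans ?_
    gcongr
  have hzm : z ∈ Metric.ball (0 : ℂ) 1.6 := by simp; linarith
  rw [← (hφd z hzm).deriv]
  have hsubz : Metric.closedBall z 0.0049 ⊆ Metric.ball (0 : ℂ) 1.595 := by
    intro w hw
    have h1 : ‖w - z‖ ≤ 0.0049 := by simpa [dist_eq_norm] using hw
    have h2 := norm_le_norm_add_norm_sub' w z
    simp
    linarith
  have hsub2 : Metric.ball (0 : ℂ) 1.595 ⊆ Metric.ball 0 1.6 :=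
    Metric.ball_subset_ball (by norm_num)
  have := Complex.norm_deriv_le_of_forall_mem_sphere_norm_le (f := φ) (c := z) (R := 0.0049)
    (C := 2 * L * 1.595 / (1.6 - 1.595)) (by norm_num)
    (DifferentiableOn.diffContOnCl (fun w hw => (hφd w (hsub2 (hsubz
      (Metric.closure_ball_subset_closedBall hw)))).differentiableAt.differentiableWithinAt))
    (fun w hw => hbc w (hsubz (Metric.sphere_subset_closedBall hw)))
  refine this.trans (le_of_eq ?_)
  ring

/-- Holomorphic functions of polynomial growth on vertical strips to the right of `0`, bounded below
on `Re s = 2`, all of whose zeros to the right of `0` lie on the line `Re s = 1 / 2`. -/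
structure IsRiemannType (f : ℂ → ℂ) : Prop where
  diff : DifferentiableOn ℂ f {s | 0 < s.re}
  growth : ∃ (C : ℝ) (A : ℕ), 0 < C ∧
    ∀ s : ℂ, 0.1 ≤ s.re → s.re ≤ 3.9 → ‖f s‖ ≤ C * (1 + |s.im|) ^ A
  lower : ∃ c : ℝ, 0 < c ∧ ∀ t : ℝ, c ≤ ‖f (2 + t * Complex.I)‖
  zeros : ∀ s : ℂ, 0 < s.re → f s = 0 → s.re = 1 / 2

lemma half_le_log_abs_add_two (t : ℝ) : 1 / 2 ≤ Real.log (|t| + 2) := by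
  have h1 := Real.log_two_gt_d9
  have h2 : Real.log 2 ≤ Real.log (|t| + 2) := Real.log_le_log (by norm_num) (by simp)
  linarith

lemma exists_growth_le_exp (C c : ℝ) (hC : 0 < C) (hc : 0 < c) (A : ℕ) : ∃ K : ℝ, 0 < K ∧
    ∀ t : ℝ, C * (3 + |t|) ^ A ≤ c * Real.exp (K * Real.log (|t| + 2)) := by
  refine ⟨2 * |Real.log (C / c)| + 2 * A + 1, by positivity, fun t => ?_⟩
  have hl := half_le_log_abs_add_two t
  have hpos : 0 < |t| + 2 := by positivity
  have h1 : (3 + |t|) ^ A ≤ Real.exp (2 * A * Real.log (|t| + 2)) := by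
    have : Real.exp (2 * A * Real.log (|t| + 2)) = ((|t| + 2) ^ 2) ^ A := by
      rw [← pow_mul, ← Real.rpow_natCast, Real.rpow_def_of_pos hpos]
      push_cast; ring_nf
    rw [this]
    gcongr
    nlinarith [abs_nonneg t]
  have h2 : C ≤ c * Real.exp (2 * |Real.log (C / c)| * Real.log (|t| + 2)) := by
    have : C = c * Real.exp (Real.log (C / c)) := by
      rw [Real.exp_log (by positivity)]; field_simp
    conv_lhs => rw [this]
    gcongr
    nlinarith [le_abs_self (Real.log (C / c)), abs_nonneg (Real.log (C / c))]
  calc C * (3 + |t|) ^ A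
      ≤ c * Real.exp (2 * |Real.log (C / c)| * Real.log (|t| + 2)) *
        Real.exp (2 * A * Real.log (|t| + 2)) := by gcongr
    _ ≤ _ := by
      rw [mul_assoc, ← Real.exp_add]
      gcongr
      nlinarith

/-- Local partial fraction expansion of the logarithmic derivative. -/
lemma IsRiemannType.exists_local_expansion {f : ℂ → ℂ} (hf : IsRiemannType f) :
    ∃ K : ℝ, 0 < K ∧ ∀ t₀ : ℝ, ∃ Z : Multiset ℂ, (Z.card : ℝ) ≤ K * Real.log (|t₀| + 2) ∧
      (∀ ρ ∈ Z, ρ.re = 1 / 2) ∧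
      ∀ s : ℂ, ‖s - (2 + t₀ * Complex.I)‖ < 1.59 → f s ≠ 0 →
        ‖logDeriv f s - (Z.map fun ρ => 1 / (s - ρ)).sum‖ ≤ K * Real.log (|t₀| + 2) := by
  obtain ⟨C, A, hC, hgr⟩ := hf.growth
  obtain ⟨c, hc, hlow⟩ := hf.lower
  obtain ⟨K₁, hK₁, hexp⟩ := exists_growth_le_exp C c hC hc A
  obtain ⟨K₂, hK₂, hBC⟩ := exists_norm_logDeriv_le
  refine ⟨K₂ * K₁ + 2 * (10 * K₁ + 2), by positivity, fun t₀ => ?_⟩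
  set ℓ := Real.log (|t₀| + 2) with hℓ
  have hl : 1 / 2 ≤ ℓ := half_le_log_abs_add_two t₀
  set w : ℂ := 2 + t₀ * Complex.I with hw
  set F : ℂ → ℂ := fun z => f (z + w) with hF
  have hwre : w.re = 2 := by simp [hw]
  have hwim : w.im = t₀ := by simp [hw]
  have hre : ∀ z : ℂ, |(z + w).re - 2| ≤ ‖z‖ := by
    intro z
    rw [Complex.add_re, hwre, add_sub_cancel_right]
    exact Complex.abs_re_le_norm z
  have hFd : DifferentiableOn ℂ F (Metric.ball 0 2) := by
    refine hf.diff.comp (by fun_prop) ?_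
    intro z hz
    have h1 := hre z
    have h2 : ‖z‖ < 2 := by simpa using hz
    have h3 := (abs_le.1 h1).1
    simp only [Set.mem_ofPred_eq]
    linarith
  set M := C * (3 + |t₀|) ^ A with hM
  have hFM : ∀ z ∈ Metric.closedBall (0 : ℂ) 1.9, ‖F z‖ ≤ M := by
    intro z hz
    have h1 := abs_le.1 (hre z)
    have h2 : ‖z‖ ≤ 1.9 := by simpa using hz
    refine (hgr _ (by linarith [h1.1]) (by linarith [h1.2])).trans ?_
    have h3 : |(z + w).im| ≤ 2 + |t₀| := by
      rw [Complex.add_im, hwim]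
      refine (abs_add_le _ _).trans ?_
      have := Complex.abs_im_le_norm z
      linarith
    exact mul_le_mul_of_nonneg_left (pow_le_pow_left₀ (by positivity) (by linarith) A) hC.le
  have hF0c : c ≤ ‖F 0‖ := by simpa [hF, hw] using hlow t₀
  have hF0 : F 0 ≠ 0 := norm_pos_iff.1 (hc.trans_le hF0c)
  have hME : M ≤ Real.exp (K₁ * ℓ) * c := by
    rw [mul_comm]; exact hexp t₀
  set n := ⌊10 * K₁ * ℓ⌋₊ + 1 with hn
  have hnle : (n : ℝ) ≤ (10 * K₁ + 2) * ℓ := by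
    have := Nat.floor_le (by positivity : 0 ≤ 10 * K₁ * ℓ)
    rw [hn]; push_cast
    linarith
  have hngt : K₁ * ℓ < n / 10 := by
    have := Nat.lt_floor_add_one (10 * K₁ * ℓ)
    rw [hn]; push_cast
    linarith
  have hpow : Real.exp (K₁ * ℓ) < (1.9 / 1.6) ^ n := by
    have h1 : Real.exp (1 / 10) ≤ 1.9 / 1.6 := by
      have h := Real.add_one_le_exp (-(1 / 10) : ℝ)
      rw [Real.exp_neg] at h
      have h2 := Real.exp_pos (1 / 10)
      have h3 : (0.9 : ℝ) * Real.exp (1 / 10) ≤ 1 := by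
        calc (0.9 : ℝ) * Real.exp (1 / 10) ≤ (Real.exp (1 / 10))⁻¹ * Real.exp (1 / 10) := by
              gcongr; linarith
          _ = 1 := by field_simp
      norm_num at h3 ⊢
      linarith
    calc Real.exp (K₁ * ℓ) < Real.exp (n / 10) := Real.exp_lt_exp.2 hngt
      _ = Real.exp (1 / 10) ^ n := by rw [← Real.exp_nat_mul]; ring_nf
      _ ≤ _ := by gcongr
  obtain ⟨Z, h, hcard, hZ, hd, hne, hbd, h0, hlog⟩ := exists_blaschke_quotient n F hFd hFM hF0 (by
    refine hME.trans_lt ?_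
    calc _ ≤ Real.exp (K₁ * ℓ) * ‖F 0‖ := by gcongr
      _ < _ := by
        have := norm_pos_iff.2 hF0
        gcongr)
  have hcard' : (Z.card : ℝ) ≤ (10 * K₁ + 2) * ℓ := le_trans (by exact_mod_cast hcard) hnle
  refine ⟨Z.map (· + w), ?_, ?_, ?_⟩
  · rw [Multiset.card_map]
    exact hcard'.trans (mul_le_mul_of_nonneg_right (by nlinarith [mul_pos hK₂ hK₁]) (by linarith))
  · intro ρ hρ
    obtain ⟨τ, hτ, rfl⟩ := Multiset.mem_map.1 hρ
    obtain ⟨h1, h2⟩ := hZ τ hτ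
    refine hf.zeros _ ?_ h2
    have := (abs_le.1 (hre τ)).1
    norm_num at h1
    linarith
  · intro s hs hfs
    have hs0 : s - w ∈ Metric.ball (0 : ℂ) 1.59 := by simpa using hs
    have hs1 : s - w ∈ Metric.ball (0 : ℂ) 1.6 := Metric.ball_subset_ball (by norm_num) hs0
    have h1 := hlog (s - w) hs1 (by simpa [hF] using hfs)
    have h2 := hBC h (K₁ * ℓ) (by positivity) hd hne (fun z hz => by
      refine (hbd z (Metric.closedBall_subset_closedBall (by norm_num) hz)).trans (hME.trans ?_)
      gcongr
      exact hF0c.trans h0) _ hs0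
    have h3 : logDeriv F (s - w) = logDeriv f s := by
      simp only [logDeriv_apply, hF]
      rw [deriv_comp_add_const]
      simp
    have h4 : ((Z.map (· + w)).map fun ρ => 1 / (s - ρ)).sum
        = (Z.map fun ρ => 1 / (s - w - ρ)).sum := by
      rw [Multiset.map_map]
      congr 1
      refine Multiset.map_congr rfl fun x _ => ?_
      simp only [Function.comp]
      congr 1
      ring
    rw [h3] at h1
    rw [h4]
    calc _ = ‖(logDeriv f s - logDeriv h (s - w) - (Z.map fun ρ => 1 / (s - w - ρ)).sum) +
          logDeriv h (s - w)‖ := by congr 1; ring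
      _ ≤ 2 * Z.card + K₂ * (K₁ * ℓ) := (norm_add_le _ _).trans (add_le_add h1 h2)
      _ ≤ _ := by nlinarith

lemma log_abs_add_three_le (t : ℝ) : Real.log (|t| + 3) ≤ 12 * (1 + |t|) ^ (1 / 4 : ℝ) := by
  have h0 : 0 ≤ |t| := abs_nonneg t
  calc Real.log (|t| + 3) ≤ (|t| + 3) ^ (1 / 4 : ℝ) / (1 / 4) :=
        Real.log_le_rpow_div (by positivity) (by norm_num)
    _ ≤ (3 * (1 + |t|)) ^ (1 / 4 : ℝ) / (1 / 4) := by
        gcongr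
        linarith
    _ = 4 * (3 ^ (1 / 4 : ℝ) * (1 + |t|) ^ (1 / 4 : ℝ)) := by
        rw [Real.mul_rpow (by norm_num) (by positivity)]; ring
    _ ≤ 4 * (3 ^ (1 : ℝ) * (1 + |t|) ^ (1 / 4 : ℝ)) := by
        gcongr <;> norm_num
    _ = _ := by rw [Real.rpow_one]; ring

lemma norm_sum_multiset_le (Z : Multiset ℂ) (s : ℂ) :
    ‖(Z.map fun ρ => 1 / (s - ρ)).sum‖ ≤ (Z.map fun ρ => 1 / ‖s - ρ‖).sum := by
  induction Z using Multiset.induction_on with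
  | empty => simp
  | cons a Z ih =>
    simp only [Multiset.map_cons, Multiset.sum_cons]
    refine (norm_add_le _ _).trans (add_le_add ?_ ih)
    simp

/-- Pointwise bound for the logarithmic derivative away from the critical line. -/
lemma IsRiemannType.norm_logDeriv_le {f : ℂ → ℂ} (hf : IsRiemannType f) {ε : ℝ} (hε : 0 < ε) :
    ∃ C : ℝ, 0 < C ∧ ∀ s : ℂ, 1 / 2 + ε ≤ s.re → s.re ≤ 3 →
      ‖logDeriv f s‖ ≤ C * (1 + |s.im|) ^ (1 / 4 : ℝ) := by
  obtain ⟨K, hK, h⟩ := hf.exists_local_expansion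
  refine ⟨K * (1 + 1 / ε) * 12, by positivity, fun s hs1 hs2 => ?_⟩
  obtain ⟨Z, hcard, hZ, hexp⟩ := h s.im
  have hs : ‖s - (2 + s.im * Complex.I)‖ < 1.59 := by
    have : s - (2 + s.im * Complex.I) = ((s.re - 2 : ℝ) : ℂ) := by
      apply Complex.ext <;> simp
    rw [this, Complex.norm_real, Real.norm_eq_abs, abs_lt]
    constructor <;> norm_num <;> linarith
  have hfs : f s ≠ 0 := fun h0 => by
    have := hf.zeros s (by linarith) h0
    linarith
  have h1 := hexp s hs hfs
  have h2 : (Z.map fun ρ => 1 / ‖s - ρ‖).sum ≤ Z.card * (1 / ε) := by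
    have : ∀ x ∈ Z.map (fun ρ => 1 / ‖s - ρ‖), x ≤ 1 / ε := by
      intro x hx
      obtain ⟨ρ, hρ, rfl⟩ := Multiset.mem_map.1 hx
      apply one_div_le_one_div_of_le hε
      have h3 := Complex.abs_re_le_norm (s - ρ)
      rw [Complex.sub_re, hZ ρ hρ] at h3
      exact le_trans (le_trans (by linarith) (le_abs_self _)) h3
    have h4 := Multiset.sum_le_card_nsmul _ _ this
    simpa using h4
  have h5 : Real.log (|s.im| + 2) ≤ Real.log (|s.im| + 3) :=
    Real.log_le_log (by positivity) (by linarith)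
  have h6 := log_abs_add_three_le s.im
  have h7 : ‖logDeriv f s‖ ≤ K * Real.log (|s.im| + 2) + Z.card * (1 / ε) := by
    calc ‖logDeriv f s‖ = ‖(logDeriv f s - (Z.map fun ρ => 1 / (s - ρ)).sum) +
          (Z.map fun ρ => 1 / (s - ρ)).sum‖ := by congr 1; ring
      _ ≤ _ := (norm_add_le _ _).trans (add_le_add h1 ((norm_sum_multiset_le Z s).trans h2))
  calc _ ≤ K * Real.log (|s.im| + 2) + Z.card * (1 / ε) := h7
    _ ≤ K * Real.log (|s.im| + 2) + K * Real.log (|s.im| + 2) * (1 / ε) := by gcongr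
    _ = K * (1 + 1 / ε) * Real.log (|s.im| + 2) := by ring
    _ ≤ K * (1 + 1 / ε) * (12 * (1 + |s.im|) ^ (1 / 4 : ℝ)) := by gcongr; linarith
    _ = _ := by ring

lemma lintegral_cauchy_kernel {ε : ℝ} (hε : 0 < ε) (γ : ℝ) :
    ∫⁻ t : ℝ, ENNReal.ofReal (1 / (ε ^ 2 + (t - γ) ^ 2)) = ENNReal.ofReal (Real.pi / ε) := by
  rw [lintegral_sub_right_eq_self (fun t : ℝ => ENNReal.ofReal (1 / (ε ^ 2 + t ^ 2))) γ]
  have h1 : ∀ t : ℝ, 1 / (ε ^ 2 + t ^ 2) = (ε ^ 2)⁻¹ * (1 + (ε⁻¹ * t) ^ 2)⁻¹ := by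
    intro t; field_simp
  have h2 : Integrable fun t : ℝ => 1 / (ε ^ 2 + t ^ 2) := by
    simp_rw [h1]
    exact ((integrable_comp_mul_left_iff (fun t : ℝ => (1 + t ^ 2)⁻¹) (by positivity)).2
      integrable_inv_one_add_sq).const_mul _
  rw [← ofReal_integral_eq_lintegral_ofReal h2 (Eventually.of_forall fun t => by positivity)]
  congr 1
  simp_rw [h1]
  rw [integral_const_mul, Measure.integral_comp_mul_left (fun t : ℝ => (1 + t ^ 2)⁻¹),
    integral_univ_inv_one_add_sq]
  rw [inv_inv, abs_of_pos hε, smul_eq_mul]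
  field_simp

/-- Mean square of the logarithmic derivative over a unit interval. -/
lemma IsRiemannType.exists_unit_mean_sq {f : ℂ → ℂ} (hf : IsRiemannType f) :
    ∃ K : ℝ, 0 < K ∧ ∀ ε : ℝ, 0 < ε → ε ≤ 1 / 2 → ∀ n : ℤ,
      ENNReal.ofReal ε * ∫⁻ t in Set.Ico (n : ℝ) (n + 1),
        ‖logDeriv f (1 / 2 + ε + t * Complex.I)‖ₑ ^ 2 ≤
        ENNReal.ofReal (K * (1 + |(n : ℝ)|) ^ (1 / 2 : ℝ)) := by
  obtain ⟨K, hK, h⟩ := hf.exists_local_expansion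
  refine ⟨(2 * K ^ 2 + 2 * K ^ 2 * Real.pi) * 144, by positivity, fun ε hε hε' n => ?_⟩
  obtain ⟨Z, hcard, hZ, hexp⟩ := h (n + 1 / 2)
  set ℓ := Real.log (|(n : ℝ) + 1 / 2| + 2) with hℓ
  have hl : 1 / 2 ≤ ℓ := half_le_log_abs_add_two _
  have hl2 : ℓ ≤ 12 * (1 + |(n : ℝ)|) ^ (1 / 4 : ℝ) := by
    refine le_trans (Real.log_le_log (by positivity) ?_) (log_abs_add_three_le n)
    have := abs_add_le (n : ℝ) (1 / 2)
    rw [abs_of_pos (by norm_num : (0 : ℝ) < 1 / 2)] at this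
    linarith
  have hpt : ∀ t ∈ Set.Ico (n : ℝ) (n + 1),
      ‖logDeriv f (1 / 2 + ε + t * Complex.I)‖ ^ 2 ≤
        2 * K ^ 2 * ℓ ^ 2 + 2 * Z.card * ∑ ρ : Z, 1 / (ε ^ 2 + (t - (ρ : ℂ).im) ^ 2) := by
    intro t ht
    set s : ℂ := 1 / 2 + ε + t * Complex.I with hs
    have hsre : s.re = 1 / 2 + ε := by simp [hs]
    have hsim : s.im = t := by simp [hs]
    have hfs : f s ≠ 0 := fun h0 => by
      have := hf.zeros s (by rw [hsre]; linarith) h0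
      linarith
    have hd : ‖s - (2 + ((n + 1 / 2 : ℝ) : ℂ) * Complex.I)‖ < 1.59 := by
      rw [← sq_lt_sq₀ (norm_nonneg _) (by norm_num), Complex.sq_norm, Complex.normSq_apply]
      have e1 : (s - (2 + ((n + 1 / 2 : ℝ) : ℂ) * Complex.I)).re = ε - 3 / 2 := by
        rw [Complex.sub_re, hsre]; simp; ring
      have e2 : (s - (2 + ((n + 1 / 2 : ℝ) : ℂ) * Complex.I)).im = t - (n + 1 / 2) := by
        rw [Complex.sub_im, hsim]; simp
      rw [e1, e2]
      obtain ⟨ht1, ht2⟩ := ht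
      nlinarith
    have h1 := hexp s (by exact_mod_cast hd) hfs
    have h2 : ‖logDeriv f s‖ ≤ K * ℓ + ∑ ρ : Z, 1 / ‖s - (ρ : ℂ)‖ := by
      have e : ∑ ρ : Z, 1 / ‖s - (ρ : ℂ)‖ = (Z.map fun ρ => 1 / ‖s - ρ‖).sum := by
        rw [← Multiset.map_univ (m := Z) (f := fun ρ : ℂ => 1 / ‖s - ρ‖)]; rfl
      rw [e]
      calc ‖logDeriv f s‖ = ‖(logDeriv f s - (Z.map fun ρ => 1 / (s - ρ)).sum) +
          (Z.map fun ρ => 1 / (s - ρ)).sum‖ := by congr 1; ring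
        _ ≤ _ := (norm_add_le _ _).trans (add_le_add h1 (norm_sum_multiset_le Z s))
    have h3 : (∑ ρ : Z, 1 / ‖s - (ρ : ℂ)‖) ^ 2 ≤
        Z.card * ∑ ρ : Z, (1 / ‖s - (ρ : ℂ)‖) ^ 2 := by
      have := sq_sum_le_card_mul_sum_sq (s := (Finset.univ : Finset Z))
        (f := fun ρ : Z => 1 / ‖s - (ρ : ℂ)‖)
      simpa using this
    have h4 : ∀ ρ : Z, (1 / ‖s - (ρ : ℂ)‖) ^ 2 = 1 / (ε ^ 2 + (t - (ρ : ℂ).im) ^ 2) := by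
      intro ρ
      rw [div_pow, Complex.sq_norm, Complex.normSq_apply, Complex.sub_re, Complex.sub_im, hsre,
        hsim, hZ ρ (Multiset.coe_mem)]
      congr 1 <;> ring
    simp_rw [h4] at h3
    calc ‖logDeriv f s‖ ^ 2 ≤ (K * ℓ + ∑ ρ : Z, 1 / ‖s - (ρ : ℂ)‖) ^ 2 := by gcongr
      _ ≤ 2 * ((K * ℓ) ^ 2 + (∑ ρ : Z, 1 / ‖s - (ρ : ℂ)‖) ^ 2) := add_sq_le
      _ ≤ _ := by nlinarith
  have hI : ∫⁻ t in Set.Ico (n : ℝ) (n + 1),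
        ‖logDeriv f (1 / 2 + ε + t * Complex.I)‖ₑ ^ 2 ≤
      ENNReal.ofReal (2 * K ^ 2 * ℓ ^ 2) +
        ENNReal.ofReal (2 * Z.card) * (Z.card * ENNReal.ofReal (Real.pi / ε)) := by
    calc ∫⁻ t in Set.Ico (n : ℝ) (n + 1), ‖logDeriv f (1 / 2 + ε + t * Complex.I)‖ₑ ^ 2
        ≤ ∫⁻ t in Set.Ico (n : ℝ) (n + 1), (ENNReal.ofReal (2 * K ^ 2 * ℓ ^ 2) +
          ENNReal.ofReal (2 * Z.card) *
            ∑ ρ : Z, ENNReal.ofReal (1 / (ε ^ 2 + (t - (ρ : ℂ).im) ^ 2))) := by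
          refine setLIntegral_mono' measurableSet_Ico fun t ht => ?_
          rw [← ofReal_norm, ← ENNReal.ofReal_pow (norm_nonneg _),
            ← ENNReal.ofReal_sum_of_nonneg (fun i _ => by positivity),
            ← ENNReal.ofReal_mul (by positivity), ← ENNReal.ofReal_add (by positivity)
              (mul_nonneg (by positivity) (Finset.sum_nonneg fun i _ => by positivity))]
          exact ENNReal.ofReal_le_ofReal (hpt t ht)
      _ ≤ ENNReal.ofReal (2 * K ^ 2 * ℓ ^ 2) + ∫⁻ t, ENNReal.ofReal (2 * Z.card) *
            ∑ ρ : Z, ENNReal.ofReal (1 / (ε ^ 2 + (t - (ρ : ℂ).im) ^ 2)) := by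
          rw [lintegral_add_left (by fun_prop)]
          refine add_le_add ?_ (setLIntegral_le_lintegral _ _)
          simp
      _ = _ := by
          rw [lintegral_const_mul _ (by fun_prop), lintegral_finsetSum _ (fun i _ => by fun_prop)]
          simp_rw [lintegral_cauchy_kernel hε]
          simp
  calc _ ≤ ENNReal.ofReal ε * (ENNReal.ofReal (2 * K ^ 2 * ℓ ^ 2) +
        ENNReal.ofReal (2 * Z.card) * (Z.card * ENNReal.ofReal (Real.pi / ε))) := by gcongr
    _ = ENNReal.ofReal (ε * (2 * K ^ 2 * ℓ ^ 2 + 2 * Z.card * (Z.card * (Real.pi / ε)))) := by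
        rw [ENNReal.ofReal_mul hε.le, ENNReal.ofReal_add (by positivity) (by positivity),
          ENNReal.ofReal_mul (p := 2 * (Z.card : ℝ)) (by positivity),
          ENNReal.ofReal_mul (p := (Z.card : ℝ)) (by positivity), ENNReal.ofReal_natCast]
    _ ≤ _ := by
        apply ENNReal.ofReal_le_ofReal
        have e1 : ((1 + |(n : ℝ)|) ^ (1 / 4 : ℝ)) ^ 2 = (1 + |(n : ℝ)|) ^ (1 / 2 : ℝ) := by
          rw [← Real.rpow_natCast, ← Real.rpow_mul (by positivity)]; norm_num
        have e2 : ℓ ^ 2 ≤ 144 * (1 + |(n : ℝ)|) ^ (1 / 2 : ℝ) := by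
          calc ℓ ^ 2 ≤ (12 * (1 + |(n : ℝ)|) ^ (1 / 4 : ℝ)) ^ 2 := by gcongr
            _ = _ := by rw [mul_pow, e1]; norm_num
        have e3 : (Z.card : ℝ) ^ 2 ≤ K ^ 2 * ℓ ^ 2 := by
          rw [← mul_pow]; gcongr
        calc ε * (2 * K ^ 2 * ℓ ^ 2 + 2 * Z.card * (Z.card * (Real.pi / ε)))
            = ε * (2 * K ^ 2 * ℓ ^ 2) + 2 * Real.pi * (Z.card : ℝ) ^ 2 := by field_simp
          _ ≤ 1 * (2 * K ^ 2 * ℓ ^ 2) + 2 * Real.pi * (K ^ 2 * ℓ ^ 2) := by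
              gcongr
              linarith
          _ = (2 * K ^ 2 + 2 * K ^ 2 * Real.pi) * ℓ ^ 2 := by ring
          _ ≤ (2 * K ^ 2 + 2 * K ^ 2 * Real.pi) * (144 * (1 + |(n : ℝ)|) ^ (1 / 2 : ℝ)) := by
              gcongr
          _ = _ := by ring

/-- Weighted mean square of the logarithmic derivative over a vertical line. -/
lemma IsRiemannType.exists_mean_sq {f : ℂ → ℂ} (hf : IsRiemannType f) :
    ∃ K : ENNReal, K ≠ ⊤ ∧ ∀ ε : ℝ, 0 < ε → ε ≤ 1 / 2 →
      ENNReal.ofReal ε * ∫⁻ t : ℝ, ‖logDeriv f (1 / 2 + ε + t * Complex.I)‖ₑ ^ 2 *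
        ENNReal.ofReal ((1 + |t|) ^ (-(7 / 4) : ℝ)) ≤ K := by
  obtain ⟨K, hK, h⟩ := hf.exists_unit_mean_sq
  refine ⟨∑' n : ℤ, ENNReal.ofReal (K * 4 * (1 + |(n : ℝ)|) ^ (-(5 / 4) : ℝ)), ?_, fun ε hε hε' => ?_⟩
  · have hs : Summable fun n : ℤ => K * 4 * (1 + |(n : ℝ)|) ^ (-(5 / 4) : ℝ) := by
      apply Summable.mul_left
      have h1 : Summable fun n : ℤ => |(n : ℝ)| ^ (-(5 / 4) : ℝ) :=
        Real.summable_abs_int_rpow (by norm_num)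
      refine Summable.of_norm_bounded_eventually h1 ?_
      filter_upwards [(Set.finite_singleton (0 : ℤ)).compl_mem_cofinite] with n hn
      have hn0 : n ≠ 0 := hn
      rw [Real.norm_of_nonneg (by positivity)]
      exact Real.rpow_le_rpow_of_nonpos (by positivity) (by linarith) (by norm_num)
    rw [← ENNReal.ofReal_tsum_of_nonneg (fun n => by positivity) hs]
    exact ENNReal.ofReal_ne_top
  · have hU : (⋃ n : ℤ, Set.Ico (n : ℝ) (n + 1)) = Set.univ := by
      exact iUnion_Ico_intCast ℝ
    rw [← setLIntegral_univ, ← hU, lintegral_iUnion (fun n => measurableSet_Ico)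
      (Set.pairwise_disjoint_Ico_intCast ℝ), ← ENNReal.tsum_mul_left]
    refine ENNReal.tsum_le_tsum fun n => ?_
    have hw : ∀ t ∈ Set.Ico (n : ℝ) (n + 1),
        (1 + |t|) ^ (-(7 / 4) : ℝ) ≤ 4 * (1 + |(n : ℝ)|) ^ (-(7 / 4) : ℝ) := by
      intro t ht
      have h1 : (1 + |(n : ℝ)|) / 2 ≤ 1 + |t| := by
        have : |(n : ℝ)| ≤ |t| + 1 := by
          have h2 : |(n : ℝ) - t| ≤ 1 := by
            rw [abs_le]; constructor <;> linarith [ht.1, ht.2]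
          have := abs_add_le t (n - t)
          rw [add_sub_cancel] at this
          linarith
        linarith [abs_nonneg (n : ℝ), abs_nonneg t]
      calc (1 + |t|) ^ (-(7 / 4) : ℝ) ≤ ((1 + |(n : ℝ)|) / 2) ^ (-(7 / 4) : ℝ) :=
            Real.rpow_le_rpow_of_nonpos (by positivity) h1 (by norm_num)
        _ = 2 ^ (7 / 4 : ℝ) * (1 + |(n : ℝ)|) ^ (-(7 / 4) : ℝ) := by
            rw [Real.div_rpow (by positivity) (by norm_num), Real.rpow_neg (by norm_num : (0:ℝ) ≤ 2),
              div_inv_eq_mul, mul_comm]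
        _ ≤ 2 ^ (2 : ℝ) * (1 + |(n : ℝ)|) ^ (-(7 / 4) : ℝ) := by
            gcongr <;> norm_num
        _ = _ := by norm_num
    calc _ ≤ ENNReal.ofReal ε * ∫⁻ t in Set.Ico (n : ℝ) (n + 1),
          ‖logDeriv f (1 / 2 + ε + t * Complex.I)‖ₑ ^ 2 *
            ENNReal.ofReal (4 * (1 + |(n : ℝ)|) ^ (-(7 / 4) : ℝ)) := by
          refine mul_le_mul_right (setLIntegral_mono' measurableSet_Ico fun t ht => ?_) _
          exact mul_le_mul_right (ENNReal.ofReal_le_ofReal (hw t ht)) _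
      _ = (ENNReal.ofReal ε * ∫⁻ t in Set.Ico (n : ℝ) (n + 1),
          ‖logDeriv f (1 / 2 + ε + t * Complex.I)‖ₑ ^ 2) *
            ENNReal.ofReal (4 * (1 + |(n : ℝ)|) ^ (-(7 / 4) : ℝ)) := by
          rw [lintegral_mul_const' _ _ ENNReal.ofReal_ne_top, mul_assoc]
      _ ≤ ENNReal.ofReal (K * (1 + |(n : ℝ)|) ^ (1 / 2 : ℝ)) *
            ENNReal.ofReal (4 * (1 + |(n : ℝ)|) ^ (-(7 / 4) : ℝ)) := by
          gcongr
          exact h ε hε hε' n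
      _ = _ := by
          rw [← ENNReal.ofReal_mul (by positivity)]
          congr 1
          rw [show (-(5 / 4) : ℝ) = 1 / 2 + -(7 / 4) by norm_num, Real.rpow_add (by positivity)]
          ring

/-- The point `1 / 2 + i γ` of the critical line. -/
noncomputable def critPt (γ : ℝ) : ℂ := 1 / 2 + γ * Complex.I

@[simp] lemma critPt_re (γ : ℝ) : (critPt γ).re = 1 / 2 := by simp [critPt]

@[simp] lemma critPt_im (γ : ℝ) : (critPt γ).im = γ := by simp [critPt]

lemma critPt_injective : Function.Injective critPt := fun a b h => by
  simpa using congrArg Complex.im h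

lemma critPt_ne_zero (γ : ℝ) : critPt γ ≠ 0 := fun h => by
  simpa using congrArg Complex.re h

lemma eq_critPt {s : ℂ} (h : s.re = 1 / 2) : s = critPt s.im := by
  apply Complex.ext <;> simp [h]

lemma continuous_critPt : Continuous critPt := by
  unfold critPt; fun_prop

/-- Ordinates in `[-T, T]` of the zeros of `f` on the critical line. -/
def zeroSet (f : ℂ → ℂ) (T : ℝ) : Set ℝ := {γ | |γ| ≤ T ∧ f (critPt γ) = 0}

lemma isOpen_re_pos : IsOpen {s : ℂ | 0 < s.re} := isOpen_lt continuous_const Complex.continuous_re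

lemma IsRiemannType.analyticAt {f : ℂ → ℂ} (hf : IsRiemannType f) {s : ℂ} (hs : 0 < s.re) :
    AnalyticAt ℂ f s :=
  hf.diff.analyticAt (isOpen_re_pos.mem_nhds hs)

lemma IsRiemannType.eventually_ne_zero {f : ℂ → ℂ} (hf : IsRiemannType f) {s : ℂ}
    (hs : 0 < s.re) : ∀ᶠ z in 𝓝[≠] s, f z ≠ 0 := by
  refine (hf.analyticAt hs).eventually_eq_zero_or_eventually_ne_zero.resolve_left fun h => ?_
  have hpre : IsPreconnected {s : ℂ | 0 < s.re} := (convex_halfSpace_re_gt 0).isPreconnected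
  have han : AnalyticOnNhd ℂ f {s : ℂ | 0 < s.re} := fun z hz => hf.analyticAt hz
  have h2 := han.eqOn_zero_of_preconnected_of_eventuallyEq_zero hpre hs h
    (show (2 : ℂ) ∈ {s : ℂ | 0 < s.re} from by norm_num [Set.mem_ofPred_eq])
  obtain ⟨c, hc, hl⟩ := hf.lower
  have h3 := hl 0
  simp only [Complex.ofReal_zero, zero_mul, add_zero] at h3
  rw [h2] at h3
  simp at h3
  linarith

lemma IsRiemannType.finite_zeroSet {f : ℂ → ℂ} (hf : IsRiemannType f) (T : ℝ) :
    (zeroSet f T).Finite := by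
  have hc : IsCompact (Set.Icc (-T) T) := isCompact_Icc
  have : (Set.Icc (-T) T ∩ {γ | f (critPt γ) = 0}).Finite := by
    refine hc.induction_on (p := fun s => (s ∩ {γ | f (critPt γ) = 0}).Finite) (by simp) ?_ ?_ ?_
    · exact fun s t hst ht => ht.subset (Set.inter_subset_inter_left _ hst)
    · intro s t hs ht
      rw [Set.union_inter_distrib_right]
      exact hs.union ht
    · intro γ _
      have h1 : ∀ᶠ z in 𝓝[≠] critPt γ, f z ≠ 0 := hf.eventually_ne_zero (by simp)
      have h2 : ∀ᶠ x in 𝓝[≠] γ, f (critPt x) ≠ 0 :=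
        (tendsto_nhdsWithin_of_tendsto_nhds_of_eventually_within _
          (continuous_critPt.continuousAt.mono_left nhdsWithin_le_nhds)
          (eventually_mem_nhdsWithin.mono fun x hx => critPt_injective.ne hx)).eventually h1
      rw [eventually_nhdsWithin_iff] at h2
      refine ⟨{x | x ∈ ({γ}ᶜ : Set ℝ) → f (critPt x) ≠ 0}, mem_nhdsWithin_of_mem_nhds h2, ?_⟩
      refine (Set.finite_singleton γ).subset fun x hx => ?_
      by_contra hne
      exact hx.1 hne hx.2
  refine this.subset fun γ hγ => ⟨?_, hγ.2⟩
  exact abs_le.1 hγ.1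

/-- Finset of the ordinates in `[-T, T]` of the zeros of `f` on the critical line. -/
noncomputable def zeroFinset (f : ℂ → ℂ) (T : ℝ) : Finset ℝ :=
  if h : (zeroSet f T).Finite then h.toFinset else ∅

lemma IsRiemannType.mem_zeroFinset {f : ℂ → ℂ} (hf : IsRiemannType f) {T γ : ℝ} :
    γ ∈ zeroFinset f T ↔ |γ| ≤ T ∧ f (critPt γ) = 0 := by
  rw [zeroFinset, dif_pos (hf.finite_zeroSet T), Set.Finite.mem_toFinset]
  rfl

/-- The multiplicity of `1 / 2 + i γ` as a zero of `f`. -/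
noncomputable def critMult (f : ℂ → ℂ) (γ : ℝ) : ℕ := analyticOrderNatAt f (critPt γ)

/-- `f' / (s f)` with the poles at the zeros of ordinate at most `T` subtracted. -/
noncomputable def truncLogDeriv (f : ℂ → ℂ) (T : ℝ) (s : ℂ) : ℂ :=
  logDeriv f s / s - ∑ γ ∈ zeroFinset f T, (critMult f γ : ℂ) / (critPt γ * (s - critPt γ))

lemma IsRiemannType.exists_factor {f : ℂ → ℂ} (hf : IsRiemannType f) (γ : ℝ) :
    ∃ g : ℂ → ℂ, AnalyticAt ℂ g (critPt γ) ∧ g (critPt γ) ≠ 0 ∧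
      ∀ᶠ z in 𝓝 (critPt γ), f z = (z - critPt γ) ^ critMult f γ * g z := by
  have h1 : AnalyticAt ℂ f (critPt γ) := hf.analyticAt (by simp)
  have h2 : analyticOrderAt f (critPt γ) ≠ ⊤ := by
    rw [Ne, analyticOrderAt_eq_top]
    intro h
    have h3 := hf.eventually_ne_zero (s := critPt γ) (by simp)
    obtain ⟨z, hz⟩ := (h3.and (h.filter_mono nhdsWithin_le_nhds)).exists
    exact hz.1 hz.2
  obtain ⟨g, hg, hg0, hfg⟩ := (h1.analyticOrderAt_ne_top).1 h2
  exact ⟨g, hg, hg0, hfg.mono fun z hz => by simpa [critMult] using hz⟩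

lemma IsRiemannType.zeroMult_eq {f : ℂ → ℂ} (hf : IsRiemannType f) (γ : ℝ) :
    zeroMult f (1 / 2 + γ * Complex.I) = critMult f γ := by
  have h1 : AnalyticAt ℂ f (critPt γ) := hf.analyticAt (by simp)
  have hex : ∃ n : ℕ, ∃ g : ℂ → ℂ, AnalyticAt ℂ g (critPt γ) ∧ g (critPt γ) ≠ 0 ∧
      (∀ᶠ z in nhds (critPt γ), f z = (z - critPt γ) ^ n * g z) :=
    ⟨_, hf.exists_factor γ⟩
  change zeroMult f (critPt γ) = _
  rw [zeroMult, dif_pos hex]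
  have h2 := hex.choose_spec
  have h3 : analyticOrderAt f (critPt γ) = hex.choose :=
    (h1.analyticOrderAt_eq_natCast).2 (by simpa using h2)
  rw [critMult, analyticOrderNatAt, h3]
  rfl

lemma IsRiemannType.critMult_eq_zero {f : ℂ → ℂ} (hf : IsRiemannType f) {γ : ℝ}
    (h : f (critPt γ) ≠ 0) : critMult f γ = 0 := by
  have h1 : AnalyticAt ℂ f (critPt γ) := hf.analyticAt (by simp)
  rw [critMult, analyticOrderNatAt, (h1.analyticOrderAt_eq_zero).2 h]
  rfl

/-- The truncated logarithmic derivative is bounded to the right of a bounded piece of the critical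
line. -/
lemma IsRiemannType.exists_truncLogDeriv_bound {f : ℂ → ℂ} (hf : IsRiemannType f) (T : ℝ) :
    ∃ C : ℝ, ∀ s : ℂ, 1 / 2 < s.re → s.re ≤ 1 → |s.im| ≤ T → ‖truncLogDeriv f T s‖ ≤ C := by
  have hc : IsCompact (Set.Icc (1 / 2 : ℝ) 1 ×ℂ Set.Icc (-T) T) := isCompact_Icc.reProdIm isCompact_Icc
  have key : ∃ C : ℝ, ∀ s ∈ (Set.Icc (1 / 2 : ℝ) 1 ×ℂ Set.Icc (-T) T), 1 / 2 < s.re →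
      ‖truncLogDeriv f T s‖ ≤ C := by
    refine hc.induction_on (p := fun U : Set ℂ => ∃ C : ℝ, ∀ s ∈ U, 1 / 2 < s.re →
      ‖truncLogDeriv f T s‖ ≤ C) ⟨0, by simp⟩ ?_ ?_ ?_
    · rintro U V hUV ⟨C, hC⟩
      exact ⟨C, fun s hs => hC s (hUV hs)⟩
    · rintro U V ⟨C, hC⟩ ⟨D, hD⟩
      refine ⟨max C D, fun s hs h => ?_⟩
      rcases hs with hs | hs
      · exact (hC s hs h).trans (le_max_left _ _)
      · exact (hD s hs h).trans (le_max_right _ _)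
    · intro z₀ hz₀
      suffices h : ∃ H : ℂ → ℂ, ContinuousAt H z₀ ∧
          ∀ᶠ s in 𝓝 z₀, 1 / 2 < s.re → truncLogDeriv f T s = H s by
        obtain ⟨H, hH, hev⟩ := h
        have h1 : ∀ᶠ s in 𝓝 z₀, ‖H s‖ < ‖H z₀‖ + 1 :=
          hH.norm.eventually (gt_mem_nhds (lt_add_one _))
        refine ⟨_, mem_nhdsWithin_of_mem_nhds (h1.and hev), ‖H z₀‖ + 1, fun s hs hsre => ?_⟩
        rw [hs.2 hsre]
        exact hs.1.le
      have hre : (1 / 2 : ℝ) ≤ z₀.re := hz₀.1.1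
      have him : |z₀.im| ≤ T := abs_le.2 hz₀.2
      have hz0 : z₀ ≠ 0 := fun h => by rw [h] at hre; norm_num at hre
      by_cases hfz : f z₀ = 0
      · have hz1 : z₀ = critPt z₀.im := eq_critPt (hf.zeros z₀ (by linarith) hfz)
        set γ₀ := z₀.im with hγ₀
        have hmem : γ₀ ∈ zeroFinset f T := hf.mem_zeroFinset.2 ⟨him, by rw [← hz1]; exact hfz⟩
        obtain ⟨g, hg, hg0, hfg⟩ := hf.exists_factor γ₀
        rw [← hz1] at hg hg0 hfg
        refine ⟨fun s => logDeriv g s / s - critMult f γ₀ / (s * z₀) -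
          ∑ γ ∈ (zeroFinset f T).erase γ₀, (critMult f γ : ℂ) / (critPt γ * (s - critPt γ)), ?_, ?_⟩
        · refine ContinuousAt.sub (ContinuousAt.sub ?_ ?_) ?_
          · refine ContinuousAt.div ?_ continuousAt_id hz0
            exact hg.deriv.continuousAt.div hg.continuousAt hg0
          · exact continuousAt_const.div (by fun_prop) (mul_ne_zero hz0 hz0)
          · refine tendsto_finsetSum _ fun γ hγ => ?_
            refine ContinuousAt.div continuousAt_const (by fun_prop) ?_
            refine mul_ne_zero (critPt_ne_zero _) (sub_ne_zero.2 ?_)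
            rw [hz1]
            exact critPt_injective.ne (Finset.ne_of_mem_erase hγ).symm
        · have hgne : ∀ᶠ s in 𝓝 z₀, g s ≠ 0 := hg.continuousAt.eventually_ne hg0
          have hgan : ∀ᶠ s in 𝓝 z₀, AnalyticAt ℂ g s := hg.eventually_analyticAt
          filter_upwards [hfg.eventually_nhds, hgne, hgan] with s hs1 hs2 hs3 hs4
          have hsz : s - z₀ ≠ 0 := by
            intro h
            rw [sub_eq_zero.1 h, hz1] at hs4
            simp at hs4
          have hs0 : s ≠ 0 := fun h => by rw [h] at hs4; norm_num at hs4
          have e1 : logDeriv f s = critMult f γ₀ / (s - z₀) + logDeriv g s := by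
            have : logDeriv f s = logDeriv (fun z => (z - z₀) ^ critMult f γ₀ * g z) s := by
              rw [logDeriv_apply, logDeriv_apply, Filter.EventuallyEq.deriv_eq hs1, hs1.self_of_nhds]
            rw [this, logDeriv_mul (f := fun z => (z - z₀) ^ critMult f γ₀) (g := g) s
              (pow_ne_zero _ hsz) hs2 (by fun_prop)
              hs3.differentiableAt, logDeriv_fun_pow (by fun_prop)]
            congr 1
            rw [logDeriv_apply]
            simp [div_eq_mul_inv]
          rw [truncLogDeriv, ← Finset.add_sum_erase _ _ hmem, e1, ← hz1]
          field_simp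
          ring
      · refine ⟨truncLogDeriv f T, ?_, Eventually.of_forall fun _ _ => rfl⟩
        have han : AnalyticAt ℂ f z₀ := hf.analyticAt (by linarith)
        unfold truncLogDeriv
        refine ContinuousAt.sub ?_ ?_
        · refine ContinuousAt.div ?_ continuousAt_id hz0
          exact han.deriv.continuousAt.div han.continuousAt hfz
        · refine tendsto_finsetSum _ fun γ hγ => ?_
          refine ContinuousAt.div continuousAt_const (by fun_prop) ?_
          refine mul_ne_zero (critPt_ne_zero _) (sub_ne_zero.2 fun h => hfz ?_)
          rw [h]
          exact (hf.mem_zeroFinset.1 hγ).2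
  obtain ⟨C, hC⟩ := key
  exact ⟨C, fun s h1 h2 h3 => hC s ⟨⟨h1.le, h2⟩, abs_le.1 h3⟩ h1⟩

lemma eventually_ofReal_mul_le {c η : ENNReal} (hc : c ≠ ⊤) (hη : η ≠ 0) :
    ∀ᶠ ε : ℝ in 𝓝[>] 0, ENNReal.ofReal ε * c ≤ η := by
  have h1 : Tendsto (fun ε : ℝ => ENNReal.ofReal ε * c) (𝓝[>] 0) (𝓝 0) := by
    have h2 : Tendsto (fun ε : ℝ => ENNReal.ofReal ε) (𝓝[>] 0) (𝓝 0) := by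
      have := (ENNReal.continuous_ofReal.tendsto 0).mono_left
        (nhdsWithin_le_nhds (s := Set.Ioi (0 : ℝ)))
      simpa using this
    simpa using ENNReal.Tendsto.mul_const h2 (Or.inr hc)
  exact (h1.eventually (gt_mem_nhds (pos_iff_ne_zero.2 hη))).mono fun _ h => h.le

/-- Just above height `T` there is a gap between the zeros. -/
lemma IsRiemannType.exists_gap {f : ℂ → ℂ} (hf : IsRiemannType f) (T : ℝ) :
    ∃ T' > T, zeroFinset f T' = zeroFinset f T := by
  set S := (zeroFinset f (T + 1)).filter fun γ => T < |γ| with hS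
  by_cases hne : S.Nonempty
  · set m := S.inf' hne fun γ => |γ| with hm
    have hmT : T < m := by
      rw [hm, Finset.lt_inf'_iff]
      intro γ hγ
      exact (Finset.mem_filter.1 hγ).2
    refine ⟨min ((T + m) / 2) (T + 1), lt_min (by linarith) (by linarith), ?_⟩
    ext γ
    rw [hf.mem_zeroFinset, hf.mem_zeroFinset]
    refine ⟨fun h => ⟨?_, h.2⟩, fun h => ⟨h.1.trans (le_min (by linarith) (by linarith)), h.2⟩⟩
    by_contra hlt
    push Not at hlt
    have hmem : γ ∈ S := Finset.mem_filter.2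
      ⟨hf.mem_zeroFinset.2 ⟨h.1.trans (min_le_right _ _), h.2⟩, hlt⟩
    have h1 : m ≤ |γ| := Finset.inf'_le _ hmem
    have h2 := h.1.trans (min_le_left _ _)
    linarith
  · refine ⟨T + 1, by linarith, ?_⟩
    ext γ
    rw [hf.mem_zeroFinset, hf.mem_zeroFinset]
    refine ⟨fun h => ⟨?_, h.2⟩, fun h => ⟨by linarith [h.1], h.2⟩⟩
    by_contra hlt
    push Not at hlt
    exact hne ⟨γ, Finset.mem_filter.2 ⟨hf.mem_zeroFinset.2 h, hlt⟩⟩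

lemma IsRiemannType.ne_zero_of_half_lt {f : ℂ → ℂ} (hf : IsRiemannType f) {s : ℂ}
    (hs : 1 / 2 < s.re) : f s ≠ 0 := fun h => by
  have := hf.zeros s (by linarith) h
  linarith

lemma IsRiemannType.differentiableOn_truncLogDeriv {f : ℂ → ℂ} (hf : IsRiemannType f) (T : ℝ) :
    DifferentiableOn ℂ (truncLogDeriv f T) {s | 1 / 2 < s.re} := by
  intro s hs
  have hs' : 1 / 2 < s.re := hs
  have han : AnalyticAt ℂ f s := hf.analyticAt (by linarith)
  have hs0 : s ≠ 0 := fun h => by rw [h] at hs'; norm_num at hs'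
  apply DifferentiableAt.differentiableWithinAt
  unfold truncLogDeriv
  refine DifferentiableAt.sub ?_ ?_
  · exact (han.deriv.differentiableAt.div han.differentiableAt (hf.ne_zero_of_half_lt hs')).div
      differentiableAt_id hs0
  · refine DifferentiableAt.fun_sum fun γ _ => ?_
    refine DifferentiableAt.div (differentiableAt_const _) (by fun_prop) ?_
    refine mul_ne_zero (critPt_ne_zero _) (sub_ne_zero.2 fun h => ?_)
    rw [h] at hs'
    simp at hs'

lemma norm_poleSum_le (S : Finset ℝ) (m : ℝ → ℕ) (s : ℂ) (d : ℝ) (hd : 0 < d)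
    (h : ∀ γ ∈ S, d ≤ ‖s - critPt γ‖) :
    ‖∑ γ ∈ S, (m γ : ℂ) / (critPt γ * (s - critPt γ))‖ ≤ (2 * ∑ γ ∈ S, (m γ : ℝ)) / d := by
  rw [mul_div_assoc, Finset.sum_div, Finset.mul_sum]
  refine norm_sum_le_of_le _ fun γ hγ => ?_
  have h1 : (1 / 2 : ℝ) ≤ ‖critPt γ‖ := by
    have := Complex.abs_re_le_norm (critPt γ)
    rw [critPt_re] at this
    exact le_trans (le_abs_self _) this
  have h2 := h γ hγ
  rw [norm_div, norm_mul, Complex.norm_natCast]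
  calc (m γ : ℝ) / (‖critPt γ‖ * ‖s - critPt γ‖) ≤ m γ / (1 / 2 * d) := by gcongr
    _ = _ := by field_simp

lemma IsRiemannType.exists_truncLogDeriv_decay {f : ℂ → ℂ} (hf : IsRiemannType f) (T : ℝ) {ε : ℝ}
    (hε : 0 < ε) : ∃ C : ℝ, 0 < C ∧ ∀ s : ℂ, 1 / 2 + ε ≤ s.re → s.re ≤ 3 →
      ‖truncLogDeriv f T s‖ ≤ C * (1 + |s.im|) ^ (-(3 / 4) : ℝ) := by
  obtain ⟨C, hC, h⟩ := hf.norm_logDeriv_le hε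
  set M := 2 * ∑ γ ∈ zeroFinset f T, (critMult f γ : ℝ) with hM
  have hM0 : 0 ≤ M := by positivity
  set c := ε / (1 + |T| + ε) with hc
  have hc0 : 0 < c := by positivity
  refine ⟨4 * C + M / c, by positivity, fun s hs1 hs2 => ?_⟩
  have hx : 1 ≤ 1 + |s.im| := by linarith [abs_nonneg s.im]
  have hnorm : (1 + |s.im|) / 4 ≤ ‖s‖ := by
    have h1 := Complex.abs_im_le_norm s
    have h2 := (le_abs_self _).trans (Complex.abs_re_le_norm s)
    linarith
  have h1 : ‖logDeriv f s / s‖ ≤ 4 * C * (1 + |s.im|) ^ (-(3 / 4) : ℝ) := by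
    rw [norm_div]
    calc ‖logDeriv f s‖ / ‖s‖ ≤ C * (1 + |s.im|) ^ (1 / 4 : ℝ) / ((1 + |s.im|) / 4) := by
          gcongr
          exact h s hs1 hs2
      _ = 4 * C * ((1 + |s.im|) ^ (1 / 4 : ℝ) / (1 + |s.im|)) := by field_simp
      _ = _ := by
        rw [← Real.rpow_sub_one (by positivity)]; norm_num
  have h2 : ‖∑ γ ∈ zeroFinset f T, (critMult f γ : ℂ) / (critPt γ * (s - critPt γ))‖ ≤
      M / c * (1 + |s.im|) ^ (-(3 / 4) : ℝ) := by
    refine (norm_poleSum_le _ _ s (c * (1 + |s.im|)) (by positivity) ?_).trans ?_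
    · intro γ hγ
      have hγ' := (hf.mem_zeroFinset.1 hγ).1
      have e1 := (le_abs_self _).trans (Complex.abs_re_le_norm (s - critPt γ))
      have e2 := Complex.abs_im_le_norm (s - critPt γ)
      rw [Complex.sub_re, critPt_re] at e1
      rw [Complex.sub_im, critPt_im] at e2
      have e3 : |s.im| - |T| ≤ |s.im - γ| := by
        have := abs_sub_abs_le_abs_sub s.im γ
        linarith [le_abs_self T]
      rw [hc, div_mul_eq_mul_div, div_le_iff₀ (by positivity)]
      have e4 : ε ≤ ‖s - critPt γ‖ := by linarith
      have e5 : |s.im| - |T| ≤ ‖s - critPt γ‖ := by linarith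
      nlinarith [abs_nonneg T]
    · rw [← div_div, div_eq_mul_inv (M / c)]
      gcongr
      rw [← Real.rpow_neg_one]
      exact Real.rpow_le_rpow_of_exponent_le hx (by norm_num)
  calc ‖truncLogDeriv f T s‖ ≤ _ := norm_sub_le _ _
    _ ≤ _ := add_le_add h1 h2
    _ = _ := by ring

lemma lintegral_inv_sq_ne_top (D : ℝ) :
    ∫⁻ t : ℝ, ENNReal.ofReal (D * ((1 + |t|) ^ 2)⁻¹) ≠ ⊤ := by
  have h : Integrable fun t : ℝ => D * ((1 + |t|) ^ 2)⁻¹ := by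
    apply Integrable.const_mul
    refine integrable_inv_one_add_sq.mono' (by fun_prop) (Eventually.of_forall fun t => ?_)
    rw [Real.norm_of_nonneg (by positivity)]
    apply inv_anti₀ (by positivity)
    nlinarith [abs_nonneg t, sq_abs t]
  refine ne_top_of_le_ne_top h.2.ne (lintegral_mono fun t => ?_)
  exact Real.ofReal_le_enorm _

lemma IsRiemannType.truncLogDeriv_mean_sq {f : ℂ → ℂ} (hf : IsRiemannType f) {η : ENNReal}
    (hη : η ≠ 0) : ∃ T₀ : ℝ, ∀ T ≥ T₀, ∀ᶠ ε : ℝ in 𝓝[>] 0,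
      ENNReal.ofReal ε * ∫⁻ t : ℝ, ‖truncLogDeriv f T (1 / 2 + ε + t * Complex.I)‖ₑ ^ 2 ≤ η := by
  obtain ⟨K, hK, hms⟩ := hf.exists_mean_sq
  have hT0 : ∀ᶠ T : ℝ in atTop, ENNReal.ofReal (8 * (1 + T) ^ (-(1 / 4) : ℝ)) * K ≤ η / 2 := by
    have h1 : Tendsto (fun T : ℝ => ENNReal.ofReal (8 * (1 + T) ^ (-(1 / 4) : ℝ)) * K) atTop
        (𝓝 0) := by
      have h2 : Tendsto (fun T : ℝ => 8 * (1 + T) ^ (-(1 / 4) : ℝ)) atTop (𝓝 0) := by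
        have := ((tendsto_rpow_neg_atTop (y := 1 / 4) (by norm_num)).comp
          (tendsto_atTop_add_const_left atTop (1 : ℝ) tendsto_id)).const_mul 8
        simpa [Function.comp_def] using this
      have h3 := ENNReal.tendsto_ofReal h2
      rw [ENNReal.ofReal_zero] at h3
      simpa using ENNReal.Tendsto.mul_const h3 (Or.inr hK)
    exact (h1.eventually (gt_mem_nhds (ENNReal.half_pos hη))).mono fun _ h => h.le
  obtain ⟨T₁, hT₁⟩ := eventually_atTop.1 hT0
  refine ⟨max T₁ 1, fun T hT => ?_⟩
  have hTone : 1 ≤ T := (le_max_right _ _).trans hT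
  have hTK := hT₁ T ((le_max_left _ _).trans hT)
  obtain ⟨T', hTT', hgap⟩ := hf.exists_gap T
  have hH : truncLogDeriv f T = truncLogDeriv f T' := by
    funext s; rw [truncLogDeriv, truncLogDeriv, hgap]
  obtain ⟨C, hC⟩ := hf.exists_truncLogDeriv_bound T'
  set M := 2 * ∑ γ ∈ zeroFinset f T, (critMult f γ : ℝ) with hM
  have hM0 : 0 ≤ M := by positivity
  set c := (T' - T) / (1 + T') with hc
  have hc0 : 0 < c := div_pos (by linarith) (by linarith)
  set D := C ^ 2 * (1 + T') ^ 2 + 2 * (M / c) ^ 2 with hD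
  have hpt : ∀ ε : ℝ, 0 < ε → ε ≤ 1 / 2 → ∀ t : ℝ,
      ‖truncLogDeriv f T (1 / 2 + ε + t * Complex.I)‖ ^ 2 ≤ D * ((1 + |t|) ^ 2)⁻¹ +
        8 * (1 + T) ^ (-(1 / 4) : ℝ) * (‖logDeriv f (1 / 2 + ε + t * Complex.I)‖ ^ 2 *
          (1 + |t|) ^ (-(7 / 4) : ℝ)) := by
    intro ε hε hε' t
    set s : ℂ := 1 / 2 + ε + t * Complex.I with hs
    have hsre : s.re = 1 / 2 + ε := by simp [hs]
    have hsim : s.im = t := by simp [hs]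
    have hT1 : (0 : ℝ) < 1 + T := by linarith
    rcases le_or_gt |t| T' with ht | ht
    · have h1 : ‖truncLogDeriv f T s‖ ≤ C := by
        rw [hH]
        exact hC s (by linarith) (by linarith) (by rwa [hsim])
      have h2 : ‖truncLogDeriv f T s‖ ^ 2 ≤ D * ((1 + |t|) ^ 2)⁻¹ := by
        rw [← div_eq_mul_inv, le_div_iff₀ (by positivity)]
        calc _ ≤ C ^ 2 * (1 + T') ^ 2 := by gcongr
          _ ≤ D := by rw [hD]; linarith [sq_nonneg (M / c)]
      refine h2.trans (le_add_of_nonneg_right ?_)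
      positivity
    · have ht1 : 1 ≤ |t| := by linarith
      have h1 : ‖logDeriv f s / s‖ ^ 2 ≤
          4 * (1 + T) ^ (-(1 / 4) : ℝ) * (‖logDeriv f s‖ ^ 2 * (1 + |t|) ^ (-(7 / 4) : ℝ)) := by
        have e1 : (1 + |t|) / 2 ≤ ‖s‖ := by
          have := Complex.abs_im_le_norm s
          rw [hsim] at this
          linarith
        have e2 : (1 + |t|) ^ (-2 : ℝ) ≤ (1 + T) ^ (-(1 / 4) : ℝ) * (1 + |t|) ^ (-(7 / 4) : ℝ) := by
          rw [show (-2 : ℝ) = -(1 / 4) + -(7 / 4) by norm_num, Real.rpow_add (by positivity)]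
          refine mul_le_mul_of_nonneg_right ?_ (by positivity)
          exact Real.rpow_le_rpow_of_nonpos (by positivity) (by linarith) (by norm_num)
        rw [norm_div, div_pow]
        calc ‖logDeriv f s‖ ^ 2 / ‖s‖ ^ 2 ≤ ‖logDeriv f s‖ ^ 2 / ((1 + |t|) / 2) ^ 2 := by gcongr
          _ = 4 * ‖logDeriv f s‖ ^ 2 * (1 + |t|) ^ (-2 : ℝ) := by
            rw [Real.rpow_neg (by positivity), Real.rpow_two]; field_simp; norm_num
          _ ≤ 4 * ‖logDeriv f s‖ ^ 2 *
              ((1 + T) ^ (-(1 / 4) : ℝ) * (1 + |t|) ^ (-(7 / 4) : ℝ)) := by gcongr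
          _ = _ := by ring
      have h2 : ‖∑ γ ∈ zeroFinset f T, (critMult f γ : ℂ) / (critPt γ * (s - critPt γ))‖ ≤
          M / (c * (1 + |t|)) := by
        refine norm_poleSum_le _ _ s (c * (1 + |t|)) (by positivity) ?_
        intro γ hγ
        have hγ' := (hf.mem_zeroFinset.1 hγ).1
        have e2 := Complex.abs_im_le_norm (s - critPt γ)
        rw [Complex.sub_im, critPt_im, hsim] at e2
        have e3 : |t| - T ≤ |t - γ| := by
          have := abs_sub_abs_le_abs_sub t γ
          linarith
        refine le_trans ?_ (e3.trans e2)
        rw [hc, div_mul_eq_mul_div, div_le_iff₀ (by linarith)]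
        nlinarith
      calc ‖truncLogDeriv f T s‖ ^ 2 ≤ (‖logDeriv f s / s‖ +
            ‖∑ γ ∈ zeroFinset f T, (critMult f γ : ℂ) / (critPt γ * (s - critPt γ))‖) ^ 2 := by
            gcongr
            exact norm_sub_le _ _
        _ ≤ 2 * (‖logDeriv f s / s‖ ^ 2 +
            ‖∑ γ ∈ zeroFinset f T, (critMult f γ : ℂ) / (critPt γ * (s - critPt γ))‖ ^ 2) :=
            add_sq_le
        _ ≤ 2 * (4 * (1 + T) ^ (-(1 / 4) : ℝ) * (‖logDeriv f s‖ ^ 2 *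
            (1 + |t|) ^ (-(7 / 4) : ℝ)) + (M / (c * (1 + |t|))) ^ 2) := by gcongr
        _ = 2 * (M / c) ^ 2 * ((1 + |t|) ^ 2)⁻¹ + 8 * (1 + T) ^ (-(1 / 4) : ℝ) *
            (‖logDeriv f s‖ ^ 2 * (1 + |t|) ^ (-(7 / 4) : ℝ)) := by
            rw [← div_div, div_pow (M / c)]; ring
        _ ≤ _ := by
            gcongr
            rw [hD]
            have : 0 ≤ C ^ 2 * (1 + T') ^ 2 := by positivity
            linarith
  have hη2 : η / 2 ≠ 0 := (ENNReal.half_pos hη).ne'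
  filter_upwards [eventually_ofReal_mul_le (lintegral_inv_sq_ne_top D) hη2, self_mem_nhdsWithin,
    mem_nhdsWithin_of_mem_nhds (Iic_mem_nhds (show (0 : ℝ) < 1 / 2 by norm_num))] with ε h1 hε hε'
  have hε0 : 0 < ε := hε
  have hw0 : 0 ≤ 8 * (1 + T) ^ (-(1 / 4) : ℝ) := by
    have : (0 : ℝ) ≤ 1 + T := by linarith
    positivity
  calc _ ≤ ENNReal.ofReal ε * ∫⁻ t : ℝ, (ENNReal.ofReal (D * ((1 + |t|) ^ 2)⁻¹) +
        ENNReal.ofReal (8 * (1 + T) ^ (-(1 / 4) : ℝ)) *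
          (‖logDeriv f (1 / 2 + ε + t * Complex.I)‖ₑ ^ 2 *
          ENNReal.ofReal ((1 + |t|) ^ (-(7 / 4) : ℝ)))) := by
        refine mul_le_mul_right (lintegral_mono fun t => ?_) _
        rw [← ofReal_norm, ← ofReal_norm, ← ENNReal.ofReal_pow (norm_nonneg _),
          ← ENNReal.ofReal_pow (norm_nonneg _), ← ENNReal.ofReal_mul (by positivity),
          ← ENNReal.ofReal_mul hw0, ← ENNReal.ofReal_add (by positivity) (by positivity)]
        exact ENNReal.ofReal_le_ofReal (hpt ε hε0 hε' t)
    _ = (ENNReal.ofReal ε * ∫⁻ t : ℝ, ENNReal.ofReal (D * ((1 + |t|) ^ 2)⁻¹)) +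
        ENNReal.ofReal (8 * (1 + T) ^ (-(1 / 4) : ℝ)) *
        (ENNReal.ofReal ε * ∫⁻ t : ℝ, ‖logDeriv f (1 / 2 + ε + t * Complex.I)‖ₑ ^ 2 *
          ENNReal.ofReal ((1 + |t|) ^ (-(7 / 4) : ℝ))) := by
        rw [lintegral_add_left (by fun_prop), lintegral_const_mul' _ _ ENNReal.ofReal_ne_top]
        ring
    _ ≤ η / 2 + ENNReal.ofReal (8 * (1 + T) ^ (-(1 / 4) : ℝ)) * K :=
        add_le_add h1 (mul_le_mul_right (hms ε hε0 hε') _)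
    _ ≤ η / 2 + η / 2 := by gcongr
    _ = η := ENNReal.add_halves η

lemma integrable_one_add_abs_rpow {p : ℝ} (hp : 1 < p) :
    Integrable fun t : ℝ => (1 + |t|) ^ (-p) := by
  have := integrable_one_add_norm (E := ℝ) (μ := volume) (r := p) (by simpa using hp)
  simpa using this

lemma integrable_vertical {F : ℂ → ℂ} {b₀ σ C p : ℝ} (hp : 1 < p)
    (hF : DifferentiableOn ℂ F {s | b₀ < s.re}) (hσ : b₀ < σ)
    (hC : ∀ t : ℝ, ‖F (σ + t * Complex.I)‖ ≤ C * (1 + |t|) ^ (-p)) :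
    Continuous (fun t : ℝ => F (σ + t * Complex.I)) ∧
      Integrable fun t : ℝ => F (σ + t * Complex.I) := by
  have hcont : Continuous fun t : ℝ => F (σ + t * Complex.I) := by
    refine hF.continuousOn.comp_continuous (by fun_prop) fun t => ?_
    simpa using hσ
  refine ⟨hcont, ((integrable_one_add_abs_rpow hp).const_mul C).mono' hcont.aestronglyMeasurable
    (Eventually.of_forall hC)⟩

/-- Contour shift between two vertical lines. -/
lemma integral_vertical_eq {F : ℂ → ℂ} {b₀ b c C p : ℝ} (hp : 1 < p)
    (hF : DifferentiableOn ℂ F {s | b₀ < s.re}) (hb : b₀ < b) (hbc : b ≤ c)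
    (hC : ∀ s : ℂ, b ≤ s.re → s.re ≤ c → ‖F s‖ ≤ C * (1 + |s.im|) ^ (-p)) :
    ∫ t : ℝ, F (b + t * Complex.I) = ∫ t : ℝ, F (c + t * Complex.I) := by
  have hline : ∀ σ : ℝ, b ≤ σ → σ ≤ c →
      ∀ t : ℝ, ‖F (σ + t * Complex.I)‖ ≤ C * (1 + |t|) ^ (-p) := by
    intro σ h1 h2 t
    simpa using hC (σ + t * Complex.I) (by simpa using h1) (by simpa using h2)
  have hIb := (integrable_vertical hp hF hb (hline b le_rfl hbc)).2
  have hIc := (integrable_vertical hp hF (hb.trans_le hbc) (hline c hbc le_rfl)).2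
  have hrect : ∀ R : ℝ, (∫ x : ℝ in b..c, F (x + ((-R : ℝ) : ℂ) * Complex.I)) -
      (∫ x : ℝ in b..c, F (x + (R : ℂ) * Complex.I)) +
      Complex.I * (∫ y : ℝ in (-R)..R, F (c + y * Complex.I)) -
      Complex.I * (∫ y : ℝ in (-R)..R, F (b + y * Complex.I)) = 0 := by
    intro R
    have h := Complex.integral_boundary_rect_eq_zero_of_differentiableOn F
      (b + ((-R : ℝ) : ℂ) * Complex.I) (c + (R : ℂ) * Complex.I) (hF.mono ?_)
    · simpa using h
    · intro s hs
      have h1 : s.re ∈ Set.uIcc b c := by simpa using hs.1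
      rw [Set.uIcc_of_le hbc] at h1
      exact hb.trans_le h1.1
  have hhor : ∀ s : ℝ, s = 1 ∨ s = -1 →
      Tendsto (fun R : ℝ => ∫ x : ℝ in b..c, F (x + ((s * R : ℝ) : ℂ) * Complex.I)) atTop (𝓝 0) := by
    intro s hs
    have hlim : Tendsto (fun R : ℝ => C * (1 + R) ^ (-p) * |c - b|) atTop (𝓝 0) := by
      have := (((tendsto_rpow_neg_atTop (y := p) (by linarith)).comp
        (tendsto_atTop_add_const_left atTop (1 : ℝ) tendsto_id)).const_mul C).mul_const |c - b|
      simpa [Function.comp_def] using this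
    refine squeeze_zero_norm' ?_ hlim
    filter_upwards [eventually_ge_atTop 0] with R hR
    refine intervalIntegral.norm_integral_le_of_norm_le_const fun x hx => ?_
    rw [Set.uIoc_of_le hbc] at hx
    have h1 := hline x hx.1.le hx.2 (s * R)
    have h2 : |s * R| = R := by
      rcases hs with rfl | rfl <;> simp [abs_of_nonneg hR]
    rwa [h2] at h1
  have hv : ∀ σ : ℝ, Integrable (fun t : ℝ => F (σ + t * Complex.I)) →
      Tendsto (fun R : ℝ => ∫ y : ℝ in (-R)..R, F (σ + y * Complex.I)) atTop
        (𝓝 (∫ t : ℝ, F (σ + t * Complex.I))) := fun σ hσ =>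
    intervalIntegral_tendsto_integral hσ tendsto_neg_atTop_atBot tendsto_id
  have h1 := hhor (-1) (Or.inr rfl)
  have h2 := hhor 1 (Or.inl rfl)
  simp only [neg_mul, one_mul] at h1 h2
  have hlim := ((h1.sub h2).add ((hv c hIc).const_mul Complex.I)).sub
    ((hv b hIb).const_mul Complex.I)
  have h0 := tendsto_nhds_unique hlim (tendsto_const_nhds.congr fun R => (hrect R).symm)
  rw [sub_zero, zero_add, ← mul_sub] at h0
  exact (sub_eq_zero.1 ((mul_eq_zero.1 h0).resolve_left Complex.I_ne_zero)).symm

open FourierTransform in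
/-- Plancherel's identity for integrable functions with integrable inverse Fourier transform. -/
lemma lintegral_fourierInv_sq {w g : ℝ → ℂ} (hw : Continuous w) (hwi : Integrable w)
    (hg : Integrable g) (hgw : g = 𝓕⁻ w) (hbw : ∃ C, ∀ x, ‖w x‖ ≤ C) :
    ∫⁻ y, ‖g y‖ₑ ^ 2 = ∫⁻ x, ‖w x‖ₑ ^ 2 := by
  have hgc : Continuous g := by
    rw [hgw, Real.fourierInv_eq_fourier_comp_neg]
    exact VectorFourier.fourierIntegral_continuous Real.continuous_fourierChar
      continuous_inner hwi.comp_neg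
  have hgb : ∃ C, ∀ x, ‖g x‖ ≤ C := by
    refine ⟨∫ v, ‖w v‖, fun x => ?_⟩
    rw [hgw, Real.fourierInv_eq']
    refine (norm_integral_le_integral_norm _).trans (le_of_eq ?_)
    congr 1
    funext v
    rw [norm_smul, Complex.norm_exp_ofReal_mul_I, one_mul]
  have hfg : 𝓕 g = w := by
    rw [hgw]
    refine hw.fourier_fourierInv_eq hwi ?_
    have : 𝓕 w = fun x => g (-x) := by
      funext x; rw [hgw, Real.fourierInv_eq_fourier_neg, neg_neg]
    rw [this]
    exact hg.comp_neg
  have hsesq : ∫ ξ, inner ℂ (𝓕 g ξ) (w ξ) = ∫ x, inner ℂ (g x) (𝓕⁻ w x) := by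
    have h := VectorFourier.integral_sesq_fourierIntegral_eq_neg_flip (innerSL ℂ (E := ℂ))
      (L := innerₗ ℝ) Real.continuous_fourierChar continuous_inner hg hwi
    have e : ∀ x, VectorFourier.fourierIntegral Real.fourierChar volume (-(innerₗ ℝ).flip) w x
        = 𝓕⁻ w x := by
      intro x
      rw [Real.fourierInv_eq, VectorFourier.fourierIntegral]
      simp
    simp only [e] at h
    exact h
  rw [← hgw, hfg] at hsesq
  simp only [inner_self_eq_norm_sq_to_K] at hsesq
  have hi : ∀ {u : ℝ → ℂ}, Continuous u → Integrable u → (∃ C, ∀ x, ‖u x‖ ≤ C) →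
      Integrable fun x => ‖u x‖ ^ 2 := by
    rintro u hu hui ⟨C, hC⟩
    refine (hui.norm.const_mul C).mono' (by fun_prop) (Eventually.of_forall fun x => ?_)
    rw [Real.norm_of_nonneg (by positivity), pow_two]
    exact mul_le_mul_of_nonneg_right (hC x) (norm_nonneg _)
  have hreal : ∫ x, ‖w x‖ ^ 2 = ∫ x, ‖g x‖ ^ 2 := by
    have h2 : ((∫ x, ‖w x‖ ^ 2 : ℝ) : ℂ) = ((∫ x, ‖g x‖ ^ 2 : ℝ) : ℂ) := by
      rw [← integral_complex_ofReal, ← integral_complex_ofReal]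
      simpa using hsesq
    exact_mod_cast h2
  have hl : ∀ {u : ℝ → ℂ}, Continuous u → Integrable u → (∃ C, ∀ x, ‖u x‖ ≤ C) →
      ∫⁻ x, ‖u x‖ₑ ^ 2 = ENNReal.ofReal (∫ x, ‖u x‖ ^ 2) := by
    intro u hu hui hub
    rw [ofReal_integral_eq_lintegral_ofReal (hi hu hui hub)
      (Eventually.of_forall fun x => by positivity)]
    refine lintegral_congr fun x => ?_
    rw [ENNReal.ofReal_pow (norm_nonneg _), ofReal_norm]
  rw [hl hgc hg hgb, hl hw hwi hbw, hreal]

/-- The moving average `∫₀¹ h (y + δ u) du`. -/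
noncomputable def movingAverage (h : ℝ → ℂ) (δ y : ℝ) : ℂ := ∫ u in (0 : ℝ)..1, h (y + δ * u)

/-- The entire function `∫₀¹ exp (z u) du`. -/
noncomputable def expMean (z : ℂ) : ℂ := ∫ u in (0 : ℝ)..1, Complex.exp (z * u)

lemma norm_expMean_le {z : ℂ} (hz : 0 ≤ z.re) : ‖expMean z‖ ≤ Real.exp z.re := by
  have := intervalIntegral.norm_integral_le_of_norm_le_const (a := (0 : ℝ)) (b := 1)
    (f := fun u : ℝ => Complex.exp (z * u)) (C := Real.exp z.re) fun u hu => by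
      rw [Set.uIoc_of_le zero_le_one] at hu
      rw [Complex.norm_exp]
      simp only [Complex.mul_re, Complex.ofReal_re, Complex.ofReal_im, mul_zero, sub_zero]
      gcongr
      exact mul_le_of_le_one_right hz hu.2
  simpa [expMean] using this

lemma expMean_eq {z : ℂ} (hz : z ≠ 0) : expMean z = (Complex.exp z - 1) / z := by
  rw [expMean, integral_exp_mul_complex hz]
  simp

lemma norm_mul_norm_expMean_le {z : ℂ} (hz : 0 ≤ z.re) :
    ‖z‖ * ‖expMean z‖ ≤ 2 * Real.exp z.re := by
  rcases eq_or_ne z 0 with rfl | h0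
  · simp
  rw [expMean_eq h0, norm_div, mul_div_cancel₀ _ (norm_ne_zero_iff.2 h0)]
  refine (norm_sub_le _ _).trans ?_
  rw [Complex.norm_exp, norm_one]
  linarith [Real.one_le_exp hz]

lemma differentiable_expMean : Differentiable ℂ expMean := by
  have h : expMean = dslope Complex.exp 0 := by
    funext z
    rcases eq_or_ne z 0 with rfl | h0
    · simp [expMean, dslope_same]
    · rw [dslope_of_ne _ h0, slope_def_field, expMean_eq h0]
      simp
  rw [h, ← differentiableOn_univ]
  exact (Complex.differentiableOn_dslope (by simp)).2 Complex.differentiable_exp.differentiableOn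

section

variable {h : ℝ → ℂ} {a C δ : ℝ}

lemma movingAverage_eq_zero (h0 : ∀ y < 0, h y = 0) (hδ : 0 < δ) {y : ℝ} (hy : y < -δ) :
    movingAverage h δ y = 0 := by
  rw [movingAverage, intervalIntegral.integral_congr (g := fun _ => 0)]
  · simp
  · intro u hu
    rw [Set.uIcc_of_le zero_le_one] at hu
    exact h0 _ (by nlinarith [hu.1, hu.2])

lemma norm_movingAverage_le (ha : 0 ≤ a) (hb : ∀ y, ‖h y‖ ≤ C * Real.exp (a * y)) (hδ : 0 < δ)
    (y : ℝ) : ‖movingAverage h δ y‖ ≤ C * Real.exp (a * (y + δ)) := by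
  have hC : 0 ≤ C := by simpa using (norm_nonneg _).trans (hb 0)
  have := intervalIntegral.norm_integral_le_of_norm_le_const (a := (0 : ℝ)) (b := 1)
    (f := fun u : ℝ => h (y + δ * u)) (C := C * Real.exp (a * (y + δ))) fun u hu => by
      rw [Set.uIoc_of_le zero_le_one] at hu
      refine (hb _).trans ?_
      gcongr
      exact mul_le_of_le_one_right hδ.le hu.2
  simpa [movingAverage] using this

lemma movingAverage_locallyIntegrable (hm : Measurable h)
    (hb : ∀ y, ‖h y‖ ≤ C * Real.exp (a * y)) (x y : ℝ) : IntervalIntegrable h volume x y := by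
  refine (Continuous.intervalIntegrable (u := fun y => C * Real.exp (a * y))
    (by fun_prop) x y).mono_fun' hm.aestronglyMeasurable (Eventually.of_forall hb)

lemma movingAverage_eq_sub (hm : Measurable h)
    (hb : ∀ y, ‖h y‖ ≤ C * Real.exp (a * y)) (hδ : 0 < δ) (y : ℝ) :
    movingAverage h δ y = (δ : ℂ)⁻¹ * ((∫ v in (0 : ℝ)..(y + δ), h v) - ∫ v in (0 : ℝ)..y, h v) := by
  rw [intervalIntegral.integral_interval_sub_left (movingAverage_locallyIntegrable hm hb _ _)
    (movingAverage_locallyIntegrable hm hb _ _), movingAverage,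
    intervalIntegral.integral_comp_add_mul (fun v => h v) hδ.ne']
  simp

lemma continuous_movingAverage (hm : Measurable h)
    (hb : ∀ y, ‖h y‖ ≤ C * Real.exp (a * y)) (hδ : 0 < δ) : Continuous (movingAverage h δ) := by
  have hP := intervalIntegral.continuous_primitive (movingAverage_locallyIntegrable hm hb) 0
  have : movingAverage h δ =
    fun y => (δ : ℂ)⁻¹ * ((∫ v in (0 : ℝ)..(y + δ), h v) - ∫ v in (0 : ℝ)..y, h v) :=
    funext fun y => movingAverage_eq_sub hm hb hδ y
  rw [this]
  exact continuous_const.mul ((hP.comp (continuous_add_const δ)).sub hP)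

lemma tendsto_movingAverage (hm : Measurable h) (hb : ∀ y, ‖h y‖ ≤ C * Real.exp (a * y))
    (hr : ∀ y, ContinuousWithinAt h (Set.Ici y) y) (y : ℝ) :
    Tendsto (fun δ => movingAverage h δ y) (𝓝[>] 0) (𝓝 (h y)) := by
  have hd : HasDerivWithinAt (fun x => ∫ v in y..x, h v) (h y) (Set.Ici y) y :=
    intervalIntegral.integral_hasDerivWithinAt_right
      (movingAverage_locallyIntegrable hm hb _ _)
      hm.stronglyMeasurable.stronglyMeasurableAtFilter
      ((hr y).mono Set.Ioi_subset_Ici_self)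
  rw [hasDerivWithinAt_iff_tendsto_slope] at hd
  have hs : Tendsto (fun δ : ℝ => y + δ) (𝓝[>] 0) (𝓝[Set.Ici y \ {y}] y) := by
    refine tendsto_nhdsWithin_iff.2 ⟨?_, ?_⟩
    · have : Tendsto (fun δ : ℝ => y + δ) (𝓝 0) (𝓝 (y + 0)) := (continuous_const_add y).tendsto 0
      rw [add_zero] at this
      exact this.mono_left nhdsWithin_le_nhds
    · filter_upwards [self_mem_nhdsWithin] with δ hδ
      have : (0 : ℝ) < δ := hδ
      simpa using this
  refine (hd.comp hs).congr' ?_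
  filter_upwards [self_mem_nhdsWithin] with δ hδ
  rw [movingAverage_eq_sub hm hb hδ, intervalIntegral.integral_interval_sub_left
    (movingAverage_locallyIntegrable hm hb _ _) (movingAverage_locallyIntegrable hm hb _ _)]
  simp [slope]

lemma integrable_indicator_exp {c b : ℝ} (hc : 0 < c) :
    Integrable ((Set.Ici b).indicator fun y : ℝ => Real.exp (-c * y)) := by
  rw [integrable_indicator_iff measurableSet_Ici, integrableOn_Ici_iff_integrableOn_Ioi]
  exact integrableOn_exp_mul_Ioi (by linarith) b

lemma integral_movingAverage_mul_exp (hm : Measurable h) (h0 : ∀ y < 0, h y = 0) (ha : 0 ≤ a)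
    (hb : ∀ y, ‖h y‖ ≤ C * Real.exp (a * y)) (hδ : 0 < δ) {s : ℂ} (hs : a < s.re) :
    ∫ y : ℝ, movingAverage h δ y * Complex.exp (-s * y) =
      (∫ y : ℝ, h y * Complex.exp (-s * y)) * expMean (δ * s) := by
  have hC : 0 ≤ C := by simpa using (norm_nonneg _).trans (hb 0)
  have hprod : Integrable (Function.uncurry fun (y u : ℝ) =>
      h (y + δ * u) * Complex.exp (-s * y)) (volume.prod (volume.restrict (Set.Ioc (0 : ℝ) 1))) := by
    have h1 : Integrable (fun z : ℝ × ℝ => (C * Real.exp (a * δ) *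
        (Set.Ici (-δ)).indicator (fun y : ℝ => Real.exp (-(s.re - a) * y)) z.1) * 1)
        (volume.prod (volume.restrict (Set.Ioc (0 : ℝ) 1))) :=
      Integrable.mul_prod (f := fun y : ℝ => C * Real.exp (a * δ) *
        (Set.Ici (-δ)).indicator (fun y : ℝ => Real.exp (-(s.re - a) * y)) y)
        (g := fun _ : ℝ => (1 : ℝ))
        ((integrable_indicator_exp (by linarith)).const_mul _) (integrable_const 1)
    refine h1.mono' ?_ ?_
    · refine Measurable.aestronglyMeasurable ?_
      exact (hm.comp (by fun_prop)).mul (by fun_prop)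
    · have : ∀ᵐ z : ℝ × ℝ ∂(volume.prod (volume.restrict (Set.Ioc (0 : ℝ) 1))),
          z.2 ∈ Set.Ioc (0 : ℝ) 1 :=
        Measure.quasiMeasurePreserving_snd.ae (ae_restrict_mem measurableSet_Ioc)
      filter_upwards [this] with z hz
      simp only [Function.uncurry, norm_mul, mul_one, Complex.norm_exp]
      by_cases hy : z.1 ∈ Set.Ici (-δ)
      · rw [Set.indicator_of_mem hy]
        calc _ ≤ C * Real.exp (a * (z.1 + δ * z.2)) * Real.exp (-s * z.1).re := by
              gcongr; exact hb _
          _ ≤ C * Real.exp (a * (z.1 + δ)) * Real.exp (-s * z.1).re := by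
              gcongr; exact mul_le_of_le_one_right hδ.le hz.2
          _ = _ := by
              rw [mul_assoc, mul_assoc, ← Real.exp_add, ← Real.exp_add]
              congr 2
              simp
              ring
      · rw [Set.indicator_of_notMem hy, h0, norm_zero, zero_mul, mul_zero]
        simp only [Set.mem_Ici, not_le] at hy
        nlinarith [hz.1, hz.2]
  calc ∫ y : ℝ, movingAverage h δ y * Complex.exp (-s * y)
      = ∫ y : ℝ, ∫ u in Set.Ioc (0 : ℝ) 1, h (y + δ * u) * Complex.exp (-s * y) := by
        refine integral_congr_ae (Eventually.of_forall fun y => ?_)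
        simp only [movingAverage]
        rw [intervalIntegral.integral_of_le zero_le_one, integral_mul_const]
    _ = ∫ u in Set.Ioc (0 : ℝ) 1, ∫ y : ℝ, h (y + δ * u) * Complex.exp (-s * y) :=
        integral_integral_swap hprod
    _ = ∫ u in Set.Ioc (0 : ℝ) 1, (∫ y : ℝ, h y * Complex.exp (-s * y)) *
          Complex.exp (δ * s * u) := by
        refine integral_congr_ae (Eventually.of_forall fun u => ?_)
        simp only
        rw [← integral_mul_const, ← integral_add_right_eq_self
          (fun y : ℝ => h y * Complex.exp (-s * y) * Complex.exp (δ * s * u)) (δ * u)]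
        refine integral_congr_ae (Eventually.of_forall fun y => ?_)
        simp only
        rw [mul_assoc, ← Complex.exp_add]
        congr 2
        push_cast
        ring
    _ = _ := by
        rw [integral_const_mul, expMean, intervalIntegral.integral_of_le zero_le_one]

end

lemma integral_vertical_eq' {F : ℂ → ℂ} {b₀ b c C p : ℝ} (hp : 1 < p)
    (hF : DifferentiableOn ℂ F {s | b₀ < s.re}) (hb : b₀ < b) (hbc : b ≤ c)
    (hC : ∀ s : ℂ, b ≤ s.re → s.re ≤ c → ‖F s‖ ≤ C * (1 + |s.im|) ^ (-p)) :
    ∫ ξ : ℝ, F (b + (2 * Real.pi * ξ : ℝ) * Complex.I) =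
      ∫ ξ : ℝ, F (c + (2 * Real.pi * ξ : ℝ) * Complex.I) := by
  have h := integral_vertical_eq hp hF hb hbc hC
  rw [Measure.integral_comp_mul_left (fun t : ℝ => F (b + t * Complex.I)) (2 * Real.pi),
    Measure.integral_comp_mul_left (fun t : ℝ => F (c + t * Complex.I)) (2 * Real.pi), h]

lemma lintegral_comp_two_pi_mul (f : ℝ → ENNReal) (hf : Measurable f) :
    ∫⁻ ξ : ℝ, f (2 * Real.pi * ξ) = ENNReal.ofReal (1 / (2 * Real.pi)) * ∫⁻ t, f t := by
  have h2 : (2 * Real.pi) ≠ 0 := by positivity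
  rw [← lintegral_map hf (measurable_const_mul (2 * Real.pi)), Real.map_volume_mul_left h2,
    lintegral_smul_measure, smul_eq_mul, abs_of_pos (by positivity), one_div]

open FourierTransform in
/-- A bound for the weighted `L²` norm of a function with decaying Laplace transform. -/
lemma lintegral_sq_le_of_decay {k : ℝ → ℂ} {K : ℂ → ℂ} {C B δ a b bm b' σ₁ p : ℝ} (hp : 1 < p)
    (hk : Continuous k) (hk0 : ∀ y < -δ, k y = 0) (hkb : ∀ y, ‖k y‖ ≤ C * Real.exp (a * y))
    (ha : a < σ₁) (hb : b < bm) (hbm : bm < b') (hb' : b' ≤ σ₁)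
    (hK : DifferentiableOn ℂ K {s | b < s.re})
    (hKb : ∀ s : ℂ, bm ≤ s.re → s.re ≤ σ₁ → ‖K s‖ ≤ B * (1 + |s.im|) ^ (-p))
    (hL : ∀ t : ℝ, ∫ y : ℝ, k y * Complex.exp (-(σ₁ + t * Complex.I) * y) = K (σ₁ + t * Complex.I)) :
    ∫⁻ y : ℝ, ‖k y‖ₑ ^ 2 * ENNReal.ofReal (Real.exp (-2 * b' * y)) =
      ENNReal.ofReal (1 / (2 * Real.pi)) * ∫⁻ t : ℝ, ‖K (b' + t * Complex.I)‖ₑ ^ 2 := by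
  have hB : 0 ≤ B := by
    have := (norm_nonneg _).trans (hKb bm (by simp) (by simpa using (hbm.trans_le hb').le))
    simpa using this
  have hexp_int : ∀ {σ c D : ℝ}, c < σ → (∀ y, ‖k y‖ ≤ D * Real.exp (c * y)) →
      Integrable fun y : ℝ => k y * Complex.exp (-σ * y) := by
    intro σ c D hσ hD
    refine ((integrable_indicator_exp (c := σ - c) (b := -δ) (by linarith)).const_mul D).mono'
      (by fun_prop) (Eventually.of_forall fun y => ?_)
    rw [norm_mul, Complex.norm_exp]
    by_cases hy : y ∈ Set.Ici (-δ)
    · rw [Set.indicator_of_mem hy]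
      refine (mul_le_mul_of_nonneg_right (hD y) (Real.exp_pos _).le).trans (le_of_eq ?_)
      rw [mul_assoc, ← Real.exp_add]
      congr 2
      simp
      ring
    · rw [Set.indicator_of_notMem hy, hk0 y (by simpa using hy)]
      simp
  have hline : ∀ {σ : ℝ}, bm ≤ σ → σ ≤ σ₁ → ∀ t : ℝ,
      ‖K (σ + t * Complex.I)‖ ≤ B * (1 + |t|) ^ (-p) := by
    intro σ h1 h2 t
    simpa using hKb (σ + t * Complex.I) (by simpa using h1) (by simpa using h2)
  have hw : ∀ {σ : ℝ}, bm ≤ σ → σ ≤ σ₁ →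
      Continuous (fun ξ : ℝ => K (σ + (2 * Real.pi * ξ : ℝ) * Complex.I)) ∧
      Integrable fun ξ : ℝ => K (σ + (2 * Real.pi * ξ : ℝ) * Complex.I) := by
    intro σ h1 h2
    obtain ⟨hc, hi⟩ := integrable_vertical hp hK (hb.trans_le h1) (hline h1 h2)
    exact ⟨hc.comp (continuous_const_mul (2 * Real.pi)),
      hi.comp_mul_left' (by positivity : 2 * Real.pi ≠ 0)⟩
  -- Fourier inversion on the line of absolute convergence
  have hinv : ∀ y : ℝ, k y = ∫ ξ : ℝ, K (σ₁ + (2 * Real.pi * ξ : ℝ) * Complex.I) *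
      Complex.exp ((σ₁ + (2 * Real.pi * ξ : ℝ) * Complex.I) * y) := by
    intro y
    set g : ℝ → ℂ := fun y => k y * Complex.exp (-σ₁ * y) with hg
    have hFg : 𝓕 g = fun ξ : ℝ => K (σ₁ + (2 * Real.pi * ξ : ℝ) * Complex.I) := by
      funext ξ
      rw [Real.fourier_real_eq_integral_exp_smul, ← hL]
      refine integral_congr_ae (Eventually.of_forall fun y => ?_)
      simp only [hg, smul_eq_mul]
      rw [mul_left_comm, ← Complex.exp_add]
      congr 2
      push_cast
      ring
    have h := (by fun_prop : Continuous g).fourierInv_fourier_eq (hexp_int ha hkb)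
      (by rw [hFg]; exact (hw (hbm.trans_le hb').le le_rfl).2)
    have h2 := congrFun h y
    rw [Real.fourierInv_eq', hFg] at h2
    have h3 : k y = g y * Complex.exp (σ₁ * y) := by
      simp only [hg]
      rw [mul_assoc, ← Complex.exp_add]
      simp
    rw [h3, ← h2, ← integral_mul_const]
    refine integral_congr_ae (Eventually.of_forall fun ξ => ?_)
    simp only [smul_eq_mul]
    rw [mul_comm (Complex.exp _) (K _), mul_assoc, ← Complex.exp_add]
    congr 2
    simp
    ring
  have hshift : ∀ {σ : ℝ}, bm ≤ σ → σ ≤ σ₁ → ∀ y : ℝ,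
      k y = ∫ ξ : ℝ, K (σ + (2 * Real.pi * ξ : ℝ) * Complex.I) *
        Complex.exp ((σ + (2 * Real.pi * ξ : ℝ) * Complex.I) * y) := by
    intro σ h1 h2 y
    rw [hinv y]
    refine (integral_vertical_eq' (F := fun s => K s * Complex.exp (s * y)) (b₀ := b)
      (C := B * Real.exp (max (bm * y) (σ₁ * y))) hp (hK.mul (by fun_prop)) (hb.trans_le h1) h2
      fun s hs1 hs2 => ?_).symm
    rw [norm_mul, Complex.norm_exp, mul_right_comm]
    refine mul_le_mul (hKb s (h1.trans hs1) hs2) (Real.exp_le_exp.2 ?_) (Real.exp_pos _).le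
      (by positivity)
    simp only [Complex.mul_re, Complex.ofReal_re, Complex.ofReal_im, mul_zero, sub_zero]
    rcases le_total 0 y with hy | hy
    · exact le_max_of_le_right (mul_le_mul_of_nonneg_right hs2 hy)
    · exact le_max_of_le_left (mul_le_mul_of_nonpos_right (h1.trans hs1) hy)
  have hkb2 : ∀ y, ‖k y‖ ≤ (∫ ξ : ℝ, ‖K (bm + (2 * Real.pi * ξ : ℝ) * Complex.I)‖) *
      Real.exp (bm * y) := by
    intro y
    rw [hshift le_rfl (hbm.trans_le hb').le y, ← integral_mul_const]
    refine (norm_integral_le_integral_norm _).trans (le_of_eq ?_)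
    refine integral_congr_ae (Eventually.of_forall fun ξ => ?_)
    simp only [norm_mul, Complex.norm_exp]
    simp
  set g : ℝ → ℂ := fun y => k y * Complex.exp (-b' * y) with hg
  obtain ⟨hwc, hwi⟩ := hw hbm.le hb'
  have hgw : g = 𝓕⁻ fun ξ : ℝ => K (b' + (2 * Real.pi * ξ : ℝ) * Complex.I) := by
    funext y
    simp only [hg]
    rw [Real.fourierInv_eq', hshift hbm.le hb' y, ← integral_mul_const]
    refine integral_congr_ae (Eventually.of_forall fun ξ => ?_)
    simp only [smul_eq_mul]
    rw [mul_comm (Complex.exp _) (K _), mul_assoc, ← Complex.exp_add]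
    congr 2
    simp
    ring
  have hfin := lintegral_fourierInv_sq hwc hwi (hexp_int hbm hkb2) hgw
    ⟨B, fun ξ => (hline hbm.le hb' _).trans (mul_le_of_le_one_right hB
      (Real.rpow_le_one_of_one_le_of_nonpos (by simp) (by linarith)))⟩
  have hmeas : Measurable fun t : ℝ => ‖K (b' + t * Complex.I)‖ₑ ^ 2 :=
    ((integrable_vertical hp hK (hb.trans hbm) (hline hbm.le hb')).1.measurable).enorm.pow_const 2
  rw [← lintegral_comp_two_pi_mul _ hmeas, ← hfin]
  refine lintegral_congr fun y => ?_
  simp only [enorm_mul, mul_pow]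
  congr 1
  rw [← ofReal_norm (Complex.exp _), ← ENNReal.ofReal_pow (norm_nonneg _), Complex.norm_exp,
    ← Real.exp_nat_mul]
  congr 2
  simp
  ring

/-- An inequality of Plancherel type for Laplace transforms that continue to the left of the
half-plane of absolute convergence. -/
theorem lintegral_sq_le_of_laplace {h : ℝ → ℂ} {H : ℂ → ℂ} {C C' a b bm b' σ₁ : ℝ}
    (hm : Measurable h) (h0 : ∀ y < 0, h y = 0)
    (hr : ∀ y, ContinuousWithinAt h (Set.Ici y) y)
    (hbd : ∀ y, ‖h y‖ ≤ C * Real.exp (a * y)) (ha0 : 0 ≤ a) (ha : a < σ₁)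
    (hb0 : 0 ≤ b) (hb : b < bm) (hbm : bm < b') (hb' : b' ≤ σ₁)
    (hH : DifferentiableOn ℂ H {s | b < s.re})
    (hHb : ∀ s : ℂ, bm ≤ s.re → s.re ≤ σ₁ → ‖H s‖ ≤ C' * (1 + |s.im|) ^ (-(3 / 4) : ℝ))
    (hL : ∀ t : ℝ, ∫ y : ℝ, h y * Complex.exp (-(σ₁ + t * Complex.I) * y) = H (σ₁ + t * Complex.I)) :
    ∫⁻ y : ℝ, ‖h y‖ₑ ^ 2 * ENNReal.ofReal (Real.exp (-2 * b' * y)) ≤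
      ENNReal.ofReal (1 / (2 * Real.pi)) * ∫⁻ t : ℝ, ‖H (b' + t * Complex.I)‖ₑ ^ 2 := by
  have hC' : 0 ≤ C' := by
    have := (norm_nonneg _).trans (hHb bm (by simp) (by simpa using (hbm.trans_le hb').le))
    simpa using this
  set X : ENNReal := ENNReal.ofReal (1 / (2 * Real.pi)) *
    ∫⁻ t : ℝ, ‖H (b' + t * Complex.I)‖ₑ ^ 2 with hX
  have hmain : ∀ δ : ℝ, 0 < δ →
      ∫⁻ y : ℝ, ‖movingAverage h δ y‖ₑ ^ 2 * ENNReal.ofReal (Real.exp (-2 * b' * y)) ≤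
        ENNReal.ofReal (Real.exp (2 * δ * b')) * X := by
    intro δ hδ
    have hmem : ∀ {s : ℂ}, 0 ≤ s.re → 0 ≤ ((δ : ℂ) * s).re := by
      intro s hs; simp; positivity
    rw [lintegral_sq_le_of_decay (k := movingAverage h δ) (K := fun s => H s * expMean (δ * s))
      (C := C * Real.exp (a * δ)) (B := C' * (Real.exp (δ * σ₁) * (1 + 2 / δ))) (δ := δ) (a := a)
      (b := b) (bm := bm) (b' := b') (σ₁ := σ₁) (p := 7 / 4) (by norm_num)
      (continuous_movingAverage hm hbd hδ) (fun y hy => movingAverage_eq_zero h0 hδ hy)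
      (fun y => (norm_movingAverage_le ha0 hbd hδ y).trans (le_of_eq ?_)) ha hb hbm hb'
      (hH.mul (differentiable_expMean.comp (differentiable_id.const_mul (δ : ℂ))).differentiableOn)
      ?_ ?_]
    · rw [hX, mul_left_comm]
      refine mul_le_mul_right ?_ _
      rw [← lintegral_const_mul' _ _ ENNReal.ofReal_ne_top]
      refine lintegral_mono fun t => ?_
      rw [enorm_mul, mul_pow, mul_comm]
      refine mul_le_mul_left ?_ _
      rw [← ofReal_norm, ← ENNReal.ofReal_pow (norm_nonneg _)]
      refine ENNReal.ofReal_le_ofReal ?_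
      have h1 := norm_expMean_le (z := δ * (b' + t * Complex.I)) (hmem (by simp; linarith))
      calc _ ≤ (Real.exp (δ * (b' + t * Complex.I) : ℂ).re) ^ 2 := by gcongr
        _ = _ := by
          rw [← Real.exp_nat_mul]; congr 1; simp; ring
    · intro s hs1 hs2
      have hre : 0 ≤ s.re := by linarith
      have h1 := norm_expMean_le (hmem hre)
      have h2 := norm_mul_norm_expMean_le (hmem hre)
      have hE : Real.exp ((δ : ℂ) * s).re ≤ Real.exp (δ * σ₁) := by
        simp only [Complex.re_ofReal_mul]; gcongr
      have h3 : (1 + |s.im|) * ‖expMean (δ * s)‖ ≤ Real.exp (δ * σ₁) * (1 + 2 / δ) := by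
        have h4 : δ * |s.im| * ‖expMean (δ * s)‖ ≤ 2 * Real.exp (δ * σ₁) := by
          refine (mul_le_mul_of_nonneg_right ?_ (norm_nonneg _)).trans (h2.trans (by linarith))
          rw [norm_mul, Complex.norm_real, Real.norm_of_nonneg hδ.le]
          gcongr
          exact Complex.abs_im_le_norm s
        have h5 : |s.im| * ‖expMean (δ * s)‖ ≤ 2 * Real.exp (δ * σ₁) / δ := by
          rw [le_div_iff₀ hδ]; linarith
        calc _ = ‖expMean (δ * s)‖ + |s.im| * ‖expMean (δ * s)‖ := by ring
          _ ≤ Real.exp (δ * σ₁) + 2 * Real.exp (δ * σ₁) / δ := by linarith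
          _ = _ := by ring
      have hpos : 0 < 1 + |s.im| := by positivity
      rw [norm_mul]
      calc ‖H s‖ * ‖expMean (δ * s)‖
          ≤ C' * (1 + |s.im|) ^ (-(3 / 4) : ℝ) *
            (Real.exp (δ * σ₁) * (1 + 2 / δ) / (1 + |s.im|)) := by
            gcongr
            · exact hHb s hs1 hs2
            · rw [le_div_iff₀ hpos]; linarith
        _ = _ := by
            have : (1 + |s.im|) ^ (-(7 / 4) : ℝ) =
                (1 + |s.im|) ^ (-(3 / 4) : ℝ) * (1 + |s.im|)⁻¹ := by
              rw [← Real.rpow_neg_one, ← Real.rpow_add hpos]; norm_num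
            rw [this]; ring
    · intro t
      rw [integral_movingAverage_mul_exp hm h0 ha0 hbd hδ (by simpa using ha), hL]
    · rw [mul_assoc, ← Real.exp_add]; ring_nf
  have hlim : Tendsto (fun n : ℕ => 1 / ((n : ℝ) + 1)) atTop (𝓝[>] 0) :=
    tendsto_nhdsWithin_iff.2 ⟨tendsto_one_div_add_atTop_nhds_zero_nat,
      Eventually.of_forall fun n => by simp only [Set.mem_Ioi]; positivity⟩
  have hmeas : ∀ n : ℕ, Measurable fun y => ‖movingAverage h (1 / ((n : ℝ) + 1)) y‖ₑ ^ 2 *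
      ENNReal.ofReal (Real.exp (-2 * b' * y)) := fun n =>
    ((continuous_movingAverage hm hbd (by positivity)).measurable.enorm.pow_const 2).mul
      (by fun_prop)
  calc ∫⁻ y : ℝ, ‖h y‖ₑ ^ 2 * ENNReal.ofReal (Real.exp (-2 * b' * y))
      = ∫⁻ y : ℝ, liminf (fun n : ℕ => ‖movingAverage h (1 / ((n : ℝ) + 1)) y‖ₑ ^ 2 *
          ENNReal.ofReal (Real.exp (-2 * b' * y))) atTop := by
        refine lintegral_congr fun y => (Tendsto.liminf_eq ?_).symm
        refine ENNReal.Tendsto.mul_const ?_ (Or.inr ENNReal.ofReal_ne_top)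
        exact ((ENNReal.continuous_pow 2).tendsto _).comp
          (((tendsto_movingAverage hm hbd hr y).comp hlim).enorm)
    _ ≤ liminf (fun n : ℕ => ∫⁻ y : ℝ, ‖movingAverage h (1 / ((n : ℝ) + 1)) y‖ₑ ^ 2 *
          ENNReal.ofReal (Real.exp (-2 * b' * y))) atTop := lintegral_liminf_le hmeas
    _ ≤ liminf (fun n : ℕ => ENNReal.ofReal (Real.exp (2 * (1 / ((n : ℝ) + 1)) * b')) * X)
          atTop := liminf_le_liminf (Eventually.of_forall fun n => hmain _ (by positivity))
    _ = X := by
        refine Tendsto.liminf_eq ?_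
        have h1 : Tendsto (fun n : ℕ => ENNReal.ofReal (Real.exp (2 * (1 / ((n : ℝ) + 1)) * b')))
            atTop (𝓝 (ENNReal.ofReal (Real.exp (2 * 0 * b')))) := by
          refine ((ENNReal.continuous_ofReal.tendsto _).comp ((Real.continuous_exp.tendsto _).comp
            ((tendsto_one_div_add_atTop_nhds_zero_nat.const_mul 2).mul_const b')))
        simp only [mul_zero, zero_mul, Real.exp_zero, ENNReal.ofReal_one] at h1
        simpa using ENNReal.Tendsto.mul_const (b := X) h1 (Or.inl one_ne_zero)

/-- The finite part of the explicit formula, for the zeros of height at most `T`. -/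
noncomputable def zeroSum (f : ℂ → ℂ) (T y : ℝ) : ℂ :=
  ∑ γ ∈ zeroFinset f T, (critMult f γ : ℂ) / critPt γ * Complex.exp (critPt γ * y)

lemma continuous_zeroSum (f : ℂ → ℂ) (T : ℝ) : Continuous (zeroSum f T) := by
  unfold zeroSum; fun_prop

lemma exists_norm_zeroSum_le (f : ℂ → ℂ) (T : ℝ) :
    ∃ C, ∀ y : ℝ, ‖zeroSum f T y‖ ≤ C * Real.exp (1 / 2 * y) := by
  refine ⟨∑ γ ∈ zeroFinset f T, ‖(critMult f γ : ℂ) / critPt γ‖, fun y => ?_⟩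
  rw [zeroSum, Finset.sum_mul]
  refine (norm_sum_le _ _).trans (Finset.sum_le_sum fun γ _ => ?_)
  rw [norm_mul, Complex.norm_exp]
  simp

lemma integrable_exp_Ici {s w : ℂ} (hs : w.re < s.re) :
    Integrable ((Set.Ici (0 : ℝ)).indicator fun y : ℝ => Complex.exp (w * y) * Complex.exp (-s * y)) := by
  rw [integrable_indicator_iff measurableSet_Ici, integrableOn_Ici_iff_integrableOn_Ioi]
  have := integrableOn_exp_mul_complex_Ioi (a := w - s) (by simpa using hs) 0
  refine this.congr_fun (fun y _ => ?_) measurableSet_Ioi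
  simp only
  rw [← Complex.exp_add]; ring_nf

lemma integral_exp_Ici {s w : ℂ} (hs : w.re < s.re) :
    ∫ y : ℝ, (Set.Ici (0 : ℝ)).indicator
      (fun y : ℝ => Complex.exp (w * y) * Complex.exp (-s * y)) y = 1 / (s - w) := by
  rw [integral_indicator measurableSet_Ici, integral_Ici_eq_integral_Ioi]
  have h := integral_exp_mul_complex_Ioi (a := w - s) (by simpa using hs) 0
  rw [Complex.ofReal_zero, mul_zero, Complex.exp_zero, ← neg_sub s w, neg_div_neg_eq] at h
  rw [← h]
  refine setIntegral_congr_fun measurableSet_Ioi fun y _ => ?_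
  rw [← Complex.exp_add]; ring_nf

/-- `Φ` is a right-continuous function supported on `[0, ∞)` whose Laplace transform on `Re s = 3` is
the function `-f' / (s f)`. -/
structure IsPrimeSum (f : ℂ → ℂ) (Φ : ℝ → ℂ) : Prop where
  meas : Measurable Φ
  zero : ∀ y < 0, Φ y = 0
  right : ∀ y, ContinuousWithinAt Φ (Set.Ici y) y
  bound : ∃ C, ∀ y, ‖Φ y‖ ≤ C * Real.exp y
  laplace : ∀ t : ℝ, ∫ y : ℝ, Φ y * Complex.exp (-(3 + t * Complex.I) * y) =
    -(logDeriv f (3 + t * Complex.I) / (3 + t * Complex.I))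

lemma IsPrimeSum.lintegral_sq_le {f : ℂ → ℂ} {Φ : ℝ → ℂ} (hΦ : IsPrimeSum f Φ)
    (hf : IsRiemannType f) (T : ℝ) {b : ℝ} (hb : 1 / 2 < b) (hb3 : b ≤ 3) :
    ∫⁻ y in Set.Ici 0, ‖Φ y + zeroSum f T y‖ₑ ^ 2 * ENNReal.ofReal (Real.exp (-2 * b * y)) ≤
      ENNReal.ofReal (1 / (2 * Real.pi)) *
        ∫⁻ t : ℝ, ‖truncLogDeriv f T (b + t * Complex.I)‖ₑ ^ 2 := by
  obtain ⟨C₁, hC₁⟩ := hΦ.bound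
  obtain ⟨C₂, hC₂⟩ := exists_norm_zeroSum_le f T
  have hC₁0 : 0 ≤ C₁ := by simpa using (norm_nonneg _).trans (hC₁ 0)
  have hC₂0 : 0 ≤ C₂ := by simpa using (norm_nonneg _).trans (hC₂ 0)
  obtain ⟨C', hC', hdec⟩ := hf.exists_truncLogDeriv_decay T (ε := (b - 1 / 2) / 2) (by linarith)
  set h : ℝ → ℂ := fun y => Φ y + (Set.Ici 0).indicator (zeroSum f T) y with hh
  have hpos : ∀ t : ℝ, ∀ γ : ℝ, (critPt γ).re < (3 + t * Complex.I : ℂ).re := by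
    intro t γ; simp; norm_num
  have hmain := lintegral_sq_le_of_laplace (h := h) (H := fun s => -truncLogDeriv f T s)
    (C := C₁ + C₂) (C' := C') (a := 1) (b := 1 / 2) (bm := 1 / 2 + (b - 1 / 2) / 2) (b' := b)
    (σ₁ := 3) (hΦ.meas.add ((continuous_zeroSum f T).measurable.indicator measurableSet_Ici))
    (fun y hy => ?_) (fun y => ?_) (fun y => ?_) zero_le_one (by norm_num) (by norm_num)
    (by linarith) (by linarith) hb3 (hf.differentiableOn_truncLogDeriv T).neg
    (fun s hs1 hs2 => by rw [norm_neg]; exact hdec s hs1 hs2) (fun t => ?_)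
  · simp only [enorm_neg] at hmain
    refine le_trans ?_ hmain
    refine (setLIntegral_congr_fun measurableSet_Ici fun y hy => ?_).trans_le
      (setLIntegral_le_lintegral (Set.Ici 0) _)
    simp only [hh, Set.indicator_of_mem hy]
  · simp only [hh]
    rw [hΦ.zero y hy, Set.indicator_of_notMem (by simpa using hy), add_zero]
  · refine (hΦ.right y).add ?_
    rcases lt_or_ge y 0 with hy | hy
    · refine ContinuousAt.continuousWithinAt ?_
      refine (continuousAt_const (y := (0 : ℂ))).congr ?_
      filter_upwards [Iio_mem_nhds hy] with z hz
      rw [Set.indicator_of_notMem (by simpa using hz)]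
    · refine ((continuous_zeroSum f T).continuousWithinAt).congr (fun z hz => ?_) ?_
      · exact Set.indicator_of_mem (hy.trans hz : (0 : ℝ) ≤ z) _
      · exact Set.indicator_of_mem (s := Set.Ici (0 : ℝ)) hy _
  · simp only [hh, one_mul, add_mul]
    refine (norm_add_le _ _).trans (add_le_add (hC₁ y) ?_)
    by_cases hy : y ∈ Set.Ici (0 : ℝ)
    · rw [Set.indicator_of_mem hy]
      refine (hC₂ y).trans ?_
      gcongr
      have : (0 : ℝ) ≤ y := hy
      linarith
    · rw [Set.indicator_of_notMem hy, norm_zero]; positivity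
  · have hrw : ∀ y : ℝ, h y * Complex.exp (-(3 + t * Complex.I) * y) =
        Φ y * Complex.exp (-(3 + t * Complex.I) * y) +
        ∑ γ ∈ zeroFinset f T, (critMult f γ : ℂ) / critPt γ * (Set.Ici (0 : ℝ)).indicator
          (fun y : ℝ => Complex.exp (critPt γ * y) *
            Complex.exp (-(3 + t * Complex.I) * y)) y := by
      intro y
      simp only [hh, add_mul]
      congr 1
      by_cases hy : y ∈ Set.Ici (0 : ℝ)
      · simp only [Set.indicator_of_mem hy, zeroSum, Finset.sum_mul, mul_assoc]
      · simp only [Set.indicator_of_notMem hy, mul_zero, zero_mul, Finset.sum_const_zero]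
    have hΦi : Integrable fun y : ℝ => Φ y * Complex.exp (-(3 + t * Complex.I) * y) := by
      refine ((integrable_indicator_exp (c := 2) (b := 0) two_pos).const_mul C₁).mono'
        (hΦ.meas.aestronglyMeasurable.mul (by fun_prop)) (Eventually.of_forall fun y => ?_)
      rw [norm_mul, Complex.norm_exp]
      by_cases hy : y ∈ Set.Ici (0 : ℝ)
      · rw [Set.indicator_of_mem hy]
        refine (mul_le_mul_of_nonneg_right (hC₁ y) (Real.exp_pos _).le).trans (le_of_eq ?_)
        rw [mul_assoc, ← Real.exp_add]
        congr 2
        simp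
        ring
      · rw [Set.indicator_of_notMem hy, hΦ.zero y (by simpa using hy)]
        simp
    push_cast
    simp only [hrw]
    rw [integral_add hΦi (integrable_finsetSum _ fun γ _ =>
      (integrable_exp_Ici (hpos t γ)).const_mul _), hΦ.laplace,
      integral_finsetSum _ fun γ _ => (integrable_exp_Ici (hpos t γ)).const_mul _]
    simp only [integral_const_mul, integral_exp_Ici (hpos t _), truncLogDeriv, neg_sub]
    rw [neg_add_eq_sub]
    congr 1
    refine Finset.sum_congr rfl fun γ _ => ?_
    rw [div_mul_div_comm, mul_one]

/-- The truncated explicit formula holds in mean square, with respect to Abel means. -/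
lemma IsPrimeSum.mean_sq_le {f : ℂ → ℂ} {Φ : ℝ → ℂ} (hΦ : IsPrimeSum f Φ)
    (hf : IsRiemannType f) {η : ENNReal} (hη : η ≠ 0) :
    ∃ T₀ : ℝ, ∀ T ≥ T₀, ∀ᶠ ε in 𝓝[>] (0 : ℝ),
      ENNReal.ofReal ε * ∫⁻ y in Set.Ici 0, ‖Φ y + zeroSum f T y‖ₑ ^ 2 *
        ENNReal.ofReal (Real.exp (-(1 + 2 * ε) * y)) ≤ η := by
  obtain ⟨T₀, hT₀⟩ := hf.truncLogDeriv_mean_sq hη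
  refine ⟨T₀, fun T hT => ?_⟩
  filter_upwards [hT₀ T hT, Ioo_mem_nhdsGT (zero_lt_one (α := ℝ))] with ε hε hmem
  have h1 := hΦ.lintegral_sq_le hf T (b := 1 / 2 + ε) (by linarith [hmem.1]) (by linarith [hmem.2])
  have h2 : ENNReal.ofReal (1 / (2 * Real.pi)) ≤ 1 := by
    rw [ENNReal.ofReal_le_one, div_le_one (by positivity)]
    linarith [Real.pi_gt_three]
  push_cast at h1
  calc _ ≤ ENNReal.ofReal ε * (ENNReal.ofReal (1 / (2 * Real.pi)) *
        ∫⁻ t : ℝ, ‖truncLogDeriv f T (1 / 2 + ε + t * Complex.I)‖ₑ ^ 2) := by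
        refine mul_le_mul_right (le_trans (le_of_eq ?_) h1) _
        refine lintegral_congr fun y => ?_
        congr 3
        ring
    _ ≤ ENNReal.ofReal ε * (1 * ∫⁻ t : ℝ, ‖truncLogDeriv f T (1 / 2 + ε + t * Complex.I)‖ₑ ^ 2) :=
        mul_le_mul_right (mul_le_mul_left h2 _) _
    _ ≤ η := by rwa [one_mul]

lemma IsPrimeSum.lintegral_sq_lt_top {f : ℂ → ℂ} {Φ : ℝ → ℂ} (hΦ : IsPrimeSum f Φ)
    (hf : IsRiemannType f) :
    ∫⁻ y in Set.Ici 0, ‖Φ y‖ₑ ^ 2 * ENNReal.ofReal (Real.exp (-2 * y)) < ⊤ := by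
  have h1 := hΦ.lintegral_sq_le hf (-1) (b := 1) (by norm_num) (by norm_num)
  have h0 : ∀ y, zeroSum f (-1) y = 0 := fun y => by
    have : zeroFinset f (-1) = ∅ := by
      refine Finset.eq_empty_of_forall_notMem fun γ hγ => ?_
      have := (hf.mem_zeroFinset.1 hγ).1
      linarith [abs_nonneg γ]
    rw [zeroSum, this, Finset.sum_empty]
  simp only [h0, add_zero, mul_one] at h1
  refine h1.trans_lt (ENNReal.mul_lt_top ENNReal.ofReal_lt_top ?_)
  obtain ⟨C, hC, hdec⟩ := hf.exists_truncLogDeriv_decay (-1) (ε := 1 / 2) (by norm_num)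
  have hi : Integrable fun t : ℝ => C ^ 2 * (1 + |t|) ^ (-(3 / 2) : ℝ) :=
    (integrable_one_add_abs_rpow (by norm_num)).const_mul _
  refine lt_of_le_of_lt (lintegral_mono fun t => ?_) hi.lintegral_lt_top
  rw [← ofReal_norm, ← ENNReal.ofReal_pow (norm_nonneg _)]
  refine ENNReal.ofReal_le_ofReal ?_
  have h2 := hdec ((1 : ℝ) + t * Complex.I) (by simp; norm_num) (by simp)
  calc _ ≤ (C * (1 + |t|) ^ (-(3 / 4) : ℝ)) ^ 2 := by
        refine pow_le_pow_left₀ (norm_nonneg _) ?_ 2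
        simpa using h2
    _ = _ := by
        rw [mul_pow, ← Real.rpow_natCast ((1 + |t|) ^ (-(3 / 4) : ℝ)),
          ← Real.rpow_mul (by positivity)]
        norm_num

/-- The function `s ∫₁^∞ S(t) t^(-s-1) dt`. -/
noncomputable def mellinTail (S : ℝ → ℂ) (s : ℂ) : ℂ :=
  s * ∫ t in Set.Ioi (1 : ℝ), S t * (t : ℂ) ^ (-(s + 1))

lemma norm_cpow_neg_le {t : ℝ} (ht : 1 < t) (s : ℂ) :
    ‖(t : ℂ) ^ (-(s + 1))‖ = t ^ (-(s.re + 1)) := by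
  rw [Complex.norm_cpow_eq_rpow_re_of_pos (by linarith)]
  simp

lemma integrableOn_mul_cpow {S : ℝ → ℂ} {B a : ℝ} (hS : Measurable S)
    (hB : ∀ t, 1 < t → ‖S t‖ ≤ B * t ^ a) {s : ℂ} (hs : a < s.re) :
    IntegrableOn (fun t : ℝ => S t * (t : ℂ) ^ (-(s + 1))) (Set.Ioi 1) := by
  have h1 : IntegrableOn (fun t : ℝ => B * t ^ (a - (s.re + 1))) (Set.Ioi 1) :=
    (integrableOn_Ioi_rpow_of_lt (by linarith) one_pos).const_mul B
  refine Integrable.mono' h1 ?_ ?_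
  · exact (hS.mul (by fun_prop)).aestronglyMeasurable
  · filter_upwards [ae_restrict_mem measurableSet_Ioi] with t ht
    have ht1 : (1 : ℝ) < t := ht
    rw [norm_mul, norm_cpow_neg_le ht1, sub_eq_add_neg, Real.rpow_add (by linarith), ← mul_assoc]
    exact mul_le_mul_of_nonneg_right (hB t ht1) (by positivity)

lemma norm_mellinTail_le {S : ℝ → ℂ} {B : ℝ} (hB : ∀ t, 1 < t → ‖S t‖ ≤ B) {s : ℂ}
    (hs : 0 < s.re) : ‖mellinTail S s‖ ≤ ‖s‖ * (B / s.re) := by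
  rw [mellinTail, norm_mul]
  gcongr
  have hi : IntegrableOn (fun t : ℝ => B * t ^ (-(s.re + 1))) (Set.Ioi 1) :=
    (integrableOn_Ioi_rpow_of_lt (by linarith) one_pos).const_mul B
  refine (norm_integral_le_of_norm_le hi ?_).trans (le_of_eq ?_)
  · filter_upwards [ae_restrict_mem measurableSet_Ioi] with t ht
    rw [norm_mul, norm_cpow_neg_le ht]
    exact mul_le_mul_of_nonneg_right (hB t ht) (Real.rpow_nonneg (by linarith [Set.mem_Ioi.1 ht]) _)
  · rw [integral_const_mul, integral_Ioi_rpow_of_lt (by linarith) one_pos, Real.one_rpow]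
    rw [show -(s.re + 1) + 1 = -s.re by ring, neg_div_neg_eq]
    ring

lemma differentiableOn_mellinTail {S : ℝ → ℂ} {B : ℝ} (hS : Measurable S)
    (hB : ∀ t, 1 < t → ‖S t‖ ≤ B) : DifferentiableOn ℂ (mellinTail S) {s | 0 < s.re} := by
  have hB0 : 0 ≤ B := (norm_nonneg _).trans (hB 2 (by norm_num))
  have heq : mellinTail S = fun s => s * mellin ((Set.Ioi 1).indicator S) (-s) := by
    funext s
    rw [mellinTail, mellin, ← integral_indicator measurableSet_Ioi,
      ← integral_indicator measurableSet_Ioi]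
    congr 1
    refine integral_congr_ae (Eventually.of_forall fun t => ?_)
    by_cases ht : t ∈ Set.Ioi (1 : ℝ)
    · have h0 : t ∈ Set.Ioi (0 : ℝ) := Set.mem_Ioi.2 (by linarith [Set.mem_Ioi.1 ht])
      simp only [Set.indicator_of_mem ht, Set.indicator_of_mem h0, smul_eq_mul]
      rw [mul_comm]; ring_nf
    · rw [Set.indicator_of_notMem ht, Set.indicator_apply, Set.indicator_of_notMem ht, smul_zero,
        ite_self]
  have hm : Measurable ((Set.Ioi (1 : ℝ)).indicator S) := hS.indicator measurableSet_Ioi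
  have hbd : ∀ t, ‖(Set.Ioi (1 : ℝ)).indicator S t‖ ≤ B := by
    intro t
    by_cases ht : t ∈ Set.Ioi (1 : ℝ)
    · rw [Set.indicator_of_mem ht]; exact hB t ht
    · rw [Set.indicator_of_notMem ht, norm_zero]; exact hB0
  rw [heq]
  intro s hs
  have hs0 : 0 < s.re := hs
  refine DifferentiableAt.differentiableWithinAt ?_
  refine differentiableAt_id.mul (DifferentiableAt.comp s (g := mellin ((Set.Ioi 1).indicator S))
    (f := fun s => -s) ?_ differentiableAt_id.neg)
  refine mellin_differentiableAt_of_isBigO_rpow (a := 0) (b := (-s).re - 1) ?_ ?_ (by simpa using hs0)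
    ?_ (by linarith)
  · refine (LocallyIntegrable.locallyIntegrableOn ?_ _)
    exact (locallyIntegrable_const B).mono hm.aestronglyMeasurable
      (Eventually.of_forall fun t => (hbd t).trans (le_abs_self B))
  · refine IsBigO.of_bound B (Eventually.of_forall fun t => ?_)
    simpa using hbd t
  · refine (isBigO_zero _ _).congr' ?_ EventuallyEq.rfl
    filter_upwards [Ioo_mem_nhdsGT (zero_lt_one (α := ℝ))] with t ht
    rw [Set.indicator_of_notMem]
    simpa using ht.2.le

/-- Polynomial growth on the strip `0.1 ≤ Re s ≤ 3.9`. -/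
def PolyGrowth (f : ℂ → ℂ) : Prop := ∃ (C : ℝ) (A : ℕ), 0 < C ∧
  ∀ s : ℂ, 0.1 ≤ s.re → s.re ≤ 3.9 → ‖f s‖ ≤ C * (1 + |s.im|) ^ A

lemma PolyGrowth.mul {f g : ℂ → ℂ} (hf : PolyGrowth f) (hg : PolyGrowth g) :
    PolyGrowth fun s => f s * g s := by
  obtain ⟨C, A, hC, h⟩ := hf
  obtain ⟨C', A', hC', h'⟩ := hg
  refine ⟨C * C', A + A', by positivity, fun s h1 h2 => ?_⟩
  rw [norm_mul, pow_add, mul_mul_mul_comm]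
  exact mul_le_mul (h s h1 h2) (h' s h1 h2) (norm_nonneg _) (by positivity)

lemma PolyGrowth.prod {ι : Type*} (s : Finset ι) {f : ι → ℂ → ℂ} (hf : ∀ i ∈ s, PolyGrowth (f i)) :
    PolyGrowth fun z => ∏ i ∈ s, f i z := by
  induction s using Finset.induction_on with
  | empty => exact ⟨1, 0, one_pos, by simp⟩
  | insert a s ha ih =>
    simp only [Finset.prod_insert ha]
    exact (hf a (by simp)).mul (ih fun i hi => hf i (by simp [hi]))

lemma PolyGrowth.add {f g : ℂ → ℂ} (hf : PolyGrowth f) (hg : PolyGrowth g) :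
    PolyGrowth fun s => f s + g s := by
  obtain ⟨C, A, hC, h⟩ := hf
  obtain ⟨C', A', hC', h'⟩ := hg
  refine ⟨C + C', A + A', by positivity, fun s h1 h2 => ?_⟩
  have h3 : (1 : ℝ) ≤ 1 + |s.im| := by simp
  calc ‖f s + g s‖ ≤ C * (1 + |s.im|) ^ A + C' * (1 + |s.im|) ^ A' :=
        (norm_add_le _ _).trans (add_le_add (h s h1 h2) (h' s h1 h2))
    _ ≤ C * (1 + |s.im|) ^ (A + A') + C' * (1 + |s.im|) ^ (A + A') := by
        gcongr <;> first | exact h3 | omega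
    _ = _ := by ring

lemma norm_le_of_strip {s : ℂ} (h1 : 0.1 ≤ s.re) (h2 : s.re ≤ 3.9) : ‖s‖ ≤ 4 * (1 + |s.im|) := by
  have := Complex.norm_le_abs_re_add_abs_im s
  rw [abs_of_nonneg (by linarith : 0 ≤ s.re)] at this
  have := abs_nonneg s.im
  linarith

lemma polyGrowth_id : PolyGrowth fun s => s :=
  ⟨4, 1, by norm_num, fun s h1 h2 => by simpa using norm_le_of_strip h1 h2⟩

lemma polyGrowth_const (c : ℂ) : PolyGrowth fun _ => c :=
  ⟨‖c‖ + 1, 0, by positivity, fun s _ _ => by simp⟩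

lemma polyGrowth_mellinTail {S : ℝ → ℂ} {B : ℝ} (hB : ∀ t, 1 < t → ‖S t‖ ≤ B) :
    PolyGrowth (mellinTail S) := by
  have hB0 : 0 ≤ B := (norm_nonneg _).trans (hB 2 (by norm_num))
  refine ⟨40 * B + 1, 1, by positivity, fun s h1 h2 => ?_⟩
  have hs : 0 < s.re := by linarith
  have h3 : B / s.re ≤ 10 * B := by
    rw [div_le_iff₀ hs]; nlinarith
  calc _ ≤ ‖s‖ * (B / s.re) := norm_mellinTail_le hB hs
    _ ≤ (4 * (1 + |s.im|)) * (10 * B) := by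
        gcongr; exact norm_le_of_strip h1 h2
    _ ≤ _ := by
        rw [pow_one]; nlinarith [abs_nonneg s.im]

lemma PolyGrowth.congr {f g : ℂ → ℂ} (hf : PolyGrowth f) (h : ∀ s : ℂ, 0 < s.re → g s = f s) :
    PolyGrowth g := by
  obtain ⟨C, A, hC, hb⟩ := hf
  exact ⟨C, A, hC, fun s h1 h2 => by rw [h s (by linarith)]; exact hb s h1 h2⟩

/-- Two holomorphic functions on `Re s > 0` which agree for `Re s > 1` are equal. -/
lemma eq_of_eq_of_one_lt_re {f g : ℂ → ℂ} (hf : DifferentiableOn ℂ f {s | 0 < s.re})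
    (hg : DifferentiableOn ℂ g {s | 0 < s.re}) (h : ∀ s : ℂ, 1 < s.re → f s = g s) {s : ℂ}
    (hs : 0 < s.re) : f s = g s := by
  have hf' : AnalyticOnNhd ℂ f {s | 0 < s.re} := hf.analyticOnNhd isOpen_re_pos
  have hg' : AnalyticOnNhd ℂ g {s | 0 < s.re} := hg.analyticOnNhd isOpen_re_pos
  have hev : f =ᶠ[𝓝 (2 : ℂ)] g := by
    have : {s : ℂ | 1 < s.re} ∈ 𝓝 (2 : ℂ) :=
      (isOpen_lt continuous_const Complex.continuous_re).mem_nhds (by simp)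
    filter_upwards [this] with z hz using h z hz
  exact hf'.eqOn_of_preconnected_of_eventuallyEq hg'
    (convex_halfSpace_re_gt 0).isPreconnected (by simp : (2 : ℂ) ∈ {s : ℂ | 0 < s.re}) hev hs

lemma measurable_sum_floor (f : ℕ → ℂ) : Measurable fun t : ℝ => ∑ k ∈ Finset.Icc 1 ⌊t⌋₊, f k :=
  (measurable_from_nat (f := fun n => ∑ k ∈ Finset.Icc 1 n, f k)).comp Nat.measurable_floor

section

variable {q : ℕ} [NeZero q]

lemma norm_sum_range_character_le {χ : DirichletCharacter ℂ q} (hχ : χ ≠ 1) (n : ℕ) :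
    ‖∑ k ∈ Finset.range n, χ (k : ZMod q)‖ ≤ q := by
  have hq : ∑ k ∈ Finset.range q, χ (k : ZMod q) = 0 := by
    rw [← MulChar.sum_eq_zero_of_ne_one hχ]
    refine Finset.sum_bij' (fun k _ => (k : ZMod q)) (fun a _ => a.val) (by simp)
      (fun a _ => by simpa using ZMod.val_lt a) (fun k hk => ?_) (by simp) (by simp)
    exact ZMod.val_cast_of_lt (by simpa using hk)
  have hper : Function.Periodic (fun n : ℕ => ∑ k ∈ Finset.range n, χ (k : ZMod q)) q := by
    intro n
    simp only
    rw [add_comm n q, Finset.sum_range_add, hq, zero_add]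
    simp
  have := hper.map_mod_nat n
  rw [← this]
  refine (norm_sum_le _ _).trans ((Finset.sum_le_card_nsmul _ _ 1 fun k _ =>
    DirichletCharacter.norm_le_one χ _).trans ?_)
  simpa using (Nat.mod_lt n (NeZero.pos q)).le

lemma norm_sum_Icc_character_le {χ : DirichletCharacter ℂ q} (hχ : χ ≠ 1) (n : ℕ) :
    ‖∑ k ∈ Finset.Icc 1 n, χ (k : ZMod q)‖ ≤ q + 1 := by
  have h1 := norm_sum_range_character_le hχ (n + 1)
  have h2 : ∑ k ∈ Finset.range (n + 1), χ (k : ZMod q) =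
      χ ((0 : ℕ) : ZMod q) + ∑ k ∈ Finset.Icc 1 n, χ (k : ZMod q) := by
    rw [Finset.range_eq_Ico, Finset.sum_eq_sum_Ico_succ_bot (by omega)]
    rfl
  have h3 : ∑ k ∈ Finset.Icc 1 n, χ (k : ZMod q) =
      ∑ k ∈ Finset.range (n + 1), χ (k : ZMod q) - χ ((0 : ℕ) : ZMod q) := by rw [h2]; ring
  rw [h3]
  exact (norm_sub_le _ _).trans (add_le_add h1 (DirichletCharacter.norm_le_one χ _))

lemma LFunction_eq_mellinTail {χ : DirichletCharacter ℂ q} (hχ : χ ≠ 1) {s : ℂ} (hs : 0 < s.re) :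
    χ.LFunction s = mellinTail (fun t => ∑ k ∈ Finset.Icc 1 ⌊t⌋₊, χ (k : ZMod q)) s := by
  refine eq_of_eq_of_one_lt_re (DirichletCharacter.differentiable_LFunction hχ).differentiableOn
    (differentiableOn_mellinTail (measurable_sum_floor fun k => χ (k : ZMod q))
      fun t _ => norm_sum_Icc_character_le hχ _) (fun s hs => ?_) hs
  rw [DirichletCharacter.LFunction_eq_LSeries χ hs, mellinTail,
    LSeries_eq_mul_integral (fun n => χ (n : ZMod q)) le_rfl (by linarith)
      (DirichletCharacter.LSeriesSummable_of_one_lt_re χ hs)]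
  refine IsBigO.of_bound (q + 1) (Eventually.of_forall fun n => ?_)
  simpa using norm_sum_Icc_character_le hχ n

lemma polyGrowth_LFunction {χ : DirichletCharacter ℂ q} (hχ : χ ≠ 1) : PolyGrowth χ.LFunction :=
  (polyGrowth_mellinTail fun t _ => norm_sum_Icc_character_le hχ ⌊t⌋₊).congr
    fun _ hs => LFunction_eq_mellinTail hχ hs

end

/-- The entire function `(s - 1) ζ(s)`. -/
noncomputable abbrev zetaEntire : ℂ → ℂ := DirichletCharacter.LFunctionTrivChar₁ 1

lemma zetaEntire_eq {s : ℂ} (hs : s ≠ 1) : zetaEntire s = (s - 1) * riemannZeta s := by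
  simp [zetaEntire, Function.update_of_ne hs, DirichletCharacter.LFunctionTrivChar]

lemma zetaEntire_eq_mellinTail {s : ℂ} (hs : 0 < s.re) :
    zetaEntire s = (s - 1) * mellinTail (fun t => ((⌊t⌋₊ : ℝ) - t : ℝ)) s + s := by
  have hm : Measurable fun t : ℝ => (((⌊t⌋₊ : ℝ) - t : ℝ) : ℂ) := by fun_prop
  have hb : ∀ t : ℝ, 1 < t → ‖(((⌊t⌋₊ : ℝ) - t : ℝ) : ℂ)‖ ≤ 1 := by
    intro t ht
    rw [Complex.norm_real, Real.norm_eq_abs, abs_le]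
    have h1 := Nat.floor_le (by linarith : 0 ≤ t)
    have h2 := Nat.lt_floor_add_one t
    constructor <;> linarith
  refine eq_of_eq_of_one_lt_re
    (DirichletCharacter.differentiable_LFunctionTrivChar₁ 1).differentiableOn
    (((differentiableOn_id.sub_const 1).mul (differentiableOn_mellinTail hm hb)).add
      differentiableOn_id) (fun s hs => ?_) hs
  have hs1 : s - 1 ≠ 0 := by
    intro h
    rw [sub_eq_zero.1 h] at hs
    simp at hs
  have h1 : riemannZeta s = s * ∫ t in Set.Ioi (1 : ℝ), (⌊t⌋₊ : ℂ) * (t : ℂ) ^ (-(s + 1)) := by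
    rw [← LSeries_one_eq_riemannZeta hs, LSeries_eq_mul_integral 1 zero_le_one (by linarith)
      (LSeriesSummable_one_iff.2 hs)]
    · simp
    · refine IsBigO.of_bound 1 (Eventually.of_forall fun n => ?_)
      simp
  have h2 : mellinTail (fun t => (((⌊t⌋₊ : ℝ) - t : ℝ) : ℂ)) s =
      s * (∫ t in Set.Ioi (1 : ℝ), (⌊t⌋₊ : ℂ) * (t : ℂ) ^ (-(s + 1))) -
      s * ∫ t in Set.Ioi (1 : ℝ), (t : ℂ) * (t : ℂ) ^ (-(s + 1)) := by
    rw [mellinTail, ← mul_sub, ← integral_sub]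
    · congr 1
      refine integral_congr_ae (Eventually.of_forall fun t => ?_)
      push_cast
      ring
    · refine integrableOn_mul_cpow (B := 1) (a := 1) (by fun_prop) (fun t ht => ?_) hs
      simpa using Nat.floor_le (by linarith : 0 ≤ t)
    · refine integrableOn_mul_cpow (B := 1) (a := 1) (by fun_prop) (fun t ht => ?_) hs
      simpa using (abs_of_pos (by linarith : 0 < t)).le
  have h3 : ∫ t in Set.Ioi (1 : ℝ), (t : ℂ) * (t : ℂ) ^ (-(s + 1)) = 1 / (s - 1) := by
    have h := integral_Ioi_cpow_of_lt (a := -s) (by simpa using hs) one_pos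
    have h4 : ∫ t in Set.Ioi (1 : ℝ), (t : ℂ) * (t : ℂ) ^ (-(s + 1)) =
        ∫ t in Set.Ioi (1 : ℝ), (t : ℂ) ^ (-s) := by
      refine setIntegral_congr_fun measurableSet_Ioi fun t ht => ?_
      have ht0 : (t : ℂ) ≠ 0 := by
        exact_mod_cast (by linarith [Set.mem_Ioi.1 ht] : (0 : ℝ) < t).ne'
      rw [show -s = 1 + -(s + 1) by ring, Complex.cpow_add _ _ ht0, Complex.cpow_one]
    rw [h4, h, Complex.ofReal_one, Complex.one_cpow,
      show -s + 1 = -(s - 1) by ring, neg_div_neg_eq]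
  change zetaEntire s = (s - 1) * mellinTail (fun t => (((⌊t⌋₊ : ℝ) - t : ℝ) : ℂ)) s + s
  rw [zetaEntire_eq (sub_ne_zero.1 hs1), h2, h3, ← h1]
  field_simp
  ring

lemma polyGrowth_zetaEntire : PolyGrowth zetaEntire := by
  have hb : ∀ t : ℝ, 1 < t → ‖(((⌊t⌋₊ : ℝ) - t : ℝ) : ℂ)‖ ≤ 1 := by
    intro t ht
    rw [Complex.norm_real, Real.norm_eq_abs, abs_le]
    have h1 := Nat.floor_le (by linarith : 0 ≤ t)
    have h2 := Nat.lt_floor_add_one t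
    constructor <;> linarith
  refine ((((polyGrowth_id.add (polyGrowth_const (-1))).mul (polyGrowth_mellinTail hb)).add
    polyGrowth_id).congr fun s hs => ?_)
  rw [zetaEntire_eq_mellinTail hs, sub_eq_add_neg]

/-- The nontrivial real characters mod `q`. -/
noncomputable def quadChars (q : ℕ) [NeZero q] : Finset (DirichletCharacter ℂ q) :=
  Finset.univ.filter fun χ => χ ^ 2 = 1 ∧ χ ≠ 1

lemma mem_quadChars {q : ℕ} [NeZero q] {χ : DirichletCharacter ℂ q} :
    χ ∈ quadChars q ↔ χ ^ 2 = 1 ∧ χ ≠ 1 := by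
  simp [quadChars]

lemma LFun_eq {q : ℕ} [NeZero q] (χ : DirichletCharacter ℂ q) (s : ℂ) :
    LFun q χ s = χ.LFunction s := by
  rw [LFun, dif_pos (NeZero.ne q)]

lemma Zfun_eq_prod {q : ℕ} [NeZero q] : Zfun q = fun s => ∏ χ ∈ quadChars q, χ.LFunction s := by
  funext s
  have : {χ : DirichletCharacter ℂ q | χ ^ 2 = 1 ∧ χ ≠ 1} = ↑(quadChars q) := by
    ext χ; simp [mem_quadChars]
  rw [Zfun, this, finprod_mem_coe_finset]
  exact Finset.prod_congr rfl fun χ _ => LFun_eq χ s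

lemma norm_LSeries_ge {f : ℕ → ℂ} (h1 : f 1 = 1) (hf : ∀ n, ‖f n‖ ≤ 1) {s : ℂ} (hs : s.re = 2) :
    1 / 4 ≤ ‖LSeries f s‖ := by
  have hsum : LSeriesSummable f s :=
    LSeriesSummable_of_bounded_of_one_lt_re (m := 1) (fun n _ => hf n) (by rw [hs]; norm_num)
  have h2 := Summable.sum_add_tsum_nat_add 2 hsum
  simp only [Finset.sum_range_succ, Finset.sum_range_zero, LSeries.term_zero, zero_add,
    LSeries.term_of_ne_zero one_ne_zero, h1, Nat.cast_one, Complex.one_cpow, div_one] at h2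
  have hz := (hasSum_nat_add_iff' 2).2 hasSum_zeta_two
  simp only [Finset.sum_range_succ, Finset.sum_range_zero] at hz
  have htail : ‖∑' n : ℕ, LSeries.term f s (n + 2)‖ ≤ Real.pi ^ 2 / 6 - 1 := by
    refine tsum_of_norm_bounded (by simpa using hz) fun n => ?_
    rw [LSeries.term_of_ne_zero (by omega), norm_div,
      Complex.norm_natCast_cpow_of_pos (by omega), hs]
    have : ((n + 2 : ℕ) : ℝ) ^ (2 : ℝ) = ((n + 2 : ℕ) : ℝ) ^ 2 := Real.rpow_natCast _ 2
    rw [this]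
    have := hf (n + 2)
    push_cast
    rw [inv_eq_one_div]
    gcongr
  have hpi : Real.pi ^ 2 / 6 ≤ 7 / 4 := by nlinarith [Real.pi_lt_d2, Real.pi_pos]
  have h4 : LSeries f s - ∑' n : ℕ, LSeries.term f s (n + 2) = 1 := by
    rw [LSeries, ← h2]; ring
  have h5 := norm_sub_le (LSeries f s) (∑' n : ℕ, LSeries.term f s (n + 2))
  rw [h4, norm_one] at h5
  linarith

lemma norm_LFunction_ge {q : ℕ} [NeZero q] (χ : DirichletCharacter ℂ q) {s : ℂ} (hs : s.re = 2) :
    1 / 4 ≤ ‖χ.LFunction s‖ := by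
  rw [DirichletCharacter.LFunction_eq_LSeries χ (by rw [hs]; norm_num)]
  exact norm_LSeries_ge (by simp) (fun n => DirichletCharacter.norm_le_one χ _) hs

lemma re_eq_half_of_LFunction_eq_zero (hGRH : GRH) {q : ℕ} [NeZero q] {χ : DirichletCharacter ℂ q}
    (hχ : χ ≠ 1) {s : ℂ} (hs : 0 < s.re) (h0 : χ.LFunction s = 0) : s.re = 1 / 2 := by
  have hs1 : s.re < 1 := by
    by_contra! h
    exact DirichletCharacter.LFunction_ne_zero_of_one_le_re χ (Or.inl hχ) h h0
  have : NeZero χ.conductor := ⟨χ.conductor_ne_zero⟩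
  have hne : s ≠ 1 := by rintro rfl; simp at hs1
  rw [← χ.changeLevel_primitiveCharacter,
    DirichletCharacter.LFunction_changeLevel χ.conductor_dvd_level _ (Or.inr hne)] at h0
  rcases mul_eq_zero.1 h0 with h | h
  · refine hGRH χ.conductor χ.primitiveCharacter (NeZero.ne _) χ.primitiveCharacter_isPrimitive s hs
      hs1 ?_
    rw [LFun_eq, h]
  · obtain ⟨p, hp, hp0⟩ := Finset.prod_eq_zero_iff.1 h
    have hpp := Nat.prime_of_mem_primeFactors hp
    have h1 : ‖χ.primitiveCharacter (p : ZMod χ.conductor) * (p : ℂ) ^ (-s)‖ < 1 := by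
      rw [norm_mul, Complex.norm_natCast_cpow_of_pos hpp.pos]
      calc _ ≤ 1 * (p : ℝ) ^ (-s).re := by
            gcongr; exact DirichletCharacter.norm_le_one _ _
        _ < 1 := by
            rw [one_mul]
            exact Real.rpow_lt_one_of_one_lt_of_neg (by exact_mod_cast hpp.one_lt) (by simpa using hs)
    rw [← sub_eq_zero.1 hp0, norm_one] at h1
    exact absurd h1 (lt_irrefl _)

lemma isRiemannType_Zfun (hGRH : GRH) (q : ℕ) [NeZero q] : IsRiemannType (Zfun q) where
  diff := by
    rw [Zfun_eq_prod]
    exact DifferentiableOn.fun_finsetProd fun χ hχ =>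
      (DirichletCharacter.differentiable_LFunction (mem_quadChars.1 hχ).2).differentiableOn
  growth := by
    rw [Zfun_eq_prod]
    exact PolyGrowth.prod _ fun χ hχ => polyGrowth_LFunction (mem_quadChars.1 hχ).2
  lower := by
    refine ⟨(1 / 4) ^ (quadChars q).card, by positivity, fun t => ?_⟩
    rw [Zfun_eq_prod, norm_prod, ← Finset.prod_const]
    exact Finset.prod_le_prod (fun _ _ => by norm_num) fun χ _ => norm_LFunction_ge χ (by simp)
  zeros s hs h := by
    rw [Zfun_eq_prod] at h
    obtain ⟨χ, hχ, h0⟩ := Finset.prod_eq_zero_iff.1 h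
    exact re_eq_half_of_LFunction_eq_zero hGRH (mem_quadChars.1 hχ).2 hs h0

lemma isRiemannType_zetaEntire (hGRH : GRH) : IsRiemannType zetaEntire where
  diff := (DirichletCharacter.differentiable_LFunctionTrivChar₁ 1).differentiableOn
  growth := polyGrowth_zetaEntire
  lower := by
    refine ⟨1 / 4, by norm_num, fun t => ?_⟩
    have hs : (2 + t * Complex.I : ℂ).re = 2 := by simp
    have hne : (2 + t * Complex.I : ℂ) ≠ 1 := by
      intro h; rw [h] at hs; norm_num at hs
    have h1 : 1 ≤ ‖(2 + t * Complex.I : ℂ) - 1‖ := by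
      refine le_trans ?_ (Complex.re_le_norm _)
      simp; norm_num
    have h2 := norm_LFunction_ge (1 : DirichletCharacter ℂ 1) hs
    rw [DirichletCharacter.LFunction_modOne_eq] at h2
    rw [zetaEntire_eq hne, norm_mul]
    nlinarith [norm_nonneg (riemannZeta (2 + t * Complex.I))]
  zeros s hs h := by
    rcases eq_or_ne s 1 with rfl | hne
    · exact absurd h (DirichletCharacter.LFunctionTrivChar₁_apply_one_ne_zero 1)
    · rw [zetaEntire_eq hne] at h
      have h0 := (mul_eq_zero.1 h).resolve_left (sub_ne_zero.2 hne)
      have hs1 : s.re < 1 := by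
        by_contra! h
        exact riemannZeta_ne_zero_of_one_le_re h h0
      refine hGRH 1 1 one_ne_zero DirichletCharacter.isPrimitive_one_level_one s hs hs1 ?_
      rw [LFun_eq, DirichletCharacter.LFunction_modOne_eq, h0]

/-- The summatory function of `f` in the variable `y = log x`. -/
noncomputable def expSum (f : ℕ → ℂ) (y : ℝ) : ℂ := ∑ n ∈ Finset.Icc 1 ⌊Real.exp y⌋₊, f n

lemma measurable_expSum (f : ℕ → ℂ) : Measurable (expSum f) :=
  (measurable_sum_floor f).comp Real.measurable_exp

lemma expSum_of_neg (f : ℕ → ℂ) {y : ℝ} (hy : y < 0) : expSum f y = 0 := by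
  have : ⌊Real.exp y⌋₊ = 0 := Nat.floor_eq_zero.2 (Real.exp_lt_one_iff.2 hy)
  simp [expSum, this]

lemma continuousWithinAt_expSum (f : ℕ → ℂ) (y : ℝ) : ContinuousWithinAt (expSum f) (Set.Ici y) y := by
  have h : ∀ᶠ u in 𝓝[≥] y, expSum f u = expSum f y := by
    have h1 : ∀ᶠ u in 𝓝 y, Real.exp u < ⌊Real.exp y⌋₊ + 1 :=
      Real.continuous_exp.continuousAt.eventually_lt_const (Nat.lt_floor_add_one _)
    filter_upwards [nhdsWithin_le_nhds h1, self_mem_nhdsWithin] with u hu hyu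
    have : ⌊Real.exp u⌋₊ = ⌊Real.exp y⌋₊ := by
      refine (Nat.floor_eq_iff (Real.exp_pos u).le).2 ⟨?_, hu⟩
      exact (Nat.floor_le (Real.exp_pos y).le).trans (Real.exp_le_exp.2 hyu)
    simp [expSum, this]
  exact (continuousWithinAt_const (b := expSum f y)).congr_of_eventuallyEq h rfl

lemma sum_vonMangoldt_le (n : ℕ) :
    ∑ k ∈ Finset.Icc 1 n, ArithmeticFunction.vonMangoldt k ≤ (Real.log 4 + 4) * n := by
  have h := Chebyshev.psi_le_const_mul_self (Nat.cast_nonneg (α := ℝ) n)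
  rw [Chebyshev.psi, Nat.floor_natCast] at h
  exact h

section
variable {f : ℕ → ℂ} {K : ℝ} (hK : 0 ≤ K) (hf : ∀ n, ‖f n‖ ≤ K * ArithmeticFunction.vonMangoldt n)
include hK hf

lemma norm_sum_Icc_le_of_vonMangoldt (n : ℕ) :
    ‖∑ k ∈ Finset.Icc 1 n, f k‖ ≤ K * (Real.log 4 + 4) * n := by
  refine (norm_sum_le _ _).trans ((Finset.sum_le_sum fun k _ => hf k).trans ?_)
  rw [← Finset.mul_sum, mul_assoc]
  exact mul_le_mul_of_nonneg_left (sum_vonMangoldt_le n) hK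

lemma norm_expSum_le (y : ℝ) : ‖expSum f y‖ ≤ K * (Real.log 4 + 4) * Real.exp y := by
  refine (norm_sum_Icc_le_of_vonMangoldt hK hf _).trans ?_
  have := Real.log_nonneg (x := 4) (by norm_num)
  exact mul_le_mul_of_nonneg_left (Nat.floor_le (Real.exp_pos y).le) (by positivity)

lemma integral_expSum {s : ℂ} (hs : 1 < s.re) :
    ∫ y : ℝ, expSum f y * Complex.exp (-s * y) = LSeries f s / s := by
  have hs0 : s ≠ 0 := by intro h; simp [h] at hs; linarith
  have hO : (fun n ↦ ∑ k ∈ Finset.Icc 1 n, ‖f k‖) =O[atTop] fun n ↦ (n : ℝ) ^ (1 : ℝ) := by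
    refine IsBigO.of_bound (K * (Real.log 4 + 4)) (Eventually.of_forall fun n => ?_)
    rw [Real.norm_of_nonneg (Finset.sum_nonneg fun _ _ => norm_nonneg _)]
    refine (Finset.sum_le_sum fun k _ => hf k).trans ?_
    rw [← Finset.mul_sum, mul_assoc, Real.rpow_one, Real.norm_natCast]
    exact mul_le_mul_of_nonneg_left (sum_vonMangoldt_le n) hK
  rw [LSeries_eq_mul_integral' f zero_le_one hs hO, mul_div_cancel_left₀ _ hs0, ← Real.exp_zero,
    ← integral_comp_exp_Ioi, ← integral_Ici_eq_integral_Ioi]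
  have hsupp : (fun y : ℝ => expSum f y * Complex.exp (-s * y)) =
      (Set.Ici 0).indicator fun y : ℝ => expSum f y * Complex.exp (-s * y) := by
    funext y
    by_cases hy : y ∈ Set.Ici (0 : ℝ)
    · rw [Set.indicator_of_mem hy]
    · rw [Set.indicator_of_notMem hy, expSum_of_neg f (by simpa using hy), zero_mul]
  rw [hsupp, integral_indicator measurableSet_Ici]
  refine setIntegral_congr_fun measurableSet_Ici fun y _ => ?_
  have : Complex.exp (-s * y) = (Real.exp y : ℂ) * ((Real.exp y : ℝ) : ℂ) ^ (-(s + 1)) := by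
    rw [Complex.ofReal_exp, Complex.cpow_def_of_ne_zero (Complex.exp_ne_zero _),
      ← Complex.ofReal_exp, ← Complex.ofReal_log (Real.exp_pos y).le, Real.log_exp,
      Complex.ofReal_exp, ← Complex.exp_add]
    congr 1; ring
  rw [this, Complex.real_smul, expSum]
  ring

end

/-- The sum of the values at `n` of the nontrivial real characters mod `q`. -/
noncomputable def quadCharSum (q : ℕ) [NeZero q] (n : ℕ) : ℂ := ∑ χ ∈ quadChars q, χ n

lemma norm_quadCharSum_le (q : ℕ) [NeZero q] (n : ℕ) : ‖quadCharSum q n‖ ≤ (quadChars q).card := by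
  refine (norm_sum_le _ _).trans ?_
  simpa using Finset.sum_le_card_nsmul (quadChars q) (fun χ => ‖χ n‖) 1
    fun χ _ => DirichletCharacter.norm_le_one χ _

/-- The weights `a(n) Λ(n)`, where `a(n)` is the sum of the nontrivial real characters at `n`. -/
noncomputable def quadLambda (q : ℕ) [NeZero q] (n : ℕ) : ℂ :=
  quadCharSum q n * (ArithmeticFunction.vonMangoldt n : ℝ)

lemma norm_quadLambda_le (q : ℕ) [NeZero q] (n : ℕ) :
    ‖quadLambda q n‖ ≤ (quadChars q).card * ArithmeticFunction.vonMangoldt n := by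
  rw [quadLambda, norm_mul, Complex.norm_real,
    Real.norm_of_nonneg ArithmeticFunction.vonMangoldt_nonneg]
  exact mul_le_mul_of_nonneg_right (norm_quadCharSum_le q n) ArithmeticFunction.vonMangoldt_nonneg

lemma LSeries_quadLambda (q : ℕ) [NeZero q] {s : ℂ} (hs : 1 < s.re) :
    LSeries (quadLambda q) s = -logDeriv (Zfun q) s := by
  have h1 : quadLambda q = ∑ χ ∈ quadChars q, (fun n : ℕ => χ n * (ArithmeticFunction.vonMangoldt n : ℂ)) := by
    funext n
    simp [quadLambda, quadCharSum, Finset.sum_mul]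
  rw [h1, LSeries_sum, Zfun_eq_prod, logDeriv_prod, ← Finset.sum_neg_distrib]
  · refine Finset.sum_congr rfl fun χ _ => ?_
    rw [logDeriv_apply, DirichletCharacter.deriv_LFunction_eq_deriv_LSeries χ hs,
      DirichletCharacter.LFunction_eq_LSeries χ hs, ← neg_div]
    exact DirichletCharacter.LSeries_twist_vonMangoldt_eq χ hs
  · intro χ hχ
    exact DirichletCharacter.LFunction_ne_zero_of_one_le_re χ (Or.inl (mem_quadChars.1 hχ).2) hs.le
  · exact fun χ hχ => (DirichletCharacter.differentiable_LFunction (mem_quadChars.1 hχ).2).differentiableAt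
  · exact fun χ _ => DirichletCharacter.LSeriesSummable_twist_vonMangoldt χ hs

lemma one_lt_re_three (t : ℝ) : 1 < (3 + t * Complex.I : ℂ).re := by simp

lemma isPrimeSum_quad (q : ℕ) [NeZero q] : IsPrimeSum (Zfun q) (expSum (quadLambda q)) where
  meas := measurable_expSum _
  zero _ hy := expSum_of_neg _ hy
  right := continuousWithinAt_expSum _
  bound := ⟨_, norm_expSum_le (Nat.cast_nonneg _) (norm_quadLambda_le q)⟩
  laplace t := by
    rw [integral_expSum (Nat.cast_nonneg _) (norm_quadLambda_le q) (one_lt_re_three t),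
      LSeries_quadLambda q (one_lt_re_three t), neg_div]

/-- `ψ(e^y) - e^y + 1` for `y ≥ 0`, extended by zero. -/
noncomputable def psiError (y : ℝ) : ℂ :=
  expSum (fun n => (ArithmeticFunction.vonMangoldt n : ℝ)) y +
    (Set.Ici (0 : ℝ)).indicator (fun y => 1 - (Real.exp y : ℂ)) y

lemma norm_vonMangoldt_le (n : ℕ) : ‖((ArithmeticFunction.vonMangoldt n : ℝ) : ℂ)‖ ≤
    1 * ArithmeticFunction.vonMangoldt n := by
  rw [Complex.norm_real, Real.norm_of_nonneg ArithmeticFunction.vonMangoldt_nonneg, one_mul]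

lemma isPrimeSum_psiError : IsPrimeSum zetaEntire psiError where
  meas := (measurable_expSum _).add ((by fun_prop : Measurable _).indicator measurableSet_Ici)
  zero y hy := by
    rw [psiError, expSum_of_neg _ hy, Set.indicator_of_notMem (by simpa using hy), add_zero]
  right y := by
    refine (continuousWithinAt_expSum _ y).add ?_
    rcases lt_or_ge y 0 with hy | hy
    · have : ∀ᶠ u in 𝓝 y, (Set.Ici (0 : ℝ)).indicator (fun y => 1 - (Real.exp y : ℂ)) u = 0 := by
        filter_upwards [Iio_mem_nhds hy] with u hu
        exact Set.indicator_of_notMem (by simpa using hu) _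
      exact ((continuousAt_const (y := (0 : ℂ))).congr (this.mono fun _ h => h.symm)).continuousWithinAt
    · have hc : ContinuousWithinAt (fun y => 1 - (Real.exp y : ℂ)) (Set.Ici y) y :=
        (by fun_prop : Continuous fun y => 1 - (Real.exp y : ℂ)).continuousWithinAt
      refine hc.congr (fun u hu => ?_) ?_
      · exact Set.indicator_of_mem (hy.trans hu) _
      · exact Set.indicator_of_mem hy _
  bound := by
    refine ⟨1 * (Real.log 4 + 4) + 1, fun y => ?_⟩
    rw [add_mul]
    refine (norm_add_le _ _).trans (add_le_add (norm_expSum_le zero_le_one norm_vonMangoldt_le y) ?_)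
    by_cases hy : y ∈ Set.Ici (0 : ℝ)
    · rw [Set.indicator_of_mem hy, ← Complex.ofReal_one, ← Complex.ofReal_sub, Complex.norm_real,
        Real.norm_eq_abs, abs_le]
      have := Real.one_le_exp hy
      constructor <;> linarith
    · rw [Set.indicator_of_notMem hy]
      simpa using (Real.exp_pos y).le
  laplace t := by
    set s : ℂ := 3 + t * Complex.I with hs
    have hs1 : 1 < s.re := one_lt_re_three t
    have hne : s ≠ 1 := by intro h; rw [h] at hs1; simp at hs1
    have hne0 : s ≠ 0 := by intro h; rw [h] at hs1; simp at hs1; linarith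
    have hL : LSeries (fun n => ((ArithmeticFunction.vonMangoldt n : ℝ) : ℂ)) s =
        -logDeriv riemannZeta s := by
      rw [logDeriv_apply, ← neg_div]
      exact ArithmeticFunction.LSeries_vonMangoldt_eq_deriv_riemannZeta_div hs1
    have hlog : logDeriv zetaEntire s = 1 / (s - 1) + logDeriv riemannZeta s := by
      have he : zetaEntire =ᶠ[𝓝 s] fun z => (z - 1) * riemannZeta z := by
        filter_upwards [isOpen_ne.mem_nhds hne] with z hz using zetaEntire_eq hz
      have h1 : logDeriv zetaEntire s = logDeriv (fun z => (z - 1) * riemannZeta z) s := by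
        rw [logDeriv_apply, logDeriv_apply, Filter.EventuallyEq.deriv_eq he, he.eq_of_nhds]
      rw [h1, logDeriv_mul (f := fun z => z - 1) s (sub_ne_zero.2 hne)
        (riemannZeta_ne_zero_of_one_le_re hs1.le) (by fun_prop) (differentiableAt_riemannZeta hne)]
      simp [logDeriv_apply]
    have i0 := integral_expSum zero_le_one norm_vonMangoldt_le hs1
    have e1 := integral_exp_Ici (w := 0) (s := s) (by simp; linarith)
    have e2 := integral_exp_Ici (w := 1) (s := s) (by simpa using hs1)
    have j1 := integrable_exp_Ici (w := 0) (s := s) (by simp; linarith)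
    have j2 := integrable_exp_Ici (w := 1) (s := s) (by simpa using hs1)
    have j0 : Integrable fun y : ℝ => expSum (fun n => ((ArithmeticFunction.vonMangoldt n : ℝ) : ℂ)) y *
        Complex.exp (-s * y) := by
      refine ((integrable_indicator_exp (c := 2) (b := 0) two_pos).const_mul
        (1 * (Real.log 4 + 4))).mono' ((measurable_expSum _).mul (by fun_prop)).aestronglyMeasurable
        (Eventually.of_forall fun y => ?_)
      by_cases hy : y ∈ Set.Ici (0 : ℝ)
      · rw [Set.indicator_of_mem hy, norm_mul, Complex.norm_exp]
        refine (mul_le_mul_of_nonneg_right (norm_expSum_le zero_le_one norm_vonMangoldt_le y)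
          (Real.exp_pos _).le).trans (le_of_eq ?_)
        rw [mul_assoc, ← Real.exp_add]
        congr 2
        simp [hs]; ring
      · rw [expSum_of_neg _ (by simpa using hy), zero_mul, norm_zero,
          Set.indicator_of_notMem hy, mul_zero]
    have hsplit : ∀ y : ℝ, psiError y * Complex.exp (-s * y) =
        expSum (fun n => ((ArithmeticFunction.vonMangoldt n : ℝ) : ℂ)) y * Complex.exp (-s * y) +
        ((Set.Ici (0 : ℝ)).indicator (fun y : ℝ => Complex.exp (0 * y) * Complex.exp (-s * y)) y -
        (Set.Ici (0 : ℝ)).indicator (fun y : ℝ => Complex.exp (1 * y) * Complex.exp (-s * y)) y) := by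
      intro y
      rw [psiError, add_mul]
      congr 1
      by_cases hy : y ∈ Set.Ici (0 : ℝ)
      · simp only [Set.indicator_of_mem hy, zero_mul, Complex.exp_zero, one_mul, Complex.ofReal_exp]
        ring
      · simp [Set.indicator_of_notMem hy]
    have j3 : Integrable fun y : ℝ =>
        (Set.Ici (0 : ℝ)).indicator (fun y : ℝ => Complex.exp (0 * y) * Complex.exp (-s * y)) y -
        (Set.Ici (0 : ℝ)).indicator (fun y : ℝ => Complex.exp (1 * y) * Complex.exp (-s * y)) y :=
      j1.sub j2
    rw [integral_congr_ae (Eventually.of_forall hsplit), integral_add j0 j3,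
      integral_sub j1 j2, i0, e1, e2, hL, hlog]
    have := sub_ne_zero.2 hne
    field_simp
    ring

lemma mem_range_pow_two_iff {q : ℕ} {u : (ZMod q)ˣ} {n : ℕ} (hu : (u : ZMod q) = n) :
    u ∈ (powMonoidHom 2 : (ZMod q)ˣ →* (ZMod q)ˣ).range ↔
      ∃ v : (ZMod q)ˣ, (v : ZMod q) ^ 2 = (n : ZMod q) := by
  rw [← hu]
  constructor
  · rintro ⟨v, rfl⟩
    exact ⟨v, by simp⟩
  · rintro ⟨v, hv⟩
    exact ⟨v, Units.ext (by simpa using hv)⟩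

section
variable {q : ℕ} [NeZero q]

lemma sum_real_characters_apply (u : (ZMod q)ˣ) :
    ∑ χ : DirichletCharacter ℂ q with χ ^ 2 = 1, χ u =
      if u ∈ (powMonoidHom 2 : (ZMod q)ˣ →* (ZMod q)ˣ).range then (rho q : ℂ) else 0 := by
  set H := (powMonoidHom 2 : (ZMod q)ˣ →* (ZMod q)ˣ).range with hH
  set X := (MulChar.subgroupOrderIsoSubgroupMulChar (ZMod q) ℂ H).ofDual with hX
  have hmem : ∀ χ : DirichletCharacter ℂ q, χ ^ 2 = 1 ↔ χ ∈ X := by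
    intro χ
    rw [hX, MulChar.mem_subgroupOrderIsoSubgroupMulChar_iff]
    constructor
    · rintro h _ ⟨v, rfl⟩
      rw [powMonoidHom_apply, Units.val_pow_eq_pow_val, map_pow, ← MulChar.pow_apply_coe, h,
        MulChar.one_apply_coe]
    · intro h
      ext v
      rw [MulChar.pow_apply_coe, MulChar.one_apply_coe, ← map_pow, ← Units.val_pow_eq_pow_val]
      exact h _ ⟨v, rfl⟩
  split_ifs with hu
  · have h1 : ∀ χ ∈ Finset.univ.filter fun χ : DirichletCharacter ℂ q => χ ^ 2 = 1, χ u = 1 := by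
      intro χ hχ
      have := (hmem χ).1 (Finset.mem_filter.1 hχ).2
      exact MulChar.mem_subgroupOrderIsoSubgroupMulChar_iff.1 this u hu
    have hcard : (Finset.univ.filter fun χ : DirichletCharacter ℂ q => χ ^ 2 = 1).card = rho q := by
      rw [rho, Subgroup.index_eq_card, ← MulChar.card_subgroupOrderIsoSubgroupMulChar (R := ℂ),
        Nat.card_eq_fintype_card, Fintype.card_subtype]
      congr 1
      ext χ
      simp [hmem, hX, hH]
    rw [Finset.sum_congr rfl h1, Finset.sum_const, hcard, nsmul_eq_mul, mul_one]
  · have hex : ∃ χ ∈ X, χ u ≠ 1 := by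
      by_contra! hall
      apply hu
      have := MulChar.mem_subgroupOrderIsoSubgroupMulChar_symm_iff.2 hall
      rwa [hX, OrderDual.toDual_ofDual, OrderIso.symm_apply_apply] at this
    obtain ⟨χ, hχ, hne⟩ := hex
    refine eq_zero_of_mul_eq_self_left hne ?_
    rw [Finset.mul_sum]
    refine Finset.sum_bijective (fun χ' => χ * χ') (Group.mulLeft_bijective χ) (fun χ' => ?_)
      fun χ' _ => (MulChar.mul_apply ..).symm
    simp only [Finset.mem_filter, Finset.mem_univ, true_and, hmem]
    exact (X.mul_mem_cancel_left hχ).symm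

lemma quadCharSum_of_isUnit {n : ℕ} (u : (ZMod q)ˣ) (hu : (u : ZMod q) = n) :
    quadCharSum q n =
      (if u ∈ (powMonoidHom 2 : (ZMod q)ˣ →* (ZMod q)ˣ).range then (rho q : ℂ) else 0) - 1 := by
  rw [← sum_real_characters_apply, quadCharSum, ← hu, quadChars, Finset.filter_and,
    Finset.filter_ne', Finset.inter_erase, Finset.inter_univ, eq_sub_iff_add_eq]
  have h1 : (1 : DirichletCharacter ℂ q) u = 1 := MulChar.one_apply_coe u
  rw [← h1]
  exact Finset.sum_erase_add _ _ (by simp)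

lemma card_quadChars : (((quadChars q).card : ℝ)) = rho q - 1 := by
  have h := quadCharSum_of_isUnit (q := q) (n := 1) 1 (by simp)
  rw [if_pos (one_mem _), quadCharSum] at h
  simp at h
  exact_mod_cast congrArg Complex.re h

lemma quadCharSum_of_square {n : ℕ} (h : ∃ v : (ZMod q)ˣ, (v : ZMod q) ^ 2 = (n : ZMod q)) :
    quadCharSum q n = rho q - 1 := by
  obtain ⟨v, hv⟩ := h
  have hu : ((v ^ 2 : (ZMod q)ˣ) : ZMod q) = n := by simpa using hv
  rw [quadCharSum_of_isUnit _ hu, if_pos ((mem_range_pow_two_iff hu).2 ⟨v, hv⟩)]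

lemma quadCharSum_of_not_square {n : ℕ} (hn : IsUnit (n : ZMod q))
    (h : ¬ ∃ v : (ZMod q)ˣ, (v : ZMod q) ^ 2 = (n : ZMod q)) : quadCharSum q n = -1 := by
  obtain ⟨u, hu⟩ := hn
  rw [quadCharSum_of_isUnit u hu, if_neg fun hm => h ((mem_range_pow_two_iff hu).1 hm), zero_sub]

lemma quadCharSum_of_not_isUnit {n : ℕ} (hn : ¬ IsUnit (n : ZMod q)) : quadCharSum q n = 0 :=
  Finset.sum_eq_zero fun χ _ => χ.map_nonunit hn

lemma quadCharSum_sq {p : ℕ} (hp : IsUnit (p : ZMod q)) : quadCharSum q (p ^ 2) = rho q - 1 := by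
  obtain ⟨u, hu⟩ := hp
  exact quadCharSum_of_square ⟨u, by rw [hu]; push_cast; rfl⟩

/-- The primes in the race, counted with signs. -/
lemma race_eq_neg_sum (y : ℝ) :
    (((primePiNR q (Real.exp y) : ℝ) - ((rho q : ℝ) - 1) * primePiR q (Real.exp y) : ℝ) : ℂ) =
      -expSum (fun n => if n.Prime then quadCharSum q n else 0) y := by
  set N := ⌊Real.exp y⌋₊ with hN
  have hcard : ∀ P : ℕ → Prop, Nat.card {p : ℕ | p.Prime ∧ (p : ℝ) ≤ Real.exp y ∧ P p} =
      ((Finset.Icc 1 N).filter fun p => p.Prime ∧ P p).card := by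
    intro P
    refine Nat.subtype_card _ fun p => ?_
    simp only [Finset.mem_filter, Finset.mem_Icc, Set.mem_ofPred_eq, hN,
      Nat.le_floor_iff (Real.exp_pos y).le]
    constructor
    · exact fun h => ⟨h.2.1, h.1.2, h.2.2⟩
    · exact fun h => ⟨⟨h.1.one_le, h.2.1⟩, h.1, h.2.2⟩
  have hval : ∀ n : ℕ, (if n.Prime then quadCharSum q n else 0) =
      ((rho q : ℂ) - 1) * (if n.Prime ∧ ∃ u : (ZMod q)ˣ, (u : ZMod q) ^ 2 = (n : ZMod q) then 1 else 0) -
      if n.Prime ∧ IsUnit (n : ZMod q) ∧ ¬ ∃ u : (ZMod q)ˣ, (u : ZMod q) ^ 2 = (n : ZMod q) then 1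
      else 0 := by
    intro n
    by_cases hn : n.Prime
    · by_cases hs : ∃ u : (ZMod q)ˣ, (u : ZMod q) ^ 2 = (n : ZMod q)
      · simp [hn, hs, quadCharSum_of_square hs]
      · by_cases hu : IsUnit (n : ZMod q)
        · simp [hn, hs, hu, quadCharSum_of_not_square hu hs]
        · simp [hn, hs, hu, quadCharSum_of_not_isUnit hu]
    · simp [hn]
  rw [expSum, ← hN, Finset.sum_congr rfl fun n _ => hval n, Finset.sum_sub_distrib, ← Finset.mul_sum,
    Finset.sum_boole, Finset.sum_boole, primePiNR, primePiR, hcard, hcard]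
  push_cast
  ring_nf

end

lemma psi_sub_theta_sub_psi_bounds : ∃ C, 0 ≤ C ∧ ∀ y : ℝ, 0 ≤ y →
    0 ≤ Chebyshev.psi (Real.exp y) - Chebyshev.theta (Real.exp y) - Chebyshev.psi (Real.exp (y / 2)) ∧
    Chebyshev.psi (Real.exp y) - Chebyshev.theta (Real.exp y) - Chebyshev.psi (Real.exp (y / 2)) ≤
      C * Real.exp (y / 3) ∧
    Chebyshev.psi (Real.exp y) - Chebyshev.theta (Real.exp y) - Chebyshev.theta (Real.exp (y / 2)) ≤
      C * Real.exp (y / 3) := by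
  obtain ⟨C₀, hC₀⟩ := Chebyshev.psi_sub_theta_le_mul_sqrt
  set L := Real.log 4 + 4
  have hL : 0 ≤ L := by have := Real.log_nonneg (x := 4) (by norm_num); positivity
  refine ⟨2 * L + |C₀|, by positivity, fun y hy => ?_⟩
  have hpow : ∀ a : ℝ, Real.exp y ^ (a⁻¹) = Real.exp (y / a) := fun a => by
    rw [← Real.exp_mul, div_eq_mul_inv]
  have hle : ∀ a : ℝ, 3 ≤ a → Chebyshev.psi (Real.exp (y / a)) ≤ L * Real.exp (y / 3) := fun a ha => by
    refine (Chebyshev.psi_le_const_mul_self (Real.exp_pos _).le).trans ?_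
    refine mul_le_mul_of_nonneg_left (Real.exp_le_exp.2 ?_) hL
    exact div_le_div_of_nonneg_left hy (by norm_num) ha
  have hu := Chebyshev.psi_sub_theta_le_psi_add_psi_add_psi (Real.exp y)
  have hl := Chebyshev.psi_sub_theta_ge_psi_add_psi_add_psi (Real.exp_pos y).le
  rw [hpow, hpow, hpow] at hu hl
  have h3 := hle 3 le_rfl
  have h5 := hle 5 (by norm_num)
  have h4 : Chebyshev.psi (Real.exp (y / 2)) - Chebyshev.theta (Real.exp (y / 2)) ≤
      |C₀| * Real.exp (y / 3) := by
    refine (hC₀ _).trans ((mul_le_mul_of_nonneg_right (le_abs_self C₀) (Real.sqrt_nonneg _)).trans ?_)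
    refine mul_le_mul_of_nonneg_left ?_ (abs_nonneg _)
    rw [← Real.exp_half]
    exact Real.exp_le_exp.2 (by linarith)
  have p3 := Chebyshev.psi_nonneg (Real.exp (y / 3))
  have p7 := Chebyshev.psi_nonneg (Real.exp (y / 7))
  have hA : 0 ≤ |C₀| * Real.exp (y / 3) := by positivity
  refine ⟨by linarith, ?_, ?_⟩ <;> rw [add_mul, mul_assoc] <;> linarith

section
variable (q : ℕ) [NeZero q]

/-- The weights `a(p) log p` supported on primes. -/
noncomputable def quadTheta (n : ℕ) : ℂ :=
  if n.Prime then quadCharSum q n * (Real.log n : ℝ) else 0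

lemma norm_quadCharSum_sub_le (n : ℕ) : ‖quadCharSum q n - (rho q - 1)‖ ≤ 2 * (rho q - 1 : ℝ) := by
  have h1 := norm_quadCharSum_le q n
  rw [card_quadChars] at h1
  have h2 : ‖(rho q - 1 : ℂ)‖ = (rho q - 1 : ℝ) := by
    rw [← Complex.ofReal_natCast, ← Complex.ofReal_one, ← Complex.ofReal_sub, Complex.norm_real,
      Real.norm_of_nonneg (by rw [← card_quadChars]; positivity)]
  have := norm_sub_le (quadCharSum q n) (rho q - 1 : ℂ)
  linarith

lemma exists_norm_quad_sub_le : ∃ C, ∀ y : ℝ, 0 ≤ y →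
    ‖expSum (quadLambda q) y - expSum (quadTheta q) y -
      ((rho q - 1) * Chebyshev.psi (Real.exp (y / 2)) : ℝ)‖ ≤ C * Real.exp (y / 3) := by
  obtain ⟨C, hC0, hC⟩ := psi_sub_theta_sub_psi_bounds
  set r : ℝ := rho q - 1 with hr
  have hr0 : 0 ≤ r := by rw [hr, ← card_quadChars]; positivity
  set K : ℝ := ∑ p ∈ q.divisors, Real.log p with hK
  have hK0 : 0 ≤ K := Finset.sum_nonneg fun p _ => Real.log_natCast_nonneg p
  refine ⟨r * C + 2 * r * (C + K), fun y hy => ?_⟩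
  obtain ⟨c1, c2, c3⟩ := hC y hy
  set N := ⌊Real.exp y⌋₊ with hN
  set S := (Finset.Ioc 0 N).filter fun n => ¬ n.Prime with hS
  set P := (Finset.Ioc 0 ⌊Real.exp (y / 2)⌋₊).filter fun p => p.Prime with hP
  have hdiff : expSum (quadLambda q) y - expSum (quadTheta q) y =
      ∑ n ∈ S, quadCharSum q n * (ArithmeticFunction.vonMangoldt n : ℝ) := by
    rw [hS, Finset.sum_filter, expSum, expSum, ← Finset.sum_sub_distrib]
    refine Finset.sum_congr rfl fun n _ => ?_
    by_cases hn : n.Prime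
    · simp [quadLambda, quadTheta, hn, ArithmeticFunction.vonMangoldt_apply_prime hn]
    · simp [quadLambda, quadTheta, hn]
  have hψθ := Chebyshev.psi_sub_theta_eq_sum_not_prime (Real.exp y)
  have hinj : Set.InjOn (fun p : ℕ => p ^ 2) P := fun a _ b _ h => Nat.pow_left_injective two_ne_zero h
  have hsub : P.image (fun p => p ^ 2) ⊆ S := by
    intro n hn
    obtain ⟨p, hp, rfl⟩ := Finset.mem_image.1 hn
    obtain ⟨hp1, hp2⟩ := Finset.mem_filter.1 hp
    have hp3 := (Nat.le_floor_iff (Real.exp_pos _).le).1 (Finset.mem_Ioc.1 hp1).2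
    refine Finset.mem_filter.2 ⟨Finset.mem_Ioc.2 ⟨by have := hp2.pos; positivity, ?_⟩, ?_⟩
    · refine Nat.le_floor ?_
      push_cast
      calc (p : ℝ) ^ 2 ≤ Real.exp (y / 2) ^ 2 := by gcongr
        _ = Real.exp y := by rw [← Real.exp_nat_mul]; congr 1; push_cast; ring
    · exact Nat.Prime.not_prime_pow le_rfl
  have hΛ : ∀ p ∈ P, ArithmeticFunction.vonMangoldt (p ^ 2) = Real.log p := fun p hp => by
    rw [ArithmeticFunction.vonMangoldt_apply_pow two_ne_zero,
      ArithmeticFunction.vonMangoldt_apply_prime (Finset.mem_filter.1 hp).2]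
  have hθ : ∑ n ∈ P.image (fun p => p ^ 2), ArithmeticFunction.vonMangoldt n =
      Chebyshev.theta (Real.exp (y / 2)) := by
    rw [Finset.sum_image hinj, Finset.sum_congr rfl hΛ, Chebyshev.theta]
  have hrest : ∑ n ∈ S \ P.image (fun p => p ^ 2), ArithmeticFunction.vonMangoldt n ≤
      C * Real.exp (y / 3) := by
    have := Finset.sum_sdiff (f := fun n => ArithmeticFunction.vonMangoldt n) hsub
    rw [hθ, ← hψθ] at this
    linarith
  have hmain : ‖∑ n ∈ S, (quadCharSum q n - (rho q - 1)) * (ArithmeticFunction.vonMangoldt n : ℝ)‖ ≤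
      2 * r * (C + K) * Real.exp (y / 3) := by
    have hn : ∀ n : ℕ, ‖(quadCharSum q n - (rho q - 1)) * (ArithmeticFunction.vonMangoldt n : ℝ)‖ ≤
        2 * r * ArithmeticFunction.vonMangoldt n := fun n => by
      rw [norm_mul, Complex.norm_real, Real.norm_of_nonneg ArithmeticFunction.vonMangoldt_nonneg]
      exact mul_le_mul_of_nonneg_right (norm_quadCharSum_sub_le q n)
        ArithmeticFunction.vonMangoldt_nonneg
    rw [← Finset.sum_sdiff hsub]
    refine (norm_add_le _ _).trans ?_
    have t1 : ‖∑ n ∈ S \ P.image (fun p => p ^ 2),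
        (quadCharSum q n - (rho q - 1)) * (ArithmeticFunction.vonMangoldt n : ℝ)‖ ≤
        2 * r * (C * Real.exp (y / 3)) := by
      refine (norm_sum_le _ _).trans ((Finset.sum_le_sum fun n _ => hn n).trans ?_)
      rw [← Finset.mul_sum]
      exact mul_le_mul_of_nonneg_left hrest (by positivity)
    have t2 : ‖∑ n ∈ P.image (fun p => p ^ 2),
        (quadCharSum q n - (rho q - 1)) * (ArithmeticFunction.vonMangoldt n : ℝ)‖ ≤ 2 * r * K := by
      rw [Finset.sum_image hinj, ← Finset.sum_filter_add_sum_filter_not P fun p => p ∣ q]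
      have z : ∑ p ∈ P.filter (fun p => ¬ p ∣ q), (quadCharSum q (p ^ 2) - (rho q - 1)) *
          ((ArithmeticFunction.vonMangoldt (p ^ 2) : ℝ) : ℂ) = 0 := by
        refine Finset.sum_eq_zero fun p hp => ?_
        obtain ⟨hp1, hp2⟩ := Finset.mem_filter.1 hp
        have hpr := (Finset.mem_filter.1 hp1).2
        rw [quadCharSum_sq ((ZMod.isUnit_iff_coprime p q).2 ((Nat.Prime.coprime_iff_not_dvd hpr).2 hp2)),
          sub_self, zero_mul]
      rw [z, add_zero]
      refine (norm_sum_le _ _).trans ((Finset.sum_le_sum fun p _ => hn (p ^ 2)).trans ?_)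
      rw [← Finset.mul_sum]
      refine mul_le_mul_of_nonneg_left ?_ (by positivity)
      rw [Finset.sum_congr rfl fun p hp => hΛ p (Finset.mem_filter.1 hp).1]
      refine Finset.sum_le_sum_of_subset_of_nonneg (fun p hp => ?_) fun p _ _ => Real.log_natCast_nonneg p
      exact Nat.mem_divisors.2 ⟨(Finset.mem_filter.1 hp).2, NeZero.ne q⟩
    have t3 : 2 * r * K ≤ 2 * r * K * Real.exp (y / 3) :=
      le_mul_of_one_le_right (by positivity) (Real.one_le_exp (by positivity))
    calc _ ≤ _ := add_le_add t1 (t2.trans t3)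
      _ = _ := by ring
  have hsplit : expSum (quadLambda q) y - expSum (quadTheta q) y -
      (r * Chebyshev.psi (Real.exp (y / 2)) : ℝ) =
      ∑ n ∈ S, (quadCharSum q n - (rho q - 1)) * (ArithmeticFunction.vonMangoldt n : ℝ) +
      (r * (Chebyshev.psi (Real.exp y) - Chebyshev.theta (Real.exp y) -
        Chebyshev.psi (Real.exp (y / 2))) : ℝ) := by
    rw [hψθ, hdiff]
    simp only [sub_mul, Finset.sum_sub_distrib, ← Finset.mul_sum]
    push_cast [hr]
    ring
  rw [hsplit]
  refine (norm_add_le _ _).trans ?_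
  rw [Complex.norm_real, Real.norm_of_nonneg (mul_nonneg hr0 c1)]
  have := mul_le_mul_of_nonneg_left c2 hr0
  calc _ ≤ _ := add_le_add hmain this
    _ = _ := by ring

end

/-- The Abel mean of `‖h‖²` on `[0, ∞)` with parameter `ε`. -/
noncomputable def abelSq (h : ℝ → ℂ) (ε : ℝ) : ENNReal :=
  ENNReal.ofReal ε * ∫⁻ y in Set.Ici 0, ‖h y‖ₑ ^ 2 * ENNReal.ofReal (Real.exp (-(2 * ε) * y))

/-- `h` has vanishing Abel mean square. -/
def AbelSmall (h : ℝ → ℂ) : Prop := ∀ η : ENNReal, η ≠ 0 → ∀ᶠ ε in 𝓝[>] (0 : ℝ), abelSq h ε ≤ η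

/-- `h` has bounded Abel mean square. -/
def AbelBdd (h : ℝ → ℂ) : Prop := ∃ K : ENNReal, K ≠ ⊤ ∧ ∀ᶠ ε in 𝓝[>] (0 : ℝ), abelSq h ε ≤ K

lemma abelSq_mono {h g : ℝ → ℂ} (hg : ∀ y, 0 ≤ y → ‖h y‖ ≤ ‖g y‖) (ε : ℝ) : abelSq h ε ≤ abelSq g ε := by
  refine mul_le_mul_right (setLIntegral_mono' measurableSet_Ici fun y hy => ?_) _
  refine mul_le_mul_left (pow_le_pow_left₀ zero_le ?_ 2) _
  rw [← ofReal_norm, ← ofReal_norm]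
  exact ENNReal.ofReal_le_ofReal (hg y hy)

lemma abelSq_congr {h g : ℝ → ℂ} (hg : ∀ y, 0 ≤ y → h y = g y) (ε : ℝ) : abelSq h ε = abelSq g ε :=
  le_antisymm (abelSq_mono (fun y hy => (congrArg norm (hg y hy)).le) ε)
    (abelSq_mono (fun y hy => (congrArg norm (hg y hy)).ge) ε)

lemma add_sq_le_two_mul (a b : ENNReal) : (a + b) ^ 2 ≤ 2 * a ^ 2 + 2 * b ^ 2 := by
  have := ENNReal.rpow_add_le_mul_rpow_add_rpow a b (p := 2) (by norm_num)
  have h2 : (2 : ENNReal) ^ ((2 : ℝ) - 1) = 2 := by norm_num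
  rw [h2, ENNReal.rpow_two, ENNReal.rpow_two, ENNReal.rpow_two, mul_add] at this
  exact this

lemma abelSq_add_le {h : ℝ → ℂ} (hh : Measurable h) (g : ℝ → ℂ) (ε : ℝ) :
    abelSq (fun y => h y + g y) ε ≤ 2 * abelSq h ε + 2 * abelSq g ε := by
  have h1 : ∫⁻ y in Set.Ici 0, ‖h y + g y‖ₑ ^ 2 * ENNReal.ofReal (Real.exp (-(2 * ε) * y)) ≤
      2 * (∫⁻ y in Set.Ici 0, ‖h y‖ₑ ^ 2 * ENNReal.ofReal (Real.exp (-(2 * ε) * y))) +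
      2 * ∫⁻ y in Set.Ici 0, ‖g y‖ₑ ^ 2 * ENNReal.ofReal (Real.exp (-(2 * ε) * y)) := by
    rw [← lintegral_const_mul' _ _ (by norm_num), ← lintegral_const_mul' _ _ (by norm_num),
      ← lintegral_add_left (by fun_prop)]
    refine lintegral_mono fun y => ?_
    rw [← mul_assoc, ← mul_assoc, ← add_mul]
    refine mul_le_mul_left ?_ _
    exact (pow_le_pow_left₀ zero_le (enorm_add_le _ _) 2).trans (add_sq_le_two_mul _ _)
  calc _ ≤ _ := mul_le_mul_right h1 (ENNReal.ofReal ε)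
    _ = _ := by rw [abelSq, abelSq]; ring

lemma abelSq_neg (h : ℝ → ℂ) (ε : ℝ) : abelSq (fun y => -h y) ε = abelSq h ε := by
  simp [abelSq]

lemma two_mul_quarter_add (η : ENNReal) : 2 * (η / 4) + 2 * (η / 4) = η := by
  rw [← mul_add, ← two_mul, ← mul_assoc, show (2 : ENNReal) * 2 = 4 by norm_num]
  exact ENNReal.mul_div_cancel (by norm_num) (by norm_num)

lemma AbelSmall.add {h g : ℝ → ℂ} (hm : Measurable h) (hh : AbelSmall h) (hg : AbelSmall g) :
    AbelSmall fun y => h y + g y := by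
  intro η hη
  have h4 : η / 4 ≠ 0 := (ENNReal.div_pos hη (by norm_num)).ne'
  filter_upwards [hh _ h4, hg _ h4] with ε h1 h2
  refine (abelSq_add_le hm g ε).trans ?_
  rw [← two_mul_quarter_add η]
  exact add_le_add (mul_le_mul_right h1 _) (mul_le_mul_right h2 _)

lemma AbelBdd.add {h g : ℝ → ℂ} (hm : Measurable h) (hh : AbelBdd h) (hg : AbelBdd g) :
    AbelBdd fun y => h y + g y := by
  obtain ⟨K, hK, h1⟩ := hh
  obtain ⟨L, hL, h2⟩ := hg
  refine ⟨2 * K + 2 * L, by finiteness, ?_⟩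
  filter_upwards [h1, h2] with ε h1 h2
  exact (abelSq_add_le hm g ε).trans (add_le_add (mul_le_mul_right h1 _) (mul_le_mul_right h2 _))

lemma AbelSmall.bdd {h : ℝ → ℂ} (hh : AbelSmall h) : AbelBdd h :=
  ⟨1, by norm_num, hh 1 one_ne_zero⟩

lemma AbelSmall.mono {h g : ℝ → ℂ} (hg : AbelSmall g) (hh : ∀ y, 0 ≤ y → ‖h y‖ ≤ ‖g y‖) : AbelSmall h :=
  fun η hη => (hg η hη).mono fun ε hε => (abelSq_mono hh ε).trans hε

lemma AbelBdd.mono {h g : ℝ → ℂ} (hg : AbelBdd g) (hh : ∀ y, 0 ≤ y → ‖h y‖ ≤ ‖g y‖) : AbelBdd h := by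
  obtain ⟨K, hK, h1⟩ := hg
  exact ⟨K, hK, h1.mono fun ε hε => (abelSq_mono hh ε).trans hε⟩

lemma AbelSmall.neg {h : ℝ → ℂ} (hh : AbelSmall h) : AbelSmall fun y => -h y :=
  hh.mono fun _ _ => (norm_neg _).le

lemma AbelSmall.const_mul {h : ℝ → ℂ} (hh : AbelSmall h) (c : ℂ) : AbelSmall fun y => c * h y := by
  intro η hη
  have hc : ‖c‖ₑ ^ 2 ≠ ⊤ := by finiteness
  have h1 : η / (‖c‖ₑ ^ 2) ≠ 0 := (ENNReal.div_pos hη hc).ne'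
  filter_upwards [hh _ h1] with ε h1
  have h2 : abelSq (fun y => c * h y) ε = ‖c‖ₑ ^ 2 * abelSq h ε := by
    rw [abelSq, abelSq, mul_left_comm, ← lintegral_const_mul' _ _ hc]
    congr 1
    refine lintegral_congr fun y => ?_
    rw [enorm_mul, mul_pow, mul_assoc]
  rw [h2]
  exact (mul_le_mul_right h1 _).trans ENNReal.mul_div_le

lemma exp_neg_le_one_of_nonneg {ε y : ℝ} (hε : 0 < ε) (hy : 0 ≤ y) :
    ENNReal.ofReal (Real.exp (-(2 * ε) * y)) ≤ 1 := by
  rw [ENNReal.ofReal_le_one, Real.exp_le_one_iff]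
  have := mul_nonneg hε.le hy
  nlinarith

lemma AbelSmall.of_lintegral_ne_top {h : ℝ → ℂ} (hh : ∫⁻ y in Set.Ici 0, ‖h y‖ₑ ^ 2 ≠ ⊤) :
    AbelSmall h := by
  intro η hη
  filter_upwards [eventually_ofReal_mul_le hh hη, self_mem_nhdsWithin] with ε h1 hε
  refine le_trans (mul_le_mul_right ?_ _) h1
  refine setLIntegral_mono' measurableSet_Ici fun y hy => ?_
  exact mul_le_of_le_one_right' (exp_neg_le_one_of_nonneg hε hy)

lemma lintegral_exp_Ici {c : ℝ} (hc : 0 < c) (a : ℝ) :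
    ∫⁻ y in Set.Ici a, ENNReal.ofReal (Real.exp (-c * y)) = ENNReal.ofReal (Real.exp (-c * a) / c) := by
  rw [← ofReal_integral_eq_lintegral_ofReal, integral_Ici_eq_integral_Ioi,
    integral_exp_mul_Ioi (by linarith)]
  · rw [neg_div_neg_eq]
  · exact (integrableOn_Ici_iff_integrableOn_Ioi (by simp)).2 (integrableOn_exp_mul_Ioi (by linarith) a)
  · exact Eventually.of_forall fun y => (Real.exp_pos _).le

lemma abelSq_const (c : ℂ) {ε : ℝ} (hε : 0 < ε) : abelSq (fun _ => c) ε = ‖c‖ₑ ^ 2 / 2 := by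
  rw [abelSq, lintegral_const_mul' _ _ (by finiteness), lintegral_exp_Ici (by positivity), mul_left_comm,
    ← ENNReal.ofReal_mul hε.le, mul_zero, Real.exp_zero, div_eq_mul_inv]
  congr 1
  rw [show ε * (1 * (2 * ε)⁻¹) = (2 : ℝ)⁻¹ by field_simp, ENNReal.ofReal_inv_of_pos two_pos]
  simp

lemma abelBdd_of_norm_le {h : ℝ → ℂ} {C : ℝ} (hC : ∀ y, 0 ≤ y → ‖h y‖ ≤ C) : AbelBdd h := by
  have : AbelBdd fun _ => (C : ℂ) := by
    refine ⟨‖(C : ℂ)‖ₑ ^ 2 / 2, ENNReal.div_ne_top (by finiteness) (by norm_num), ?_⟩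
    filter_upwards [self_mem_nhdsWithin] with ε hε
    exact (abelSq_const _ hε).le
  exact this.mono fun y hy => (hC y hy).trans (by simpa using le_abs_self C)

lemma AbelSmall.of_norm_le_exp {h : ℝ → ℂ} {C c : ℝ} (hc : 0 < c)
    (hC : ∀ y, 0 ≤ y → ‖h y‖ ≤ C * Real.exp (-c * y)) : AbelSmall h := by
  refine AbelSmall.of_lintegral_ne_top ?_
  have h1 : ∀ y ∈ Set.Ici (0 : ℝ), ‖h y‖ₑ ^ 2 ≤
      ENNReal.ofReal (C ^ 2) * ENNReal.ofReal (Real.exp (-(2 * c) * y)) := by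
    intro y hy
    rw [← ENNReal.ofReal_mul (sq_nonneg C), ← ofReal_norm, ← ENNReal.ofReal_pow (norm_nonneg _)]
    refine ENNReal.ofReal_le_ofReal ((pow_le_pow_left₀ (norm_nonneg _) (hC y hy) 2).trans (le_of_eq ?_))
    rw [mul_pow, ← Real.exp_nat_mul]
    congr 2
    push_cast
    ring
  refine ne_top_of_le_ne_top ?_ (setLIntegral_mono' measurableSet_Ici h1)
  rw [lintegral_const_mul' _ _ ENNReal.ofReal_ne_top, lintegral_exp_Ici (by positivity)]
  finiteness

lemma sq_lintegral_mul_le {s : Set ℝ} {f g : ℝ → ENNReal} (hf : Measurable f) (hg : Measurable g) :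
    (∫⁻ u in s, f u * g u) ^ 2 ≤ (∫⁻ u in s, f u ^ 2) * ∫⁻ u in s, g u ^ 2 := by
  have h := ENNReal.lintegral_mul_le_Lp_mul_Lq (volume.restrict s) Real.HolderConjugate.two_two
    hf.aemeasurable hg.aemeasurable
  have h2 := pow_le_pow_left₀ zero_le h 2
  simp only [Pi.mul_apply, ENNReal.rpow_two] at h2
  refine h2.trans (le_of_eq ?_)
  rw [mul_pow, ← ENNReal.rpow_natCast, ← ENNReal.rpow_natCast, ← ENNReal.rpow_mul, ← ENNReal.rpow_mul]
  norm_num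

lemma lintegral_Ico_swap_le {A B : ℝ → ENNReal} (hA : Measurable A) (hB : Measurable B) (b : ℝ) :
    ∫⁻ y in Set.Ici 0, A y * ∫⁻ u in Set.Ico b y, B u ≤
      ∫⁻ u in Set.Ici b, B u * ∫⁻ y in Set.Ici u, A y := by
  have h1 : ∀ y, A y * ∫⁻ u in Set.Ico b y, B u =
      ∫⁻ u in Set.Ici b, {p : ℝ × ℝ | p.2 < p.1}.indicator (fun p => A p.1 * B p.2) (y, u) := by
    intro y
    have : ∀ u, {p : ℝ × ℝ | p.2 < p.1}.indicator (fun p => A p.1 * B p.2) (y, u) =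
        (Set.Iio y).indicator (fun u => A y * B u) u := by
      intro u
      simp [Set.indicator_apply]
    simp only [this]
    rw [setLIntegral_indicator measurableSet_Iio, Set.inter_comm, Set.Ici_inter_Iio,
      lintegral_const_mul _ hB]
  simp only [h1]
  rw [lintegral_lintegral_swap]
  · refine lintegral_mono fun u => ?_
    have : ∀ y, {p : ℝ × ℝ | p.2 < p.1}.indicator (fun p => A p.1 * B p.2) (y, u) =
        (Set.Ioi u).indicator (fun y => B u * A y) y := by
      intro y
      simp [Set.indicator_apply, mul_comm]
    simp only [this]
    rw [setLIntegral_indicator measurableSet_Ioi, lintegral_const_mul _ hA]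
    refine mul_le_mul_right (lintegral_mono_set ?_) _
    exact fun y hy => (Set.mem_Ioi.1 hy.1).le
  · refine Measurable.aemeasurable ?_
    refine Measurable.indicator (by fun_prop) ?_
    exact measurableSet_lt measurable_snd measurable_fst

lemma integral_inv_sq_Ico {a y : ℝ} (ha : 0 < a) (hy : a ≤ y) :
    ∫ u in Set.Ico a y, (u ^ 2)⁻¹ = a⁻¹ - y⁻¹ := by
  rw [integral_Ico_eq_integral_Ioo, ← integral_Ioc_eq_integral_Ioo, ← intervalIntegral.integral_of_le hy]
  have h := integral_zpow (a := a) (b := y) (n := -2)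
    (Or.inr ⟨by norm_num, Set.notMem_uIcc_of_lt ha (ha.trans_le hy)⟩)
  norm_num at h
  rw [h]
  ring

lemma integrableOn_inv_sq_Ico {a : ℝ} (ha : 0 < a) (y : ℝ) :
    IntegrableOn (fun u : ℝ => (u ^ 2)⁻¹) (Set.Ico a y) := by
  refine IntegrableOn.mono_set ?_ Set.Ico_subset_Icc_self
  refine ContinuousOn.integrableOn_Icc ?_
  exact ContinuousOn.inv₀ (by fun_prop) fun u hu => pow_ne_zero _ (ha.trans_le hu.1).ne'

lemma mul_expSum_sub_eq {a : ℕ → ℂ} (ha : a 1 = 0) (y : ℝ) :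
    y * expSum a y - expSum (fun n => a n * (Real.log n : ℝ)) y =
      y * ∫ u in Set.Ico (Real.log 2) y, expSum (fun n => a n * (Real.log n : ℝ)) u * ((u ^ 2)⁻¹ : ℝ) := by
  have hl2 : 0 < Real.log 2 := Real.log_pos (by norm_num)
  set N := ⌊Real.exp y⌋₊ with hN
  have h1 : ∀ u ∈ Set.Ico (Real.log 2) y, expSum (fun n => a n * (Real.log n : ℝ)) u * ((u ^ 2)⁻¹ : ℝ) =
      ∑ n ∈ Finset.Icc 1 N, (a n * (Real.log n : ℝ)) *
        (((Set.Ici (Real.log n)).indicator (fun u => (u ^ 2)⁻¹) u : ℝ) : ℂ) := by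
    intro u hu
    rw [expSum, Finset.sum_mul]
    have hsub : Finset.Icc 1 ⌊Real.exp u⌋₊ ⊆ Finset.Icc 1 N :=
      Finset.Icc_subset_Icc_right (Nat.floor_mono (Real.exp_le_exp.2 hu.2.le))
    rw [← Finset.sum_subset hsub]
    · refine Finset.sum_congr rfl fun n hn => ?_
      rw [Finset.mem_Icc] at hn
      have hn0 : (0 : ℝ) < n := by exact_mod_cast hn.1
      have : Real.log n ≤ u := by
        rw [Real.log_le_iff_le_exp hn0]
        exact (Nat.le_floor_iff (Real.exp_pos u).le).1 hn.2
      rw [Set.indicator_of_mem (by exact this)]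
    · intro n hn hn2
      rw [Finset.mem_Icc] at hn hn2
      have hn0 : (0 : ℝ) < n := by exact_mod_cast hn.1
      rw [Set.indicator_of_notMem, Complex.ofReal_zero, mul_zero]
      rw [Set.mem_Ici, Real.log_le_iff_le_exp hn0]
      intro h
      exact hn2 ⟨hn.1, Nat.le_floor h⟩
  rw [setIntegral_congr_fun measurableSet_Ico h1, integral_finsetSum, expSum, expSum, Finset.mul_sum,
    Finset.mul_sum, ← Finset.sum_sub_distrib]
  · refine Finset.sum_congr rfl fun n hn => ?_
    rw [Finset.mem_Icc] at hn
    rcases hn.1.eq_or_lt with rfl | hn1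
    · simp [ha]
    have hn0 : (0 : ℝ) < n := by exact_mod_cast hn.1
    have hln : Real.log 2 ≤ Real.log n := Real.log_le_log (by norm_num) (by exact_mod_cast hn1)
    have hny : Real.log n ≤ y := by
      rw [Real.log_le_iff_le_exp hn0]
      exact (Nat.le_floor_iff (Real.exp_pos y).le).1 hn.2
    rw [integral_const_mul, integral_complex_ofReal, setIntegral_indicator measurableSet_Ici]
    have : Set.Ico (Real.log 2) y ∩ Set.Ici (Real.log n) = Set.Ico (Real.log n) y := by
      ext u
      simp only [Set.mem_inter_iff, Set.mem_Ico, Set.mem_Ici]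
      constructor
      · rintro ⟨⟨_, h⟩, h2⟩
        exact ⟨h2, h⟩
      · rintro ⟨h, h2⟩
        exact ⟨⟨hln.trans h, h2⟩, h⟩
    rw [this, integral_inv_sq_Ico (hl2.trans_le hln) hny]
    have hp : 0 < Real.log n := hl2.trans_le hln
    have e1 : ((Real.log n : ℝ) : ℂ) ≠ 0 := by exact_mod_cast hp.ne'
    have e2 : (y : ℂ) ≠ 0 := by exact_mod_cast (hp.trans_le hny).ne'
    rw [Complex.ofReal_sub, Complex.ofReal_inv, Complex.ofReal_inv]
    generalize ((Real.log n : ℝ) : ℂ) = L at e1 ⊢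
    field_simp
  · intro n _
    refine Integrable.const_mul ?_ _
    refine Integrable.ofReal ?_
    exact (integrableOn_inv_sq_Ico hl2 y).indicator measurableSet_Ici

lemma sq_mul_exp_le {u y : ℝ} (hu : 1 / 2 ≤ u) (hy : u ≤ y) :
    y ^ 2 * Real.exp (-y / 2) ≤ 256 * u ^ 2 * Real.exp (-u / 2) * Real.exp (-(1 / 4) * (y - u)) := by
  have h0 : y ≤ 16 * u * Real.exp ((y - u) / 8) := by
    have := Real.add_one_le_exp ((y - u) / 8)
    have h2 : 16 * u * ((y - u) / 8 + 1) ≤ 16 * u * Real.exp ((y - u) / 8) :=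
      mul_le_mul_of_nonneg_left this (by linarith)
    nlinarith
  have h1 : y ^ 2 ≤ (16 * u * Real.exp ((y - u) / 8)) ^ 2 := pow_le_pow_left₀ (by linarith) h0 2
  calc _ ≤ (16 * u * Real.exp ((y - u) / 8)) ^ 2 * Real.exp (-y / 2) :=
        mul_le_mul_of_nonneg_right h1 (Real.exp_pos _).le
    _ = 256 * u ^ 2 * (Real.exp ((y - u) / 8) ^ 2 * Real.exp (-y / 2)) := by ring
    _ = 256 * u ^ 2 * (Real.exp (-u / 2) * Real.exp (-(1 / 4) * (y - u))) := by
      rw [← Real.exp_nat_mul, ← Real.exp_add, ← Real.exp_add]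
      congr 2
      push_cast
      ring
    _ = _ := by ring

lemma abelSmall_of_eventually_le {h H : ℝ → ℂ} (hH : Measurable H) (hb : AbelBdd h) {C : ℝ}
    (hC : ∀ y, 0 ≤ y → ‖H y‖ ≤ C * Real.exp y)
    (hle : ∀ δ : ℝ, 0 < δ → ∃ U, ∀ y, U ≤ y → ‖H y‖ ≤ δ * ‖h y‖) : AbelSmall H := by
  have key : ∀ δ : ℝ, 0 < δ → ∃ U, AbelSmall ((Set.Iio U).indicator H) ∧
      ∀ ε, abelSq ((Set.Ici U).indicator H) ε ≤ ENNReal.ofReal (δ ^ 2) * abelSq h ε := by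
    intro δ hδ
    obtain ⟨U, hU⟩ := hle δ hδ
    refine ⟨U, ?_, fun ε => ?_⟩
    · refine AbelSmall.of_norm_le_exp (C := |C| * Real.exp (2 * |U|)) one_pos fun y hy => ?_
      by_cases hyU : y < U
      · rw [Set.indicator_of_mem (by exact hyU)]
        refine (hC y hy).trans ((mul_le_mul_of_nonneg_right (le_abs_self C) (Real.exp_pos _).le).trans ?_)
        rw [mul_assoc, ← Real.exp_add]
        refine mul_le_mul_of_nonneg_left (Real.exp_le_exp.2 ?_) (abs_nonneg C)
        have := le_abs_self U
        linarith
      · rw [Set.indicator_of_notMem (by exact hyU), norm_zero]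
        positivity
    · rw [abelSq, abelSq, mul_left_comm (ENNReal.ofReal (δ ^ 2)),
        ← lintegral_const_mul' (ENNReal.ofReal (δ ^ 2)) _ ENNReal.ofReal_ne_top]
      refine mul_le_mul_right (lintegral_mono fun y => ?_) _
      rw [← mul_assoc]
      refine mul_le_mul_left ?_ _
      by_cases hyU : U ≤ y
      · rw [Set.indicator_of_mem (by exact hyU), ← ofReal_norm, ← ofReal_norm,
          ENNReal.ofReal_pow hδ.le, ← mul_pow, ← ENNReal.ofReal_mul hδ.le]
        exact pow_le_pow_left₀ zero_le (ENNReal.ofReal_le_ofReal (hU y hyU)) 2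
      · rw [Set.indicator_of_notMem (by exact hyU)]
        simp
  obtain ⟨K, hK, hKε⟩ := hb
  intro η hη
  have h4 : η / 4 ≠ 0 := (ENNReal.div_pos hη (by norm_num)).ne'
  obtain ⟨δ, hδ0, hδ⟩ := ((eventually_ofReal_mul_le hK h4).and self_mem_nhdsWithin).exists
  have hδ' : 0 < δ := hδ
  obtain ⟨U, h1, h2⟩ := key (Real.sqrt δ) (Real.sqrt_pos.2 hδ')
  filter_upwards [h1 _ h4, hKε] with ε h3 h5
  have e : abelSq H ε =
      abelSq (fun y => (Set.Iio U).indicator H y + (Set.Ici U).indicator H y) ε := by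
    refine abelSq_congr (fun y _ => ?_) ε
    have := congrFun (Set.indicator_compl_add_self (Set.Ici U) H) y
    rw [Set.compl_Ici] at this
    exact this.symm
  rw [e]
  refine (abelSq_add_le (hH.indicator measurableSet_Iio) _ ε).trans ?_
  rw [← two_mul_quarter_add η]
  refine add_le_add (mul_le_mul_right h3 _) (mul_le_mul_right ?_ _)
  refine (h2 ε).trans ?_
  rw [Real.sq_sqrt hδ'.le]
  exact (mul_le_mul_right h5 _).trans hδ0

lemma enorm_mul_expSum_sub_le {a : ℕ → ℂ} (ha : a 1 = 0) (y : ℝ) (hy : 0 ≤ y) :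
    ‖y * expSum a y - expSum (fun n => a n * (Real.log n : ℝ)) y‖ₑ ^ 2 ≤
      ENNReal.ofReal (2 * y ^ 2 * Real.exp (y / 2)) * ∫⁻ u in Set.Ico (Real.log 2) y,
        (‖expSum (fun n => a n * (Real.log n : ℝ)) u‖ₑ * ENNReal.ofReal (u ^ 2)⁻¹ *
          ENNReal.ofReal (Real.exp (-u / 4))) ^ 2 := by
  set Θ := expSum (fun n => a n * (Real.log n : ℝ)) with hΘ
  have hΘm : Measurable Θ := measurable_expSum _
  rw [mul_expSum_sub_eq ha y, enorm_mul, mul_pow]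
  have h1 : ‖∫ u in Set.Ico (Real.log 2) y, Θ u * ((u ^ 2)⁻¹ : ℝ)‖ₑ ≤
      ∫⁻ u in Set.Ico (Real.log 2) y, ENNReal.ofReal (Real.exp (u / 4)) *
        (‖Θ u‖ₑ * ENNReal.ofReal (u ^ 2)⁻¹ * ENNReal.ofReal (Real.exp (-u / 4))) := by
    refine (enorm_integral_le_lintegral_enorm _).trans (lintegral_mono fun u => le_of_eq ?_)
    have e : ENNReal.ofReal (Real.exp (u / 4)) * ENNReal.ofReal (Real.exp (-u / 4)) = 1 := by
      rw [← ENNReal.ofReal_mul (Real.exp_pos _).le, ← Real.exp_add]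
      simp [neg_div]
    have e2 : ‖(((u ^ 2)⁻¹ : ℝ) : ℂ)‖ₑ = ENNReal.ofReal (u ^ 2)⁻¹ := by
      rw [← ofReal_norm, Complex.norm_real, Real.norm_of_nonneg (by positivity)]
    calc _ = ‖Θ u‖ₑ * ENNReal.ofReal (u ^ 2)⁻¹ *
          (ENNReal.ofReal (Real.exp (u / 4)) * ENNReal.ofReal (Real.exp (-u / 4))) := by
          rw [e, mul_one, enorm_mul, e2]
      _ = _ := by ring
  have h2 := (pow_le_pow_left₀ zero_le h1 2).trans (sq_lintegral_mul_le (by fun_prop) (by fun_prop))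
  have h3 : ∫⁻ u in Set.Ico (Real.log 2) y, ENNReal.ofReal (Real.exp (u / 4)) ^ 2 ≤
      ENNReal.ofReal (2 * Real.exp (y / 2)) := by
    calc _ ≤ ∫⁻ u in Set.Iic y, ENNReal.ofReal (Real.exp (u / 4)) ^ 2 :=
          lintegral_mono_set fun u hu => hu.2.le
      _ = ∫⁻ u in Set.Iic y, ENNReal.ofReal (Real.exp ((1 / 2) * u)) := by
          refine lintegral_congr fun u => ?_
          rw [← ENNReal.ofReal_pow (Real.exp_pos _).le, ← Real.exp_nat_mul]
          congr 2
          push_cast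
          ring
      _ = ENNReal.ofReal (2 * Real.exp (y / 2)) := by
          rw [← ofReal_integral_eq_lintegral_ofReal (integrableOn_exp_mul_Iic (by norm_num) y)
            (Eventually.of_forall fun u => (Real.exp_pos _).le), integral_exp_mul_Iic (by norm_num)]
          congr 1
          rw [show (1 / 2 : ℝ) * y = y / 2 by ring]
          ring
  have h4 : ‖(y : ℂ)‖ₑ ^ 2 = ENNReal.ofReal (y ^ 2) := by
    rw [← ofReal_norm, Complex.norm_real, Real.norm_of_nonneg hy, ENNReal.ofReal_pow hy]
  rw [h4]
  calc _ ≤ _ := mul_le_mul_right (h2.trans (mul_le_mul_left h3 _)) _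
    _ = _ := by
      rw [← mul_assoc, ← ENNReal.ofReal_mul (sq_nonneg y)]
      congr 2
      ring

lemma abelSmall_mul_expSum_sub {a : ℕ → ℂ} (ha : a 1 = 0) {C : ℝ}
    (hC : ∀ y, ‖expSum (fun n => a n * (Real.log n : ℝ)) y‖ ≤ C * Real.exp y)
    (hb : AbelBdd fun y => (Real.exp (-y / 2) : ℝ) * expSum (fun n => a n * (Real.log n : ℝ)) y) :
    AbelSmall fun y => (Real.exp (-y / 2) : ℝ) *
      (y * expSum a y - expSum (fun n => a n * (Real.log n : ℝ)) y) := by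
  have hl2 : 1 / 2 ≤ Real.log 2 := by have := Real.log_two_gt_d9; linarith
  set Θ := expSum (fun n => a n * (Real.log n : ℝ)) with hΘ
  have hΘm : Measurable Θ := measurable_expSum _
  have hC0 : 0 ≤ C := by simpa using (norm_nonneg _).trans (hC 0)
  set H : ℝ → ℂ := (Set.Ici (Real.log 2)).indicator fun u =>
    (u⁻¹ : ℝ) * ((Real.exp (-u / 2) : ℝ) * Θ u) with hHdef
  have hH : AbelSmall H := by
    refine abelSmall_of_eventually_le ?_ hb (C := 2 * C) ?_ ?_
    · exact Measurable.indicator (by fun_prop) measurableSet_Ici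
    · intro u hu
      by_cases hu2 : Real.log 2 ≤ u
      · rw [hHdef, Set.indicator_of_mem (by exact hu2), norm_mul, norm_mul, Complex.norm_real,
          Complex.norm_real, Real.norm_of_nonneg (Real.exp_pos _).le,
          Real.norm_of_nonneg (inv_nonneg.2 hu)]
        have i1 : u⁻¹ ≤ 2 := by
          rw [inv_le_comm₀ (by linarith) two_pos]
          linarith
        have i2 : Real.exp (-u / 2) ≤ 1 := Real.exp_le_one_iff.2 (by linarith)
        calc u⁻¹ * (Real.exp (-u / 2) * ‖Θ u‖) ≤ 2 * (1 * (C * Real.exp u)) := by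
              gcongr
              exact hC u
          _ = _ := by ring
      · rw [hHdef, Set.indicator_of_notMem (by exact hu2), norm_zero]
        positivity
    · intro δ hδ
      refine ⟨max (Real.log 2) δ⁻¹, fun u hu => ?_⟩
      have hu1 : Real.log 2 ≤ u := (le_max_left _ _).trans hu
      have hu2 : δ⁻¹ ≤ u := (le_max_right _ _).trans hu
      rw [hHdef, Set.indicator_of_mem (by exact hu1), norm_mul, Complex.norm_real,
        Real.norm_of_nonneg (inv_nonneg.2 (by linarith))]
      refine mul_le_mul_of_nonneg_right ?_ (norm_nonneg _)
      exact inv_le_of_inv_le₀ hδ hu2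
  have hmain : ∀ ε : ℝ, 0 < ε → abelSq (fun y => (Real.exp (-y / 2) : ℝ) * (y * expSum a y - Θ y)) ε ≤
      2048 * abelSq H ε := by
    intro ε hε
    rw [abelSq, abelSq, mul_left_comm]
    refine mul_le_mul_right ?_ _
    set B : ℝ → ENNReal := fun u => (‖Θ u‖ₑ * ENNReal.ofReal (u ^ 2)⁻¹ *
      ENNReal.ofReal (Real.exp (-u / 4))) ^ 2 with hB
    set A : ℝ → ENNReal := fun y => ENNReal.ofReal (2 * y ^ 2 * Real.exp (-y / 2) *
      Real.exp (-(2 * ε) * y)) with hA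
    have s1 : ∀ y ∈ Set.Ici (0 : ℝ), ‖(Real.exp (-y / 2) : ℝ) * (y * expSum a y - Θ y)‖ₑ ^ 2 *
        ENNReal.ofReal (Real.exp (-(2 * ε) * y)) ≤ A y * ∫⁻ u in Set.Ico (Real.log 2) y, B u := by
      intro y hy
      have e1 : ‖((Real.exp (-y / 2) : ℝ) : ℂ)‖ₑ ^ 2 = ENNReal.ofReal (Real.exp (-y)) := by
        rw [← ofReal_norm, Complex.norm_real, Real.norm_of_nonneg (Real.exp_pos _).le,
          ← ENNReal.ofReal_pow (Real.exp_pos _).le, ← Real.exp_nat_mul]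
        congr 2
        push_cast
        ring
      rw [enorm_mul, mul_pow, e1]
      calc _ ≤ _ := mul_le_mul_left (mul_le_mul_right (enorm_mul_expSum_sub_le ha y hy) _) _
        _ = A y * ∫⁻ u in Set.Ico (Real.log 2) y, B u := by
          rw [← mul_assoc, mul_right_comm, ← ENNReal.ofReal_mul (Real.exp_pos _).le,
            ← ENNReal.ofReal_mul (by positivity)]
          congr 2
          rw [show Real.exp (-y / 2) = Real.exp (-y) * Real.exp (y / 2) by
            rw [← Real.exp_add]; congr 1; ring]
          ring
    refine (setLIntegral_mono' measurableSet_Ici s1).trans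
      ((lintegral_Ico_swap_le (by fun_prop) (by fun_prop) _).trans ?_)
    rw [← lintegral_const_mul' _ _ (by norm_num)]
    refine (setLIntegral_mono' measurableSet_Ici (g := (Set.Ici (Real.log 2)).indicator fun u =>
      2048 * (‖H u‖ₑ ^ 2 * ENNReal.ofReal (Real.exp (-(2 * ε) * u)))) ?_).trans ?_
    · intro u hu
      have hu1 : Real.log 2 ≤ u := hu
      have s2 : ∫⁻ y in Set.Ici u, A y ≤
          ENNReal.ofReal (2048 * u ^ 2 * Real.exp (-u / 2) * Real.exp (-(2 * ε) * u)) := by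
        have s3 : ∀ y ∈ Set.Ici u, A y ≤ ENNReal.ofReal (512 * u ^ 2 * Real.exp (-u / 2) *
            Real.exp (-(2 * ε) * u) * Real.exp (u / 4)) * ENNReal.ofReal (Real.exp (-(1 / 4) * y)) := by
          intro y hy
          rw [← ENNReal.ofReal_mul (by positivity)]
          refine ENNReal.ofReal_le_ofReal ?_
          have t1 := sq_mul_exp_le (hl2.trans hu1) hy
          have t2 : Real.exp (-(2 * ε) * y) ≤ Real.exp (-(2 * ε) * u) := by
            refine Real.exp_le_exp.2 ?_
            have := mul_le_mul_of_nonneg_left (Set.mem_Ici.1 hy) hε.le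
            linarith
          calc _ = 2 * (y ^ 2 * Real.exp (-y / 2)) * Real.exp (-(2 * ε) * y) := by ring
            _ ≤ 2 * (256 * u ^ 2 * Real.exp (-u / 2) * Real.exp (-(1 / 4) * (y - u))) *
                Real.exp (-(2 * ε) * u) := by gcongr
            _ = _ := by
              rw [show -(1 / 4) * (y - u) = u / 4 + -(1 / 4) * y by ring, Real.exp_add]
              ring
        refine (setLIntegral_mono' measurableSet_Ici s3).trans (le_of_eq ?_)
        rw [lintegral_const_mul' _ _ ENNReal.ofReal_ne_top, lintegral_exp_Ici (by norm_num),
          ← ENNReal.ofReal_mul (by positivity)]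
        congr 1
        have : Real.exp (u / 4) * Real.exp (-(1 / 4) * u) = 1 := by
          rw [← Real.exp_add]
          ring_nf
          exact Real.exp_zero
        linear_combination (2048 * u ^ 2 * Real.exp (-u / 2) * Real.exp (-(2 * ε) * u)) * this
      rw [Set.indicator_of_mem hu]
      refine (mul_le_mul_right s2 _).trans (le_of_eq ?_)
      have hu0 : 0 < u := by linarith
      simp only [hB]
      rw [hHdef, Set.indicator_of_mem hu, ← ofReal_norm, ← ofReal_norm, norm_mul, norm_mul,
        Complex.norm_real, Complex.norm_real, Real.norm_of_nonneg (Real.exp_pos _).le,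
        Real.norm_of_nonneg (inv_nonneg.2 hu0.le), ← ENNReal.ofReal_mul (norm_nonneg _),
        ← ENNReal.ofReal_mul (by positivity), ← ENNReal.ofReal_pow (by positivity),
        ← ENNReal.ofReal_pow (by positivity), ← ENNReal.ofReal_mul (by positivity),
        ← ENNReal.ofReal_mul (by positivity),
        show (2048 : ENNReal) = ENNReal.ofReal 2048 by norm_num, ← ENNReal.ofReal_mul (by norm_num)]
      congr 1
      have e5 : Real.exp (-u / 2) = Real.exp (-u / 4) ^ 2 := by
        rw [← Real.exp_nat_mul]
        congr 1
        push_cast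
        ring
      rw [e5]
      field_simp
    · rw [setLIntegral_indicator measurableSet_Ici]
      exact lintegral_mono_set fun u hu => (by norm_num : (0 : ℝ) ≤ 1 / 2).trans (hl2.trans hu.1)
  intro η hη
  have h1 : η / 2048 ≠ 0 := (ENNReal.div_pos hη (by norm_num)).ne'
  filter_upwards [hH _ h1, self_mem_nhdsWithin] with ε h2 hε
  exact (hmain ε hε).trans ((mul_le_mul_right h2 _).trans ENNReal.mul_div_le)

lemma enorm_exp_half_mul_sq (h : ℂ) (y : ℝ) :
    ‖(Real.exp (-y / 2) : ℝ) * h‖ₑ ^ 2 = ‖h‖ₑ ^ 2 * ENNReal.ofReal (Real.exp (-y)) := by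
  have e1 : ‖((Real.exp (-y / 2) : ℝ) : ℂ)‖ₑ ^ 2 = ENNReal.ofReal (Real.exp (-y)) := by
    rw [← ofReal_norm, Complex.norm_real, Real.norm_of_nonneg (Real.exp_pos _).le,
      ← ENNReal.ofReal_pow (Real.exp_pos _).le, ← Real.exp_nat_mul]
    congr 2
    push_cast
    ring
  rw [enorm_mul, mul_pow, e1, mul_comm]

lemma abelSq_exp_half_mul (h : ℝ → ℂ) (ε : ℝ) :
    abelSq (fun y => (Real.exp (-y / 2) : ℝ) * h y) ε =
      ENNReal.ofReal ε * ∫⁻ y in Set.Ici 0, ‖h y‖ₑ ^ 2 *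
        ENNReal.ofReal (Real.exp (-(1 + 2 * ε) * y)) := by
  rw [abelSq]
  congr 1
  refine lintegral_congr fun y => ?_
  rw [enorm_exp_half_mul_sq, mul_assoc, ← ENNReal.ofReal_mul (Real.exp_pos _).le, ← Real.exp_add]
  congr 3
  ring

lemma psiError_of_nonneg {y : ℝ} (hy : 0 ≤ y) :
    psiError y = (Chebyshev.psi (Real.exp y) + 1 - Real.exp y : ℝ) := by
  have : (Chebyshev.psi (Real.exp y) : ℂ) =
      expSum (fun n => (ArithmeticFunction.vonMangoldt n : ℝ)) y := by
    rw [expSum, Chebyshev.psi, Complex.ofReal_sum]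
    rfl
  rw [psiError, Set.indicator_of_mem (by exact hy), ← this]
  push_cast
  ring

lemma abelSmall_psi (hGRH : GRH) : AbelSmall fun y =>
    ((Real.exp (-y / 2) * Chebyshev.psi (Real.exp (y / 2)) - 1 : ℝ) : ℂ) := by
  have h1 : AbelSmall fun y => (Real.exp (-y / 2) : ℝ) * psiError (y / 2) := by
    refine AbelSmall.of_lintegral_ne_top ?_
    have him : Set.image (fun u : ℝ => 2 * u) (Set.Ici 0) = Set.Ici 0 := by
      ext y
      simp only [Set.mem_image, Set.mem_Ici]
      constructor
      · rintro ⟨u, hu, rfl⟩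
        positivity
      · exact fun hy => ⟨y / 2, by positivity, by ring⟩
    have hcv := lintegral_image_eq_lintegral_abs_deriv_mul (s := Set.Ici 0) (f := fun u : ℝ => 2 * u)
      (f' := fun _ => 2) measurableSet_Ici
      (fun x _ => by simpa using ((hasDerivAt_id x).const_mul 2).hasDerivWithinAt)
      (fun x _ y _ hxy => by simpa using hxy)
      (fun y : ℝ => ‖(Real.exp (-y / 2) : ℝ) * psiError (y / 2)‖ₑ ^ 2)
    rw [him] at hcv
    rw [hcv, lintegral_const_mul' _ _ ENNReal.ofReal_ne_top]
    refine ENNReal.mul_ne_top ENNReal.ofReal_ne_top ?_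
    have h2 := isPrimeSum_psiError.lintegral_sq_lt_top (isRiemannType_zetaEntire hGRH)
    refine ne_of_lt (lt_of_eq_of_lt (lintegral_congr fun u => ?_) h2)
    rw [enorm_exp_half_mul_sq, neg_mul, mul_div_cancel_left₀ _ two_ne_zero]
  have h2 : AbelSmall fun y : ℝ => ((-Real.exp (-y / 2) : ℝ) : ℂ) := by
    refine AbelSmall.of_norm_le_exp (C := 1) (c := 1 / 2) (by norm_num) fun y _ => ?_
    rw [Complex.norm_real, norm_neg, Real.norm_of_nonneg (Real.exp_pos _).le, one_mul]
    exact Real.exp_le_exp.2 (by linarith)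
  have hm : Measurable psiError := isPrimeSum_psiError.meas
  refine (h1.add (by fun_prop) h2).mono fun y hy => le_of_eq ?_
  rw [psiError_of_nonneg (by positivity)]
  congr 1
  have : Real.exp (-y / 2) * Real.exp (y / 2) = 1 := by
    rw [← Real.exp_add]
    ring_nf
    exact Real.exp_zero
  rw [← Complex.ofReal_mul, ← Complex.ofReal_add]
  congr 1
  linear_combination this

section
variable (q : ℕ)

/-- The truncation at height `T` of the almost periodic expansion of `E_q(e^y)`. -/
noncomputable def trigSum (T y : ℝ) : ℂ :=
  (rho q - 1 : ℝ) + ∑ γ ∈ zeroFinset (Zfun q) T,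
    (critMult (Zfun q) γ : ℂ) / critPt γ * Complex.exp (γ * y * Complex.I)

lemma exp_half_mul_zeroSum (T y : ℝ) :
    (Real.exp (-y / 2) : ℝ) * zeroSum (Zfun q) T y = trigSum q T y - (rho q - 1 : ℝ) := by
  rw [trigSum, add_sub_cancel_left, zeroSum, Finset.mul_sum]
  refine Finset.sum_congr rfl fun γ _ => ?_
  rw [mul_left_comm, Complex.ofReal_exp, ← Complex.exp_add]
  congr 2
  rw [critPt]
  push_cast
  ring

variable [NeZero q]

lemma Efun_exp (y : ℝ) : (Efun q (Real.exp y) : ℂ) = -((Real.exp (-y / 2) : ℝ) *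
    (y * expSum (fun n => if n.Prime then quadCharSum q n else 0) y)) := by
  have h1 := race_eq_neg_sum (q := q) y
  have h2 : Efun q (Real.exp y) = ((primePiNR q (Real.exp y) : ℝ) -
      ((rho q : ℝ) - 1) * primePiR q (Real.exp y)) * (y * Real.exp (-y / 2)) := by
    rw [Efun, Real.log_exp, ← Real.exp_half, mul_div_assoc, neg_div, Real.exp_neg, div_eq_mul_inv y]
  rw [h2, Complex.ofReal_mul, h1]
  push_cast
  ring

lemma expSum_prime_mul_log : expSum (fun n => (if n.Prime then quadCharSum q n else 0) *
    (Real.log n : ℝ)) = expSum (quadTheta q) := by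
  congr 1
  ext n
  rw [quadTheta, ite_mul, zero_mul]

lemma measurable_Efun_exp : Measurable fun y : ℝ => (Efun q (Real.exp y) : ℂ) := by
  simp only [Efun_exp]
  have := measurable_expSum fun n => if n.Prime then quadCharSum q n else 0
  fun_prop

lemma norm_expSum_quadTheta_le (y : ℝ) : ‖expSum (quadTheta q) y‖ ≤
    (quadChars q).card * (Real.log 4 + 4) * Real.exp y := by
  refine norm_expSum_le (by positivity) (fun n => ?_) y
  rw [quadTheta]
  split_ifs with h
  · rw [norm_mul, Complex.norm_real, Real.norm_of_nonneg (Real.log_natCast_nonneg n),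
      ArithmeticFunction.vonMangoldt_apply_prime h]
    exact mul_le_mul_of_nonneg_right (norm_quadCharSum_le q n) (Real.log_natCast_nonneg n)
  · rw [norm_zero]
    exact mul_nonneg (by positivity) ArithmeticFunction.vonMangoldt_nonneg

variable {q}

/-- Away from the quadratic characters, `E_q(e^y)` agrees with the normalised sum of the `Λ χ`
up to a term of vanishing mean square. -/
lemma abelSmall_Efun_add (hGRH : GRH) : AbelSmall fun y => (Efun q (Real.exp y) : ℂ) +
    (Real.exp (-y / 2) : ℝ) * expSum (quadLambda q) y - (rho q - 1 : ℝ) := by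
  have hΦ := isPrimeSum_quad q
  have hZ := isRiemannType_Zfun hGRH q
  have mΛ := measurable_expSum (quadLambda q)
  have mΘ := measurable_expSum (quadTheta q)
  have mψ : Measurable Chebyshev.psi := Chebyshev.psi_mono.measurable
  set ψ₀ : ℝ → ℂ := fun y => ((Real.exp (-y / 2) * Chebyshev.psi (Real.exp (y / 2)) - 1 : ℝ) : ℂ) with hψ₀
  have mψ₀ : Measurable ψ₀ := by
    rw [hψ₀]
    fun_prop
  set R : ℝ → ℂ := fun y => (Real.exp (-y / 2) : ℝ) * (expSum (quadLambda q) y - expSum (quadTheta q) y -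
    ((rho q - 1) * Chebyshev.psi (Real.exp (y / 2)) : ℝ)) with hR
  have mR : Measurable R := by
    rw [hR]
    fun_prop
  have hψ : AbelSmall fun y => ((rho q - 1 : ℝ) : ℂ) * ψ₀ y := (abelSmall_psi hGRH).const_mul _
  have hRs : AbelSmall R := by
    obtain ⟨C, hC⟩ := exists_norm_quad_sub_le q
    refine AbelSmall.of_norm_le_exp (C := C) (c := 1 / 6) (by norm_num) fun y hy => ?_
    rw [hR, norm_mul, Complex.norm_real, Real.norm_of_nonneg (Real.exp_pos _).le]
    refine (mul_le_mul_of_nonneg_left (hC y hy) (Real.exp_pos _).le).trans (le_of_eq ?_)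
    rw [mul_left_comm, ← Real.exp_add]
    congr 2
    ring
  have hΛ : AbelBdd fun y => (Real.exp (-y / 2) : ℝ) * expSum (quadLambda q) y := by
    obtain ⟨T, hT⟩ := hΦ.mean_sq_le hZ one_ne_zero
    obtain ⟨C, hC⟩ := exists_norm_zeroSum_le (Zfun q) T
    have mz : Measurable (zeroSum (Zfun q) T) := (continuous_zeroSum _ _).measurable
    have h1 : AbelBdd fun y => (Real.exp (-y / 2) : ℝ) * (expSum (quadLambda q) y + zeroSum (Zfun q) T y) := by
      refine ⟨1, by norm_num, ?_⟩
      filter_upwards [hT T le_rfl] with ε hε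
      rwa [abelSq_exp_half_mul]
    have h2 : AbelBdd fun y => -((Real.exp (-y / 2) : ℝ) * zeroSum (Zfun q) T y) := by
      refine abelBdd_of_norm_le (C := C) fun y _ => ?_
      rw [norm_neg, norm_mul, Complex.norm_real, Real.norm_of_nonneg (Real.exp_pos _).le]
      refine (mul_le_mul_of_nonneg_left (hC y) (Real.exp_pos _).le).trans (le_of_eq ?_)
      rw [mul_left_comm, ← Real.exp_add]
      ring_nf
      rw [Real.exp_zero, mul_one]
    refine (h1.add (by fun_prop) h2).mono fun y _ => le_of_eq ?_
    congr 1
    ring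
  have hΘ : AbelBdd fun y => (Real.exp (-y / 2) : ℝ) * expSum (quadTheta q) y := by
    have h1 : AbelBdd fun _ : ℝ => -((rho q - 1 : ℝ) : ℂ) := abelBdd_of_norm_le fun _ _ => le_rfl
    refine (((hΛ.add (by fun_prop) hψ.neg.bdd).add (by fun_prop) hRs.neg.bdd).add (by fun_prop) h1).mono
      fun y _ => le_of_eq ?_
    congr 1
    simp only [hR, hψ₀]
    push_cast
    ring
  have hG := abelSmall_mul_expSum_sub (a := fun n => if n.Prime then quadCharSum q n else 0)
    (by simp [Nat.not_prime_one]) (by rw [expSum_prime_mul_log]; exact norm_expSum_quadTheta_le q)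
    (by rw [expSum_prime_mul_log]; exact hΘ)
  rw [expSum_prime_mul_log] at hG
  refine ((hψ.add (by fun_prop) hRs).add (by fun_prop) hG.neg).mono fun y _ => le_of_eq ?_
  congr 1
  simp only [Efun_exp, hR, hψ₀]
  push_cast
  ring

/-- `E_q(e^y)` is approximated in Abel mean square by trigonometric polynomials. -/
lemma abelSq_Efun_sub_trigSum_le (hGRH : GRH) {η : ENNReal} (hη : η ≠ 0) : ∃ T₀ : ℝ, ∀ T ≥ T₀,
    ∀ᶠ ε in 𝓝[>] (0 : ℝ), abelSq (fun y => (Efun q (Real.exp y) : ℂ) - trigSum q T y) ε ≤ η := by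
  have h4 : η / 4 ≠ 0 := (ENNReal.div_pos hη (by norm_num)).ne'
  obtain ⟨T₀, hT₀⟩ := (isPrimeSum_quad q).mean_sq_le (isRiemannType_Zfun hGRH q) h4
  refine ⟨T₀, fun T hT => ?_⟩
  have mΛ := measurable_expSum (quadLambda q)
  have mE := measurable_Efun_exp q
  filter_upwards [hT₀ T hT, abelSmall_Efun_add (q := q) hGRH _ h4] with ε h1 h2
  rw [← abelSq_exp_half_mul, ← abelSq_neg] at h1
  rw [← two_mul_quarter_add η]
  refine le_trans (le_of_eq (abelSq_congr (fun y _ => ?_) ε)) ((abelSq_add_le (by fun_prop) _ ε).trans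
    (add_le_add (mul_le_mul_right h2 _) (mul_le_mul_right h1 _)))
  have := exp_half_mul_zeroSum q T y
  linear_combination this

end

/-- Truncation of a real number to `[-M, M]`. -/
noncomputable def clampTo (M t : ℝ) : ℝ := max (-M) (min t M)

lemma abs_clampTo_le {M : ℝ} (hM : 0 ≤ M) (t : ℝ) : |clampTo M t| ≤ M := by
  rw [clampTo, abs_le]
  exact ⟨le_max_left _ _, max_le (by linarith) (min_le_right _ _)⟩

lemma abs_clampTo_sub_le (M s t : ℝ) : |clampTo M s - clampTo M t| ≤ |s - t| := by
  refine (abs_max_sub_max_le_max _ _ _ _).trans ?_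
  rw [sub_self, abs_zero]
  refine max_le (abs_nonneg _) ((abs_min_sub_min_le_max _ _ _ _).trans ?_)
  rw [sub_self, abs_zero]
  exact max_le le_rfl (abs_nonneg _)

lemma clampTo_of_abs_le {M t : ℝ} (h : |t| ≤ M) : clampTo M t = t := by
  rw [abs_le] at h
  rw [clampTo, min_eq_left h.2, max_eq_right h.1]

lemma continuous_clampTo (M : ℝ) : Continuous (clampTo M) := by
  unfold clampTo
  fun_prop

lemma lipschitzWith_clampTo (M : ℝ) : LipschitzWith 1 (clampTo M) :=
  LipschitzWith.of_dist_le_mul fun s t => by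
    simpa [Real.dist_eq] using abs_clampTo_sub_le M s t

lemma lipschitzWith_clampTo_sq {M : ℝ} (hM : 0 ≤ M) :
    LipschitzWith (Real.toNNReal (2 * M)) fun t => clampTo M t ^ 2 :=
  LipschitzWith.of_dist_le_mul fun s t => by
    rw [Real.dist_eq, Real.dist_eq, Real.coe_toNNReal _ (by positivity),
      show clampTo M s ^ 2 - clampTo M t ^ 2 =
        (clampTo M s + clampTo M t) * (clampTo M s - clampTo M t) by ring, abs_mul]
    refine mul_le_mul ?_ (abs_clampTo_sub_le M s t) (abs_nonneg _) (by positivity)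
    refine (abs_add_le _ _).trans ?_
    linarith [abs_clampTo_le hM s, abs_clampTo_le hM t]

lemma norm_clampTo_sub_sq_le {M : ℝ} (t : ℝ) {z : ℂ} (hz : ‖z‖ ≤ M) :
    ‖(clampTo M t : ℂ) - z‖ ≤ ‖(t : ℂ) - z‖ := by
  have h1 : |clampTo M t - z.re| ≤ |t - z.re| := by
    have := abs_clampTo_sub_le M t z.re
    rwa [clampTo_of_abs_le ((Complex.abs_re_le_norm z).trans hz)] at this
  refine abs_le_of_sq_le_sq' ?_ (norm_nonneg _) |>.2
  rw [← Complex.normSq_eq_norm_sq, ← Complex.normSq_eq_norm_sq, Complex.normSq_apply,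
    Complex.normSq_apply]
  have := sq_le_sq.2 h1
  simp
  nlinarith

lemma abs_sq_sub_norm_sq_le (k : ℝ) (z : ℂ) {δ : ℝ} (hδ : 0 < δ) :
    |k ^ 2 - ‖z‖ ^ 2| ≤ (1 + 1 / δ) * ‖(k : ℂ) - z‖ ^ 2 + δ * k ^ 2 := by
  set d := ‖(k : ℂ) - z‖ with hd
  have h1 : |‖(k : ℂ)‖ - ‖z‖| ≤ d := abs_norm_sub_norm_le _ _
  rw [Complex.norm_real, Real.norm_eq_abs] at h1
  have hd0 : 0 ≤ d := norm_nonneg _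
  rw [← sq_abs k, show |k| ^ 2 - ‖z‖ ^ 2 = (|k| - ‖z‖) * (|k| + ‖z‖) by ring, abs_mul,
    abs_of_nonneg (by positivity : 0 ≤ |k| + ‖z‖)]
  have h2 : |k| + ‖z‖ ≤ 2 * |k| + d := by have := (abs_le.1 h1).1; linarith
  have h3 : 2 * (d * |k|) ≤ 1 / δ * d ^ 2 + δ * |k| ^ 2 := by
    have h4 : 0 ≤ 1 / δ * (d - δ * |k|) ^ 2 := by positivity
    have h5 : 1 / δ * (d - δ * |k|) ^ 2 = 1 / δ * d ^ 2 - 2 * (d * |k|) + δ * |k| ^ 2 := by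
      field_simp
      ring
    linarith
  calc _ ≤ d * (2 * |k| + d) := mul_le_mul h1 h2 (by positivity) hd0
    _ ≤ _ := by nlinarith

lemma le_add_sq_div (d : ℝ) {δ : ℝ} (hδ : 0 < δ) : d ≤ δ + 1 / δ * d ^ 2 := by
  have h4 : 0 ≤ 1 / δ * (d - δ) ^ 2 := by positivity
  have h5 : 1 / δ * (d - δ) ^ 2 = 1 / δ * d ^ 2 - 2 * d + δ := by
    field_simp
    ring
  have h6 : 0 ≤ 1 / δ * d ^ 2 := by positivity
  rcases le_or_gt d 0 with h | h <;> nlinarith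

section
variable {E : ℝ → ℝ} {P : ℝ → ℂ} {μ : Measure ℝ} {M S η : ℝ} {c : ℂ}
  (hE : Measurable E)
  (hμ : ∀ f : ℝ → ℝ, (∃ C : ℝ, ∀ x, |f x| ≤ C) → (∃ K : NNReal, LipschitzWith K f) →
      Tendsto (fun Y : ℝ => (1 / Y) * ∫ y in (2 : ℝ)..Y, f (E y)) atTop (𝓝 (∫ t, f t ∂μ)))
  (hP : Continuous P) (hPM : ∀ y, ‖P y‖ ≤ M)
  (hη : ∀ᶠ Y : ℝ in atTop, ∫⁻ y in Set.Ioc 2 Y, ‖(E y : ℂ) - P y‖ₑ ^ 2 ≤ ENNReal.ofReal (Y * η))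
include hE hP hPM

lemma intervalIntegrable_comp_clampTo {F : Type*} [NormedAddCommGroup F] (φ : ℝ × ℂ → F)
    (hφ : Continuous φ) (a b : ℝ) :
    IntervalIntegrable (fun y => φ (clampTo M (E y), P y)) volume a b := by
  have hM : 0 ≤ M := (norm_nonneg _).trans (hPM 0)
  obtain ⟨C, hC⟩ := ((isCompact_Icc (a := -M) (b := M)).prod
    (isCompact_closedBall (0 : ℂ) M)).exists_bound_of_continuousOn hφ.continuousOn
  rw [intervalIntegrable_iff]
  refine Integrable.mono' (g := fun _ => C) (intervalIntegrable_iff.1 intervalIntegrable_const) ?_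
    (Eventually.of_forall fun y => hC _ ?_)
  · refine hφ.comp_aestronglyMeasurable ?_
    refine AEStronglyMeasurable.prodMk ?_ hP.aestronglyMeasurable
    exact ((continuous_clampTo M).measurable.comp hE).aestronglyMeasurable
  · exact ⟨abs_le.1 (abs_clampTo_le hM _), by simpa using hPM y⟩

include hη in
lemma eventually_integral_clampTo_sub_le :
    ∀ᶠ Y : ℝ in atTop, (1 / Y) * ∫ y in (2 : ℝ)..Y, ‖(clampTo M (E y) : ℂ) - P y‖ ^ 2 ≤ max η 0 := by
  filter_upwards [hη, eventually_gt_atTop 2] with Y hY hY2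
  have hi := intervalIntegrable_comp_clampTo hE hP hPM (fun p => ‖(p.1 : ℂ) - p.2‖ ^ 2)
    (by fun_prop) 2 Y
  rw [intervalIntegrable_iff, Set.uIoc_of_le hY2.le] at hi
  rw [intervalIntegral.integral_of_le hY2.le, one_div, inv_mul_le_iff₀ (by linarith)]
  have h0 : 0 ≤ Y * max η 0 := mul_nonneg (by linarith) (le_max_right _ _)
  rw [← ENNReal.ofReal_le_ofReal_iff h0, ofReal_integral_eq_lintegral_ofReal hi
    (Eventually.of_forall fun y => by positivity)]
  calc _ ≤ ∫⁻ y in Set.Ioc 2 Y, ‖(E y : ℂ) - P y‖ₑ ^ 2 := by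
        refine lintegral_mono fun y => ?_
        rw [← ofReal_norm, ← ENNReal.ofReal_pow (norm_nonneg _)]
        exact ENNReal.ofReal_le_ofReal
          (pow_le_pow_left₀ (norm_nonneg _) (norm_clampTo_sub_sq_le _ (hPM y)) 2)
    _ ≤ _ := hY.trans (ENNReal.ofReal_le_ofReal
        (mul_le_mul_of_nonneg_left (le_max_left _ _) (by linarith)))

include hμ hη in
lemma abs_integral_clampTo_sq_sub_le
    (hS : Tendsto (fun Y : ℝ => (1 / Y) * ∫ y in (2 : ℝ)..Y, ‖P y‖ ^ 2) atTop (𝓝 S))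
    {δ : ℝ} (hδ : 0 < δ) :
    |∫ t, clampTo M t ^ 2 ∂μ - S| ≤ (1 + 1 / δ) * max η 0 + δ * ∫ t, clampTo M t ^ 2 ∂μ := by
  have hM : 0 ≤ M := (norm_nonneg _).trans (hPM 0)
  have h1 := hμ (fun t => clampTo M t ^ 2)
    ⟨M ^ 2, fun t => by rw [abs_pow]; exact pow_le_pow_left₀ (abs_nonneg _) (abs_clampTo_le hM t) 2⟩
    ⟨_, lipschitzWith_clampTo_sq hM⟩
  refine le_of_tendsto_of_tendsto (h1.sub hS).abs ((h1.const_mul δ).const_add _) ?_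
  filter_upwards [eventually_integral_clampTo_sub_le hE hP hPM hη, eventually_gt_atTop 2] with Y hY hY2
  have hY0 : 0 ≤ 1 / Y := by
    have : 0 < Y := by linarith
    positivity
  have i1 := intervalIntegrable_comp_clampTo hE hP hPM (fun p => p.1 ^ 2) (by fun_prop) 2 Y
  have i2 := intervalIntegrable_comp_clampTo hE hP hPM (fun p => ‖p.2‖ ^ 2) (by fun_prop) 2 Y
  have i3 := intervalIntegrable_comp_clampTo hE hP hPM (fun p => ‖(p.1 : ℂ) - p.2‖ ^ 2)
    (by fun_prop) 2 Y
  rw [← mul_sub, ← intervalIntegral.integral_sub i1 i2, abs_mul, abs_of_nonneg hY0]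
  have h2 : |∫ y in (2 : ℝ)..Y, clampTo M (E y) ^ 2 - ‖P y‖ ^ 2| ≤
      (1 + 1 / δ) * (∫ y in (2 : ℝ)..Y, ‖(clampTo M (E y) : ℂ) - P y‖ ^ 2) +
        δ * ∫ y in (2 : ℝ)..Y, clampTo M (E y) ^ 2 := by
    rw [← intervalIntegral.integral_const_mul, ← intervalIntegral.integral_const_mul,
      ← intervalIntegral.integral_add (i3.const_mul _) (i1.const_mul _)]
    refine (intervalIntegral.abs_integral_le_integral_abs hY2.le).trans ?_
    refine intervalIntegral.integral_mono_on hY2.le (i1.sub i2).abs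
      ((i3.const_mul _).add (i1.const_mul _)) fun y _ => ?_
    exact abs_sq_sub_norm_sq_le _ _ hδ
  calc _ ≤ _ := mul_le_mul_of_nonneg_left h2 hY0
    _ = (1 + 1 / δ) * ((1 / Y) * ∫ y in (2 : ℝ)..Y, ‖(clampTo M (E y) : ℂ) - P y‖ ^ 2) +
        δ * ((1 / Y) * ∫ y in (2 : ℝ)..Y, clampTo M (E y) ^ 2) := by ring
    _ ≤ _ := by gcongr

include hμ hη in
lemma norm_integral_clampTo_sub_le
    (hc : Tendsto (fun Y : ℝ => (1 / Y : ℂ) * ∫ y in (2 : ℝ)..Y, P y) atTop (𝓝 c))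
    {δ : ℝ} (hδ : 0 < δ) :
    ‖((∫ t, clampTo M t ∂μ : ℝ) : ℂ) - c‖ ≤ δ + 1 / δ * max η 0 := by
  have hM : 0 ≤ M := (norm_nonneg _).trans (hPM 0)
  have h1 := hμ (clampTo M) ⟨M, abs_clampTo_le hM⟩ ⟨_, lipschitzWith_clampTo M⟩
  have h1' := (Complex.continuous_ofReal.tendsto _).comp h1
  refine le_of_tendsto (h1'.sub hc).norm ?_
  filter_upwards [eventually_integral_clampTo_sub_le hE hP hPM hη, eventually_gt_atTop 2] with Y hY hY2
  have hYp : 0 < Y := by linarith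
  have hY0 : 0 ≤ 1 / Y := by positivity
  have i1 := intervalIntegrable_comp_clampTo hE hP hPM (fun p => (p.1 : ℂ)) (by fun_prop) 2 Y
  have i2 := intervalIntegrable_comp_clampTo hE hP hPM (fun p => p.2) (by fun_prop) 2 Y
  have i3 := intervalIntegrable_comp_clampTo hE hP hPM (fun p => ‖(p.1 : ℂ) - p.2‖ ^ 2)
    (by fun_prop) 2 Y
  have h2 : ‖∫ y in (2 : ℝ)..Y, ((clampTo M (E y) : ℂ) - P y)‖ ≤
      δ * Y + 1 / δ * ∫ y in (2 : ℝ)..Y, ‖(clampTo M (E y) : ℂ) - P y‖ ^ 2 := by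
    have h3 : ∫ y in (2 : ℝ)..Y, (δ + 1 / δ * ‖(clampTo M (E y) : ℂ) - P y‖ ^ 2) ≤
        δ * Y + 1 / δ * ∫ y in (2 : ℝ)..Y, ‖(clampTo M (E y) : ℂ) - P y‖ ^ 2 := by
      rw [intervalIntegral.integral_add (by simp) (i3.const_mul _), intervalIntegral.integral_const_mul,
        intervalIntegral.integral_const, smul_eq_mul]
      nlinarith
    refine (intervalIntegral.norm_integral_le_integral_norm hY2.le).trans (le_trans ?_ h3)
    refine intervalIntegral.integral_mono_on hY2.le (i1.sub i2).norm
      (IntervalIntegrable.add (by simp) (i3.const_mul _)) fun y _ => ?_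
    exact le_add_sq_div _ hδ
  have e : (((1 / Y) * ∫ y in (2 : ℝ)..Y, clampTo M (E y) : ℝ) : ℂ) - (1 / Y : ℂ) * ∫ y in (2 : ℝ)..Y, P y =
      ((1 / Y : ℝ) : ℂ) * ∫ y in (2 : ℝ)..Y, ((clampTo M (E y) : ℂ) - P y) := by
    rw [intervalIntegral.integral_sub i1 i2, intervalIntegral.integral_ofReal]
    push_cast
    ring
  change ‖(((1 / Y) * ∫ y in (2 : ℝ)..Y, clampTo M (E y) : ℝ) : ℂ) -
    (1 / Y : ℂ) * ∫ y in (2 : ℝ)..Y, P y‖ ≤ _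
  rw [e, norm_mul, Complex.norm_real, Real.norm_of_nonneg hY0]
  calc _ ≤ _ := mul_le_mul_of_nonneg_left h2 hY0
    _ = δ + 1 / δ * ((1 / Y) * ∫ y in (2 : ℝ)..Y, ‖(clampTo M (E y) : ℂ) - P y‖ ^ 2) := by
      field_simp
    _ ≤ _ := by gcongr

end

lemma tendsto_mean_exp (γ : ℝ) :
    Tendsto (fun Y : ℝ => (1 / Y : ℂ) * ∫ y in (2 : ℝ)..Y, Complex.exp (γ * y * Complex.I)) atTop
      (𝓝 (if γ = 0 then 1 else 0)) := by
  split_ifs with h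
  · subst h
    have h1 : Tendsto (fun Y : ℝ => ((1 - 2 * Y⁻¹ : ℝ) : ℂ)) atTop (𝓝 ((1 - 2 * 0 : ℝ) : ℂ)) :=
      (Complex.continuous_ofReal.tendsto _).comp ((tendsto_inv_atTop_zero.const_mul 2).const_sub 1)
    simp only [mul_zero, sub_zero, Complex.ofReal_one] at h1
    refine h1.congr' ?_
    filter_upwards [eventually_gt_atTop 0] with Y hY
    have : (Y : ℂ) ≠ 0 := by exact_mod_cast hY.ne'
    simp only [Complex.ofReal_zero, zero_mul, Complex.exp_zero, intervalIntegral.integral_const]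
    rw [Complex.real_smul]
    push_cast
    field_simp
  · rw [tendsto_zero_iff_norm_tendsto_zero]
    have h1 : Tendsto (fun Y : ℝ => Y⁻¹ * (2 / |γ|)) atTop (𝓝 (0 * (2 / |γ|))) :=
      tendsto_inv_atTop_zero.mul_const _
    rw [zero_mul] at h1
    refine squeeze_zero' (Eventually.of_forall fun _ => norm_nonneg _) ?_ h1
    filter_upwards [eventually_gt_atTop 0] with Y hY
    have hc : (γ : ℂ) * Complex.I ≠ 0 := mul_ne_zero (by exact_mod_cast h) Complex.I_ne_zero
    have h2 : ∀ y : ℝ, Complex.exp (γ * y * Complex.I) = Complex.exp (γ * Complex.I * y) := fun y => by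
      congr 1
      ring
    simp only [h2]
    rw [integral_exp_mul_complex hc, norm_mul, norm_div, norm_div, norm_one, Complex.norm_real, norm_mul,
      Complex.norm_I, mul_one, Complex.norm_real, Real.norm_of_nonneg hY.le, one_div, Real.norm_eq_abs]
    refine mul_le_mul_of_nonneg_left ?_ (inv_nonneg.2 hY.le)
    refine div_le_div_of_nonneg_right ((norm_sub_le _ _).trans ?_) (abs_nonneg γ)
    rw [← h2, ← h2, Complex.norm_exp, Complex.norm_exp]
    norm_num

/-- The trigonometric polynomial with coefficients `c γ` and frequencies in `F`. -/
noncomputable def trigPoly (F : Finset ℝ) (c : ℝ → ℂ) (y : ℝ) : ℂ :=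
  ∑ γ ∈ F, c γ * Complex.exp (γ * y * Complex.I)

lemma continuous_trigPoly (F : Finset ℝ) (c : ℝ → ℂ) : Continuous (trigPoly F c) := by
  unfold trigPoly
  fun_prop

lemma norm_trigPoly_le (F : Finset ℝ) (c : ℝ → ℂ) (y : ℝ) : ‖trigPoly F c y‖ ≤ ∑ γ ∈ F, ‖c γ‖ := by
  refine (norm_sum_le _ _).trans (Finset.sum_le_sum fun γ _ => ?_)
  rw [norm_mul, Complex.norm_exp]
  simp

lemma tendsto_mean_trigPoly {ι : Type*} (F : Finset ι) (c : ι → ℂ) (γ : ι → ℝ) :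
    Tendsto (fun Y : ℝ => (1 / Y : ℂ) * ∫ y in (2 : ℝ)..Y,
      ∑ i ∈ F, c i * Complex.exp (γ i * y * Complex.I)) atTop
      (𝓝 (∑ i ∈ F, if γ i = 0 then c i else 0)) := by
  have h : Tendsto (fun Y : ℝ => ∑ i ∈ F, c i * ((1 / Y : ℂ) * ∫ y in (2 : ℝ)..Y,
      Complex.exp (γ i * y * Complex.I))) atTop (𝓝 (∑ i ∈ F, c i * if γ i = 0 then 1 else 0)) :=
    tendsto_finsetSum _ fun i _ => (tendsto_mean_exp _).const_mul _
  simp only [mul_ite, mul_one, mul_zero] at h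
  refine h.congr fun Y => ?_
  rw [intervalIntegral.integral_finsetSum, Finset.mul_sum]
  · refine Finset.sum_congr rfl fun i _ => ?_
    rw [intervalIntegral.integral_const_mul]
    ring
  · intro i _
    exact Continuous.intervalIntegrable (by fun_prop) _ _

lemma tendsto_mean_norm_sq_trigPoly (F : Finset ℝ) (c : ℝ → ℂ) :
    Tendsto (fun Y : ℝ => (1 / Y) * ∫ y in (2 : ℝ)..Y, ‖trigPoly F c y‖ ^ 2) atTop
      (𝓝 (∑ γ ∈ F, ‖c γ‖ ^ 2)) := by
  have h1 := tendsto_mean_trigPoly (F ×ˢ F) (fun p => c p.1 * (starRingEnd ℂ) (c p.2))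
    (fun p => p.1 - p.2)
  have h2 : ∑ p ∈ F ×ˢ F, (if p.1 - p.2 = 0 then c p.1 * (starRingEnd ℂ) (c p.2) else 0) =
      ((∑ γ ∈ F, ‖c γ‖ ^ 2 : ℝ) : ℂ) := by
    rw [Finset.sum_product, Complex.ofReal_sum]
    refine Finset.sum_congr rfl fun γ hγ => ?_
    simp only [sub_eq_zero]
    rw [Finset.sum_ite_eq, if_pos hγ, Complex.mul_conj']
    push_cast
    rfl
  rw [h2] at h1
  have h3 := (Complex.continuous_re.tendsto _).comp h1
  rw [Complex.ofReal_re] at h3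
  refine h3.congr fun Y => ?_
  have h4 : ∀ y : ℝ, ∑ p ∈ F ×ˢ F, c p.1 * (starRingEnd ℂ) (c p.2) *
      Complex.exp ((p.1 - p.2 : ℝ) * y * Complex.I) = ((‖trigPoly F c y‖ ^ 2 : ℝ) : ℂ) := by
    intro y
    rw [Complex.ofReal_pow, ← Complex.mul_conj', trigPoly, map_sum, Finset.sum_mul_sum,
      Finset.sum_product]
    refine Finset.sum_congr rfl fun γ _ => Finset.sum_congr rfl fun δ _ => ?_
    rw [map_mul, ← Complex.exp_conj, mul_mul_mul_comm, ← Complex.exp_add]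
    congr 2
    simp only [map_mul, Complex.conj_ofReal, Complex.conj_I]
    push_cast
    ring
  simp only [Function.comp_apply, h4]
  rw [intervalIntegral.integral_ofReal, ← Complex.ofReal_one, ← Complex.ofReal_div, ← Complex.ofReal_mul,
    Complex.ofReal_re]

/-- The first two moments of a limiting distribution, from approximations in quadratic mean. -/
lemma moments_of_approx {E : ℝ → ℝ} {μ : Measure ℝ} [IsProbabilityMeasure μ] (hE : Measurable E)
    (hμ : ∀ f : ℝ → ℝ, (∃ C : ℝ, ∀ x, |f x| ≤ C) → (∃ K : NNReal, LipschitzWith K f) →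
      Tendsto (fun Y : ℝ => (1 / Y) * ∫ y in (2 : ℝ)..Y, f (E y)) atTop (𝓝 (∫ t, f t ∂μ)))
    {P : ℝ → ℝ → ℂ} {S : ℝ → ℝ} {c : ℂ} (hP : ∀ T, Continuous (P T))
    (hb : ∀ T, ∃ M, ∀ y, ‖P T y‖ ≤ M)
    (hS : ∀ T, Tendsto (fun Y : ℝ => (1 / Y) * ∫ y in (2 : ℝ)..Y, ‖P T y‖ ^ 2) atTop (𝓝 (S T)))
    (hc : ∀ T, Tendsto (fun Y : ℝ => (1 / Y : ℂ) * ∫ y in (2 : ℝ)..Y, P T y) atTop (𝓝 c))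
    (happ : ∀ η : ℝ, 0 < η → ∃ T₀ : ℝ, ∀ T ≥ T₀, ∀ᶠ Y : ℝ in atTop,
      ∫⁻ y in Set.Ioc 2 Y, ‖(E y : ℂ) - P T y‖ₑ ^ 2 ≤ ENNReal.ofReal (Y * η)) :
    Tendsto S atTop (𝓝 (∫ t, t ^ 2 ∂μ)) ∧ ((∫ t, t ∂μ : ℝ) : ℂ) = c := by
  set N : ℕ → ℝ := fun n => ∫ t, clampTo n t ^ 2 ∂μ with hN
  have hlarge : ∀ T, ∀ᶠ n : ℕ in atTop, ∀ y, ‖P T y‖ ≤ n := fun T => by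
    obtain ⟨M, hM⟩ := hb T
    filter_upwards [eventually_ge_atTop ⌈M⌉₊] with n hn y
    exact (hM y).trans ((Nat.le_ceil M).trans (by exact_mod_cast hn))
  have hsq_le : ∀ (n : ℕ) (t : ℝ), clampTo n t ^ 2 ≤ t ^ 2 := fun n t => by
    have := abs_clampTo_sub_le n t 0
    rw [clampTo_of_abs_le (M := (n : ℝ)) (t := 0) (by simp), sub_zero, sub_zero] at this
    exact sq_le_sq.2 this
  have hlim : ∀ t : ℝ, ∀ᶠ n : ℕ in atTop, clampTo n t = t := fun t => by
    filter_upwards [eventually_ge_atTop ⌈|t|⌉₊] with n hn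
    exact clampTo_of_abs_le ((Nat.le_ceil _).trans (by exact_mod_cast hn))
  have hcm : ∀ n : ℕ, Measurable (clampTo n) := fun n => (continuous_clampTo _).measurable
  have hci : ∀ n : ℕ, Integrable (fun t => clampTo n t ^ 2) μ := fun n => by
    refine Integrable.mono' (g := fun _ => (n : ℝ) ^ 2) (integrable_const _)
      ((hcm n).pow_const 2).aestronglyMeasurable (Eventually.of_forall fun t => ?_)
    rw [norm_pow]
    exact pow_le_pow_left₀ (norm_nonneg _) (abs_clampTo_le n.cast_nonneg t) 2
  have hi2 : Integrable (fun t : ℝ => t ^ 2) μ := by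
    obtain ⟨T, hT⟩ := happ 1 one_pos
    have hB : ∀ᶠ n : ℕ in atTop, N n ≤ 2 * S T + 6 := by
      filter_upwards [hlarge T] with n hn
      have := abs_integral_clampTo_sq_sub_le hE hμ (hP T) hn (hT T le_rfl) (hS T)
        (δ := 1 / 2) (by norm_num)
      have h2 := (abs_le.1 this).2
      norm_num at h2
      simp only [hN]
      linarith
    have hle : ∫⁻ t, ENNReal.ofReal (t ^ 2) ∂μ ≤ ENNReal.ofReal (2 * S T + 6) := by
      calc ∫⁻ t, ENNReal.ofReal (t ^ 2) ∂μ
          = ∫⁻ t, liminf (fun n : ℕ => ENNReal.ofReal (clampTo n t ^ 2)) atTop ∂μ := by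
            refine lintegral_congr fun t => ?_
            refine (Tendsto.liminf_eq ?_).symm
            refine tendsto_const_nhds.congr' ?_
            filter_upwards [hlim t] with n hn
            rw [hn]
        _ ≤ liminf (fun n : ℕ => ∫⁻ t, ENNReal.ofReal (clampTo n t ^ 2) ∂μ) atTop :=
            lintegral_liminf_le fun n => ((hcm n).pow_const 2).ennreal_ofReal
        _ ≤ ENNReal.ofReal (2 * S T + 6) := by
            refine liminf_le_of_frequently_le' (Eventually.frequently ?_)
            filter_upwards [hB] with n hn
            rw [← ofReal_integral_eq_lintegral_ofReal (hci n)
              (Eventually.of_forall fun t => sq_nonneg _)]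
            exact ENNReal.ofReal_le_ofReal hn
    rw [← lintegral_ofReal_ne_top_iff_integrable (by fun_prop)
      (Eventually.of_forall fun t => sq_nonneg _)]
    exact ne_top_of_le_ne_top ENNReal.ofReal_ne_top hle
  have hi1 : Integrable (fun t : ℝ => 1 + t ^ 2) μ := (integrable_const _).add hi2
  have hNlim : Tendsto N atTop (𝓝 (∫ t, t ^ 2 ∂μ)) := by
    refine tendsto_integral_of_dominated_convergence (fun t => t ^ 2)
      (fun n => ((hcm n).pow_const 2).aestronglyMeasurable) hi2
      (fun n => Eventually.of_forall fun t => ?_) (Eventually.of_forall fun t => ?_)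
    · rw [Real.norm_of_nonneg (sq_nonneg _)]
      exact hsq_le n t
    · refine tendsto_const_nhds.congr' ?_
      filter_upwards [hlim t] with n hn
      rw [hn]
  have hMlim : Tendsto (fun n : ℕ => ∫ t, clampTo n t ∂μ) atTop (𝓝 (∫ t, t ∂μ)) := by
    refine tendsto_integral_of_dominated_convergence (fun t => 1 + t ^ 2)
      (fun n => (hcm n).aestronglyMeasurable) hi1
      (fun n => Eventually.of_forall fun t => ?_) (Eventually.of_forall fun t => ?_)
    · rw [Real.norm_eq_abs]
      have h1 := hsq_le n t
      rw [← sq_abs] at h1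
      nlinarith [sq_nonneg (|clampTo n t| - 1)]
    · refine tendsto_const_nhds.congr' ?_
      filter_upwards [hlim t] with n hn
      rw [hn]
  set m := ∫ t, t ^ 2 ∂μ with hm
  have hm0 : 0 ≤ m := integral_nonneg fun t => sq_nonneg t
  have key : ∀ δ : ℝ, 0 < δ → ∃ T₀ : ℝ, ∀ T ≥ T₀,
      |m - S T| ≤ (1 + 1 / δ) * δ ^ 2 + δ * m ∧
      ‖((∫ t, t ∂μ : ℝ) : ℂ) - c‖ ≤ δ + 1 / δ * δ ^ 2 := by
    intro δ hδ
    have hδ2 : 0 < δ ^ 2 := by positivity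
    obtain ⟨T₀, hT₀⟩ := happ (δ ^ 2) hδ2
    refine ⟨T₀, fun T hT => ⟨?_, ?_⟩⟩
    · refine le_of_tendsto_of_tendsto (hNlim.sub_const (S T)).abs
        ((hNlim.const_mul δ).const_add ((1 + 1 / δ) * δ ^ 2)) ?_
      filter_upwards [hlarge T] with n hn
      have := abs_integral_clampTo_sq_sub_le hE hμ (hP T) hn (hT₀ T hT) (hS T) hδ
      rwa [max_eq_left hδ2.le] at this
    · have h1 : Tendsto (fun n : ℕ => ((∫ t, clampTo n t ∂μ : ℝ) : ℂ)) atTop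
          (𝓝 ((∫ t, t ∂μ : ℝ) : ℂ)) := (Complex.continuous_ofReal.tendsto _).comp hMlim
      refine le_of_tendsto (h1.sub_const c).norm ?_
      filter_upwards [hlarge T] with n hn
      have := norm_integral_clampTo_sub_le hE hμ (hP T) hn (hT₀ T hT) (hc T) hδ
      rwa [max_eq_left hδ2.le] at this
  constructor
  · rw [Metric.tendsto_atTop]
    intro ε hε
    set δ := min 1 (ε / (3 + m)) with hδdef
    have hδ : 0 < δ := lt_min one_pos (by positivity)
    obtain ⟨T₀, hT₀⟩ := key δ hδ
    refine ⟨T₀, fun T hT => ?_⟩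
    rw [Real.dist_eq, abs_sub_comm]
    refine (hT₀ T hT).1.trans_lt ?_
    have h1 : δ ≤ 1 := min_le_left _ _
    have h2 : δ * (3 + m) ≤ ε := by
      rw [← le_div_iff₀ (by positivity)]
      exact min_le_right _ _
    have h3 : (1 + 1 / δ) * δ ^ 2 = δ ^ 2 + δ := by field_simp
    rw [h3]
    nlinarith
  · rw [← sub_eq_zero, ← norm_le_zero_iff]
    refine le_of_forall_pos_le_add fun ε hε => ?_
    obtain ⟨T₀, hT₀⟩ := key (ε / 2) (by positivity)
    refine (hT₀ T₀ le_rfl).2.trans (le_of_eq ?_)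
    field_simp
    ring

/-- An Abel mean square dominates the ordinary mean square, up to a constant. -/
lemma lintegral_Ioc_le_of_abelSq_le {h : ℝ → ℂ} (hh : Measurable h) {Y η : ℝ} (hY : 0 < Y)
    (hη : abelSq h Y⁻¹ ≤ ENNReal.ofReal (η * Real.exp (-2))) :
    ∫⁻ y in Set.Ioc 2 Y, ‖h y‖ₑ ^ 2 ≤ ENNReal.ofReal (Y * η) := by
  have h1 : (∫⁻ y in Set.Ioc 2 Y, ‖h y‖ₑ ^ 2) * ENNReal.ofReal (Real.exp (-2)) ≤
      ∫⁻ y in Set.Ici 0, ‖h y‖ₑ ^ 2 * ENNReal.ofReal (Real.exp (-(2 * Y⁻¹) * y)) := by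
    rw [← lintegral_mul_const _ (by fun_prop)]
    refine (setLIntegral_mono' measurableSet_Ioc fun y hy => ?_).trans
      (lintegral_mono_set fun y hy => (zero_le_two.trans hy.1.le : (0 : ℝ) ≤ y))
    refine mul_le_mul_right (ENNReal.ofReal_le_ofReal (Real.exp_le_exp.2 ?_)) _
    have : Y⁻¹ * y ≤ 1 := by
      rw [inv_mul_le_one₀ hY]
      exact hy.2
    linarith
  have h2 : ENNReal.ofReal (Y * Real.exp 2) * (ENNReal.ofReal Y⁻¹ *
      ENNReal.ofReal (Real.exp (-2))) = 1 := by
    rw [← ENNReal.ofReal_mul (by positivity), ← ENNReal.ofReal_mul (by positivity), Real.exp_neg]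
    rw [show Y * Real.exp 2 * (Y⁻¹ * (Real.exp 2)⁻¹) = 1 by field_simp, ENNReal.ofReal_one]
  calc ∫⁻ y in Set.Ioc 2 Y, ‖h y‖ₑ ^ 2
      = ENNReal.ofReal (Y * Real.exp 2) * (ENNReal.ofReal Y⁻¹ *
          ((∫⁻ y in Set.Ioc 2 Y, ‖h y‖ₑ ^ 2) * ENNReal.ofReal (Real.exp (-2)))) := by
        rw [mul_comm (∫⁻ y in Set.Ioc 2 Y, ‖h y‖ₑ ^ 2), ← mul_assoc (ENNReal.ofReal Y⁻¹), ← mul_assoc,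
          h2, one_mul]
    _ ≤ ENNReal.ofReal (Y * Real.exp 2) * abelSq h Y⁻¹ :=
        mul_le_mul_right (mul_le_mul_right h1 _) _
    _ ≤ ENNReal.ofReal (Y * Real.exp 2) * ENNReal.ofReal (η * Real.exp (-2)) := mul_le_mul_right hη _
    _ = ENNReal.ofReal (Y * η) := by
        rw [← ENNReal.ofReal_mul (by positivity), Real.exp_neg]
        congr 1
        field_simp

/-- The Fourier coefficients of `E_q(e^y)`. -/
noncomputable def trigCoeff (q : ℕ) (γ : ℝ) : ℂ :=
  (critMult (Zfun q) γ : ℂ) / critPt γ + if γ = 0 then ((rho q - 1 : ℝ) : ℂ) else 0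

lemma trigPoly_eq_trigSum {q : ℕ} (hZ : IsRiemannType (Zfun q)) {T : ℝ} (hT : 0 ≤ T) (y : ℝ) :
    trigPoly (insert 0 (zeroFinset (Zfun q) T)) (trigCoeff q) y = trigSum q T y := by
  simp only [trigPoly, trigCoeff, add_mul, Finset.sum_add_distrib, trigSum, ite_mul, zero_mul]
  rw [Finset.sum_ite_eq', if_pos (Finset.mem_insert_self _ _), add_comm]
  congr 1
  · simp
  · rw [Finset.sum_insert_of_eq_zero_if_notMem]
    intro h
    have h1 : Zfun q (critPt 0) ≠ 0 := fun h0 => h (hZ.mem_zeroFinset.2 ⟨by simpa using hT, h0⟩)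
    rw [hZ.critMult_eq_zero h1]
    simp

lemma norm_sq_critPt (γ : ℝ) : ‖critPt γ‖ ^ 2 = 1 / 4 + γ ^ 2 := by
  rw [Complex.sq_norm, Complex.normSq_apply, critPt_re, critPt_im]
  ring

lemma norm_sq_trigCoeff (q : ℕ) {γ : ℝ} (hγ : γ ≠ 0) :
    ‖trigCoeff q γ‖ ^ 2 = (critMult (Zfun q) γ : ℝ) ^ 2 / (1 / 4 + γ ^ 2) := by
  rw [trigCoeff, if_neg hγ, add_zero, norm_div, div_pow, norm_sq_critPt, Complex.norm_natCast]

/-- The second moment of a limiting distribution of `E_q`, and its mean. -/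
lemma IsLimitingDistribution.moments (hGRH : GRH) {q : ℕ} [NeZero q] {μ : Measure ℝ}
    (hμ : IsLimitingDistribution q μ) :
    Tendsto (fun T : ℝ => ∑ γ ∈ insert 0 (zeroFinset (Zfun q) T), ‖trigCoeff q γ‖ ^ 2) atTop
      (𝓝 (∫ t, t ^ 2 ∂μ)) ∧ ((∫ t, t ∂μ : ℝ) : ℂ) = trigCoeff q 0 := by
  have hZ := isRiemannType_Zfun hGRH q
  obtain ⟨hp, hl⟩ := hμ
  have hm : Measurable fun y : ℝ => Efun q (Real.exp y) := by
    exact (Complex.measurable_re.comp (measurable_Efun_exp q) :)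
  refine moments_of_approx hm hl (P := fun T => trigPoly (insert 0 (zeroFinset (Zfun q) T)) (trigCoeff q))
    (fun T => continuous_trigPoly _ _) (fun T => ⟨_, norm_trigPoly_le _ _⟩)
    (fun T => tendsto_mean_norm_sq_trigPoly _ _) (fun T => ?_) (fun η hη => ?_)
  · have := tendsto_mean_trigPoly (insert 0 (zeroFinset (Zfun q) T)) (trigCoeff q) (fun γ => γ)
    rw [Finset.sum_ite_eq', if_pos (Finset.mem_insert_self _ _)] at this
    exact this
  · obtain ⟨T₀, hT₀⟩ := abelSq_Efun_sub_trigSum_le (q := q) hGRH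
      (η := ENNReal.ofReal (η * Real.exp (-2))) (by positivity)
    refine ⟨max T₀ 0, fun T hT => ?_⟩
    filter_upwards [tendsto_inv_atTop_nhdsGT_zero.eventually (hT₀ T ((le_max_left _ _).trans hT)),
      eventually_gt_atTop 0] with Y h1 hY
    simp only [trigPoly_eq_trigSum hZ ((le_max_right _ _).trans hT)]
    refine lintegral_Ioc_le_of_abelSq_le ((measurable_Efun_exp q).sub ?_) hY h1
    have := (continuous_trigPoly (insert 0 (zeroFinset (Zfun q) T)) (trigCoeff q)).measurable
    rwa [funext (trigPoly_eq_trigSum hZ ((le_max_right _ _).trans hT))] at this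

/-- The variance of a limiting distribution of `E_q` as a sum over zeros. -/
lemma IsLimitingDistribution.hasSum (hGRH : GRH) {q : ℕ} [NeZero q] {μ : Measure ℝ}
    (hμ : IsLimitingDistribution q μ) :
    HasSum (fun γ : {γ : ℝ // γ ≠ 0} => (critMult (Zfun q) γ : ℝ) ^ 2 / (1 / 4 + (γ : ℝ) ^ 2))
      ((∫ t, t ^ 2 ∂μ) - (∫ t, t ∂μ) ^ 2) := by
  have hZ := isRiemannType_Zfun hGRH q
  obtain ⟨h2, h1⟩ := hμ.moments hGRH
  have hsq : (∫ t, t ∂μ) ^ 2 = ‖trigCoeff q 0‖ ^ 2 := by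
    rw [← h1, Complex.norm_real, Real.norm_eq_abs, sq_abs]
  set g : ℝ → ℝ := fun γ => (critMult (Zfun q) γ : ℝ) ^ 2 / (1 / 4 + γ ^ 2) with hg
  have hg0 : ∀ γ, 0 ≤ g γ := fun γ => by positivity
  have hlim : Tendsto (fun T : ℝ => ∑ γ ∈ (zeroFinset (Zfun q) T).erase 0, g γ) atTop
      (𝓝 ((∫ t, t ^ 2 ∂μ) - (∫ t, t ∂μ) ^ 2)) := by
    rw [hsq]
    refine (h2.sub_const _).congr fun T => ?_
    rw [← Finset.add_sum_erase _ _ (Finset.mem_insert_self 0 _), Finset.erase_insert_eq_erase,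
      add_sub_cancel_left]
    exact Finset.sum_congr rfl fun γ hγ => norm_sq_trigCoeff q (Finset.ne_of_mem_erase hγ)
  have hmono : Monotone fun T : ℝ => ∑ γ ∈ (zeroFinset (Zfun q) T).erase 0, g γ := fun S T hST =>
    Finset.sum_le_sum_of_subset_of_nonneg (Finset.erase_subset_erase _ fun γ hγ => by
      rw [hZ.mem_zeroFinset] at hγ ⊢
      exact ⟨hγ.1.trans hST, hγ.2⟩) fun γ _ _ => hg0 γ
  refine hasSum_of_isLUB_of_nonneg _ (fun γ => hg0 γ) ⟨?_, fun b hb => ?_⟩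
  · rintro _ ⟨s, rfl⟩
    obtain ⟨T, hT⟩ : ∃ T, ∀ γ ∈ s, |(γ : ℝ)| ≤ T :=
      ⟨∑ γ ∈ s, |(γ : ℝ)|, fun γ hγ =>
        Finset.single_le_sum (f := fun γ : {γ : ℝ // γ ≠ 0} => |(γ : ℝ)|) (fun _ _ => abs_nonneg _) hγ⟩
    refine le_trans ?_ (hmono.ge_of_tendsto hlim T)
    change ∑ γ ∈ s, g γ ≤ _
    rw [show ∑ γ ∈ s, g γ = ∑ γ ∈ s.map (Function.Embedding.subtype _), g γ from
      (Finset.sum_map s (Function.Embedding.subtype _) g).symm,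
      ← Finset.sum_filter_of_ne (p := fun γ => Zfun q (critPt γ) = 0)]
    · refine Finset.sum_le_sum_of_subset_of_nonneg (fun γ hγ => ?_) fun γ _ _ => hg0 γ
      obtain ⟨hγ1, hγ2⟩ := Finset.mem_filter.1 hγ
      obtain ⟨δ, hδ, rfl⟩ := Finset.mem_map.1 hγ1
      exact Finset.mem_erase.2 ⟨δ.2, hZ.mem_zeroFinset.2 ⟨hT δ hδ, hγ2⟩⟩
    · intro γ _ hne
      by_contra h0
      refine hne ?_
      simp [hg, hZ.critMult_eq_zero h0]
  · refine le_of_tendsto' hlim fun T => ?_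
    refine le_trans (le_of_eq ?_) (hb ⟨((zeroFinset (Zfun q) T).erase 0).subtype (· ≠ 0), rfl⟩)
    exact (Finset.sum_subtype_of_mem g fun γ hγ => Finset.ne_of_mem_erase hγ).symm

theorem variance_of_limiting_distribution (hGRH : GRH) (q : ℕ) (hq : 3 ≤ q)
    (μ : MeasureTheory.Measure ℝ) (hμ : IsLimitingDistribution q μ) :
    (∫ t, t ^ 2 ∂μ) - (∫ t, t ∂μ) ^ 2 =
      ∑' γ : {γ : ℝ // γ ≠ 0},
        ((zeroMult (Zfun q) (1 / 2 + (γ : ℝ) * Complex.I) : ℝ)) ^ 2 /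
          (1 / 4 + (γ : ℝ) ^ 2) := by
  have : NeZero q := ⟨by omega⟩
  simp only [(isRiemannType_Zfun hGRH q).zeroMult_eq]
  exact (hμ.hasSum hGRH).tsum_eq.symm
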